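/- arXiv:math/0701017 — 8 statements merged into one kernel-verified Lean document; each statement's English description precedes it below -/
import Mathlib

section
/- (Extended Lie's Theorem) Let L be a finite dimensional solvable (right) Leibniz algebra over an algebraically closed field k of characteristic 0, and let (V, f, g) be a finite dimensional nonzero module over L. Then there exist linear functionals φ, ψ : L → k and a nonzero vector v ∈ V such that f(z)(v) = φ(z) v and g(z)(v) = ψ(z) v for all z ∈ L; moreover, either ψ = φ or ψ = 0. -/
/-- The derived series of a Leibniz algebra (with bracket `br`): `D¹L = L` and
`D^{n+1}L = ⟨D^n L, D^n L⟩` (here indexed from `0`, so `derivedSeries br n = D^{n+1}L`). -/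
def LeibnizAlgebra.derivedSeries {k L : Type*} [Field k] [AddCommGroup L] [Module k L]
    (br : L →ₗ[k] L →ₗ[k] L) : ℕ → Submodule k L
  | 0 => ⊤
  | n + 1 => Submodule.span k
      {z : L | ∃ x ∈ LeibnizAlgebra.derivedSeries br n,
        ∃ y ∈ LeibnizAlgebra.derivedSeries br n, z = br x y}

attribute [local instance] LieRing.ofAssociativeRing

/-- **Lie's theorem** for a linear map `f` from a solvable Leibniz algebra to `End V` that carries
the bracket to the commutator. -/
theorem LeibnizAlgebra.exists_common_eigenvector {k L V : Type*} [Field k] [IsAlgClosed k]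
    [CharZero k] [AddCommGroup L] [Module k L] [AddCommGroup V] [Module k V]
    [FiniteDimensional k V] [Nontrivial V] (br : L →ₗ[k] L →ₗ[k] L)
    (hsolv : ∃ n : ℕ, LeibnizAlgebra.derivedSeries br n = ⊥) (f : L →ₗ[k] Module.End k V)
    (hf : ∀ x y : L, f (br x y) = f x ∘ₗ f y - f y ∘ₗ f x) :
    ∃ (φ : L →ₗ[k] k) (v : V), v ≠ 0 ∧ ∀ z : L, f z v = φ z • v := by
  have hlie (x y : L) : ⁅f x, f y⁆ = f (br x y) := (hf x y).symm
  let A : LieSubalgebra k (Module.End k V) :=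
    { LinearMap.range f with
      lie_mem' := by
        rintro _ _ ⟨x, rfl⟩ ⟨y, rfl⟩
        exact ⟨br x y, (hlie x y).symm⟩ }
  have hA (n : ℕ) : ∀ a ∈ LieAlgebra.derivedSeries k A n,
      (a : Module.End k V) ∈ (LeibnizAlgebra.derivedSeries br n).map f := by
    induction n with
    | zero =>
      rintro ⟨_, x, rfl⟩ -
      exact ⟨x, Submodule.mem_top, rfl⟩
    | succ n ih =>
      intro a ha
      rw [LieAlgebra.derivedSeries_def, LieAlgebra.derivedSeriesOfIdeal_succ,
        ← LieSubmodule.mem_toSubmodule, LieSubmodule.lieIdeal_oper_eq_linear_span'] at ha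
      refine (Submodule.span_le (p := Submodule.comap A.toSubmodule.subtype
        ((LeibnizAlgebra.derivedSeries br (n + 1)).map f))).2 ?_ ha
      rintro _ ⟨b, hb, c, hc, rfl⟩
      obtain ⟨x, hx, hxb⟩ := ih b hb
      obtain ⟨y, hy, hyc⟩ := ih c hc
      refine ⟨br x y, Submodule.subset_span ⟨x, hx, y, hy, rfl⟩, ?_⟩
      rw [← hlie, hxb, hyc]
      rfl
  have : LieAlgebra.IsSolvable A := by
    obtain ⟨n, hn⟩ := hsolv
    refine LieAlgebra.IsSolvable.mk (R := k) (k := n) ((LieSubmodule.eq_bot_iff _).2 fun a ha ↦ ?_)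
    have := hA n a ha
    rw [hn, Submodule.map_bot, Submodule.mem_bot] at this
    exact Subtype.ext this
  obtain ⟨χ, hχ⟩ := LieModule.exists_nontrivial_weightSpace_of_isSolvable k A V
  obtain ⟨⟨v, hv⟩, hv0⟩ := exists_ne (0 : LieModule.weightSpace V χ)
  rw [LieModule.mem_weightSpace] at hv
  refine ⟨χ ∘ₗ f.rangeRestrict, v, fun h ↦ hv0 (Subtype.ext h), fun z ↦ ?_⟩
  exact hv (f.rangeRestrict z)

/-- **Extended Lie's Theorem.** Let `L` be a finite dimensional solvable (right)
Leibniz algebra over an algebraically closed field `k` of characteristic `0`, and let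
`(V, f, g)` be a finite dimensional nonzero module over `L`.  Then there exist linear
functionals `φ, ψ : L → k` and a nonzero `v ∈ V` with `f(z)(v) = φ(z)v` and
`g(z)(v) = ψ(z)v` for all `z ∈ L`; moreover `ψ = φ` or `ψ = 0`. -/
theorem leibniz_extended_lie_theorem
    (k : Type*) [Field k] [IsAlgClosed k] [CharZero k]
    (L : Type*) [AddCommGroup L] [Module k L] [FiniteDimensional k L]
    (V : Type*) [AddCommGroup V] [Module k V] [FiniteDimensional k V] [Nontrivial V]
    (br : L →ₗ[k] L →ₗ[k] L)
    (hleib : ∀ x y z : L, br (br x y) z = br x (br y z) + br (br x z) y)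
    (hsolv : ∃ n : ℕ, LeibnizAlgebra.derivedSeries br n = ⊥)
    (f g : L →ₗ[k] Module.End k V)
    (hf : ∀ x y : L, f (br x y) = f x ∘ₗ f y - f y ∘ₗ f x)
    (hg : ∀ x y : L, g (br x y) = g x ∘ₗ f y - f y ∘ₗ g x)
    (hgg : ∀ x y : L, g x ∘ₗ g y = g x ∘ₗ f y) :
    ∃ (φ ψ : L →ₗ[k] k) (v : V), v ≠ 0 ∧
      (∀ z : L, f z v = φ z • v) ∧ (∀ z : L, g z v = ψ z • v) ∧ (ψ = φ ∨ ψ = 0) := by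
  let W : Submodule k V := ⨅ z, LinearMap.ker (g z)
  have hW (v : V) : v ∈ W ↔ ∀ z, g z v = 0 := by simp [W]
  by_cases hbot : W = ⊥
  · have hgf : ∀ z, g z = f z := by
      intro z
      ext v
      have hmem : g z v - f z v ∈ W := (hW _).2 fun x ↦ by
        rw [map_sub, sub_eq_zero]
        exact LinearMap.congr_fun (hgg x z) v
      rwa [hbot, Submodule.mem_bot, sub_eq_zero] at hmem
    obtain ⟨φ, v, hv, h⟩ := LeibnizAlgebra.exists_common_eigenvector br hsolv f hf
    exact ⟨φ, φ, v, hv, h, fun z ↦ by rw [hgf, h], Or.inl rfl⟩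
  · have hfW (z : L) : ∀ v ∈ W, f z v ∈ W := fun v hv ↦ (hW _).2 fun x ↦ by
      rw [← LinearMap.comp_apply, ← hgg, LinearMap.comp_apply, (hW v).1 hv z, map_zero]
    have : Nontrivial W := (Submodule.nontrivial_iff_ne_bot).2 hbot
    let fW : L →ₗ[k] Module.End k W :=
      { toFun z := (f z).restrict (hfW z)
        map_add' x y := by ext; simp
        map_smul' c x := by ext; simp }
    obtain ⟨φ, v, hv, h⟩ := LeibnizAlgebra.exists_common_eigenvector br hsolv fW
      fun x y ↦ by ext v; simp [fW, hf]
    exact ⟨φ, 0, v, fun h0 ↦ hv (Subtype.ext h0), fun z ↦ congrArg Subtype.val (h z),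
      fun z ↦ by simpa using (hW v).1 v.2 z, Or.inr rfl⟩
end

section
/- Let L be a right nilpotent (right) Leibniz algebra over an algebraically closed field k of characteristic 0, and let (V, f, g) be a finite dimensional nonzero module over L. For a linear functional φ : L → k, define V^φ := { v ∈ V : for every x ∈ L there exists n ≥ 1 with (f(x) - φ(x)·I)^n(v) = 0 }. Then V is the direct sum of the nonzero subspaces V^φ, taken over the set of all weights φ (those linear functionals with V^φ ≠ 0). -/
attribute [local instance] LieRing.ofAssociativeRing


/-- The right lower central series of a Leibniz algebra (with bracket `br`): `C¹L = L` and
`C^{n+1}L = ⟨C^n L, L⟩` (indexed from `0`). -/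
def LeibnizAlgebra.rightLowerSeries {k L : Type*} [Field k] [AddCommGroup L] [Module k L]
    (br : L →ₗ[k] L →ₗ[k] L) : ℕ → Submodule k L
  | 0 => ⊤
  | n + 1 => Submodule.span k
      {z : L | ∃ x ∈ LeibnizAlgebra.rightLowerSeries br n, ∃ y : L, z = br x y}

/-- The image of a Leibniz algebra in `End V` under a representation, as a Lie subalgebra. -/
def LeibnizAlgebra.rangeLieSubalgebra {k L V : Type*} [Field k] [AddCommGroup L] [Module k L]
    [AddCommGroup V] [Module k V] {br : L →ₗ[k] L →ₗ[k] L} {f : L →ₗ[k] Module.End k V}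
    (hf : ∀ x y : L, f (br x y) = f x ∘ₗ f y - f y ∘ₗ f x) : LieSubalgebra k (Module.End k V) where
  __ := LinearMap.range f
  lie_mem' := by
    rintro _ _ ⟨x, rfl⟩ ⟨y, rfl⟩
    exact ⟨br x y, hf x y⟩

/-- The lower central series of the image is contained in the image of the right lower series. -/
theorem LeibnizAlgebra.exists_of_mem_lowerCentralSeries {k L V : Type*} [Field k]
    [AddCommGroup L] [Module k L] [AddCommGroup V] [Module k V] {br : L →ₗ[k] L →ₗ[k] L}
    {f : L →ₗ[k] Module.End k V}
    (hf : ∀ x y : L, f (br x y) = f x ∘ₗ f y - f y ∘ₗ f x) (n : ℕ) :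
    ∀ a ∈ LieModule.lowerCentralSeries k (rangeLieSubalgebra hf) (rangeLieSubalgebra hf) n,
      (a : Module.End k V) ∈ (rightLowerSeries br n).map f := by
  induction n with
  | zero =>
    rintro ⟨_, x, rfl⟩ -
    exact ⟨x, Submodule.mem_top, rfl⟩
  | succ n ih =>
    intro a ha
    rw [LieModule.lowerCentralSeries_succ, ← LieSubmodule.mem_toSubmodule,
      LieSubmodule.lieIdeal_oper_eq_linear_span'] at ha
    induction ha using Submodule.span_induction with
    | mem a ha =>
      obtain ⟨⟨_, x, rfl⟩, -, b, hb, rfl⟩ := ha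
      obtain ⟨y, hy, hyb⟩ := ih b hb
      refine ⟨-br y x, neg_mem (Submodule.subset_span ⟨y, hy, x, rfl⟩), ?_⟩
      rw [map_neg, hf, hyb, neg_sub]
      rfl
    | zero => exact zero_mem _
    | add a b _ _ ha hb => exact add_mem ha hb
    | smul c a _ ha => exact Submodule.smul_mem _ c ha

/-- The image of a right nilpotent Leibniz algebra in `End V` is a nilpotent Lie algebra. -/
theorem LeibnizAlgebra.isNilpotent_rangeLieSubalgebra {k L V : Type*} [Field k]
    [AddCommGroup L] [Module k L] [AddCommGroup V] [Module k V] {br : L →ₗ[k] L →ₗ[k] L}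
    {f : L →ₗ[k] Module.End k V}
    (hf : ∀ x y : L, f (br x y) = f x ∘ₗ f y - f y ∘ₗ f x)
    (hnilp : ∃ n : ℕ, rightLowerSeries br n = ⊥) :
    LieRing.IsNilpotent (rangeLieSubalgebra hf) := by
  obtain ⟨n, hn⟩ := hnilp
  refine (LieModule.isNilpotent_iff k _ _).2 ⟨n, (LieSubmodule.eq_bot_iff _).2 fun a ha => ?_⟩
  have h := exists_of_mem_lowerCentralSeries hf n a ha
  rw [hn, Submodule.map_bot, Submodule.mem_bot] at h
  exact Subtype.ext h

/-- Let `L` be a right nilpotent (right) Leibniz algebra over an algebraically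
closed field `k` of characteristic `0` and `(V, f, g)` a finite dimensional nonzero `L`-module.
For a linear functional `φ : L → k` let
`V^φ = {v : for every x ∈ L, (f(x) - φ(x)I)^n v = 0 for some n ≥ 1}`.  Then `V` is the
(internal) direct sum of the nonzero spaces `V^φ`, `φ` ranging over the weights (those `φ`
with `V^φ ≠ 0`): the family of weight spaces is independent and its supremum is `V`. -/
theorem leibniz_weight_space_decomposition
    (k : Type*) [Field k] [IsAlgClosed k] [CharZero k]
    (L : Type*) [AddCommGroup L] [Module k L]
    (V : Type*) [AddCommGroup V] [Module k V] [FiniteDimensional k V] [Nontrivial V]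
    (br : L →ₗ[k] L →ₗ[k] L)
    (hleib : ∀ x y z : L, br (br x y) z = br x (br y z) + br (br x z) y)
    (hnilp : ∃ n : ℕ, LeibnizAlgebra.rightLowerSeries br n = ⊥)
    (f g : L →ₗ[k] Module.End k V)
    (hf : ∀ x y : L, f (br x y) = f x ∘ₗ f y - f y ∘ₗ f x)
    (hg : ∀ x y : L, g (br x y) = g x ∘ₗ f y - f y ∘ₗ g x)
    (hgg : ∀ x y : L, g x ∘ₗ g y = g x ∘ₗ f y) :
    ∃ W : (L →ₗ[k] k) → Submodule k V,
      (∀ φ : L →ₗ[k] k, (W φ : Set V) =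
        {v : V | ∀ x : L, ∃ n : ℕ, 1 ≤ n ∧ ((f x - φ x • (1 : Module.End k V)) ^ n) v = 0}) ∧
      iSupIndep (fun φ : {φ : L →ₗ[k] k // W φ ≠ ⊥} => W φ.1) ∧
      (⨆ φ : {φ : L →ₗ[k] k // W φ ≠ ⊥}, W φ.1) = ⊤ := by
  let H := LeibnizAlgebra.rangeLieSubalgebra hf
  have : LieRing.IsNilpotent H := LeibnizAlgebra.isNilpotent_rangeLieSubalgebra hf hnilp
  let F : L →ₗ[k] H := f.codRestrict H.toSubmodule fun x => ⟨x, rfl⟩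
  let W (φ : L → k) : Submodule k V := ⨅ x, (f x).maxGenEigenspace (φ x)
  have hmaps (i j : L) (c : k) :
      Set.MapsTo (f i) ((f j).maxGenEigenspace c) ((f j).maxGenEigenspace c) := fun v hv =>
    (LieModule.genWeightSpaceOf V c (F j)).lie_mem (x := F i) hv
  have hindep := Module.End.independent_iInf_maxGenEigenspace_of_forall_mapsTo f hmaps
  refine ⟨fun φ => W φ, fun φ => ?_, ?_, ?_⟩
  · ext v
    simp only [W, SetLike.mem_coe, Submodule.mem_iInf, Module.End.mem_maxGenEigenspace,
      Set.mem_ofPred_eq]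
    refine forall_congr' fun x => ⟨fun ⟨n, hn⟩ => ⟨n + 1, by omega, ?_⟩, fun ⟨n, _, hn⟩ => ⟨n, hn⟩⟩
    rw [pow_succ', Module.End.mul_apply, hn, map_zero]
  · exact hindep.comp (f := fun φ : {φ : L →ₗ[k] k // W φ ≠ ⊥} => (φ.1 : L → k))
      (DFunLike.coe_injective.comp Subtype.val_injective)
  · have hle (χ : LieModule.Weight k H V) :
        (LieModule.genWeightSpace V χ).toSubmodule ≤ W (χ.toLinear ∘ₗ F) := by
      intro v hv
      refine (Submodule.mem_iInf _).2 fun x => ?_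
      exact LieModule.genWeightSpace_le_genWeightSpaceOf V (F x) χ hv
    have htop := congrArg LieSubmodule.toSubmodule (LieModule.iSup_genWeightSpace_eq_top' k H V)
    rw [LieSubmodule.iSup_toSubmodule, LieSubmodule.top_toSubmodule] at htop
    refine top_le_iff.1 (htop.ge.trans (iSup_le fun χ => (hle χ).trans ?_))
    refine le_iSup_of_le (ι := {φ : L →ₗ[k] k // W φ ≠ ⊥}) ⟨χ.toLinear ∘ₗ F, fun h => ?_⟩ le_rfl
    refine LieModule.Weight.genWeightSpace_ne_bot V χ ?_
    rw [← LieSubmodule.toSubmodule_eq_bot, ← le_bot_iff]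
    exact (hle χ).trans h.le
end

section
/- Let L be a right nilpotent (right) Leibniz algebra over an algebraically closed field k of characteristic 0, let (V, f, g) be a finite dimensional nonzero module over L, and let φ : L → k be a weight, i.e., the subspace V^φ := { v ∈ V : for every x ∈ L there exists n ≥ 1 with (f(x) - φ(x)·I)^n(v) = 0 } is nonzero. Then V^φ is a submodule of V (stable under all f(x) and g(x)), and if φ ≠ 0 then V^ann ∩ V^φ = (V^φ)^ann, where (V^φ)^ann is the annihilator of V^φ regarded as an L-module with the restricted maps. -/
/-- Iterated right multiplication by `y` lands in the right lower central series. -/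
theorem LeibnizAlgebra.flip_pow_mem_rightLowerSeries {k L : Type*} [Field k] [AddCommGroup L]
    [Module k L] (br : L →ₗ[k] L →ₗ[k] L) (x y : L) (n : ℕ) :
    (br.flip y ^ n) x ∈ LeibnizAlgebra.rightLowerSeries br n := by
  induction n with
  | zero => exact Submodule.mem_top
  | succ n ih =>
    rw [pow_succ', Module.End.mul_apply, LinearMap.flip_apply]
    exact Submodule.subset_span ⟨_, ih, y, rfl⟩

theorem Module.End.mem_maxGenEigenspace_of_sub_apply_mem {k V : Type*} [Field k]
    [AddCommGroup V] [Module k V] (T : Module.End k V) (c : k) {v : V}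
    (h : (T - c • (1 : Module.End k V)) v ∈ T.maxGenEigenspace c) :
    v ∈ T.maxGenEigenspace c := by
  rw [Module.End.mem_maxGenEigenspace] at h ⊢
  obtain ⟨n, hn⟩ := h
  exact ⟨n + 1, by rwa [pow_succ, Module.End.mul_apply]⟩

/-- If `h (br x y) = [h x, T]` for all `x` and right multiplication by `y` kills `x` after finitely
many steps, then `h x` preserves the generalized eigenspaces of `T`. -/
theorem LeibnizAlgebra.apply_mem_maxGenEigenspace {k L V : Type*} [Field k] [AddCommGroup L]
    [Module k L] [AddCommGroup V] [Module k V] (br : L →ₗ[k] L →ₗ[k] L)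
    (h : L →ₗ[k] Module.End k V) (T : Module.End k V) (c : k) (y : L)
    (hT : ∀ x : L, h (br x y) = h x ∘ₗ T - T ∘ₗ h x) (m : ℕ) (x : L)
    (hx : (br.flip y ^ m) x = 0) (v : V) (hv : v ∈ T.maxGenEigenspace c) :
    h x v ∈ T.maxGenEigenspace c := by
  induction m generalizing x v with
  | zero =>
    have : x = 0 := by simpa using hx
    simp [this]
  | succ m ih =>
    rw [pow_succ, Module.End.mul_apply, LinearMap.flip_apply] at hx
    obtain ⟨n, hn⟩ := (Module.End.mem_maxGenEigenspace T c v).1 hv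
    induction n generalizing v with
    | zero =>
      have : v = 0 := by simpa using hn
      simp [this]
    | succ n ihn =>
      apply Module.End.mem_maxGenEigenspace_of_sub_apply_mem
      have key : (T - c • (1 : Module.End k V)) (h x v) =
          h x ((T - c • (1 : Module.End k V)) v) - h (br x y) v := by
        rw [hT]
        simp
      rw [pow_succ, Module.End.mul_apply] at hn
      rw [key]
      exact sub_mem (ihn _ ((Module.End.mem_maxGenEigenspace T c _).2 ⟨n, hn⟩) hn)
        (ih _ hx v hv)


/-- Let `L` be a right nilpotent (right) Leibniz algebra over an
algebraically closed field `k` of characteristic `0`, `(V, f, g)` a finite dimensional nonzero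
`L`-module, and `φ : L → k` a weight, i.e. the generalized weight set
`S = {v : ∀ x, (f(x) - φ(x)I)^n v = 0 for some n ≥ 1}` is nonzero.  Then `S` is a submodule
of `V` (stable under all `f(x)` and `g(x)`), and if `φ ≠ 0` then
`V^ann ∩ S = (V^φ)^ann`, the span of `{(g(y) - f(y))(v) : y ∈ L, v ∈ S}`. -/
theorem leibniz_weight_space_submodule_and_annihilator
    (k : Type*) [Field k] [IsAlgClosed k] [CharZero k]
    (L : Type*) [AddCommGroup L] [Module k L]
    (V : Type*) [AddCommGroup V] [Module k V] [FiniteDimensional k V] [Nontrivial V]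
    (br : L →ₗ[k] L →ₗ[k] L)
    (hleib : ∀ x y z : L, br (br x y) z = br x (br y z) + br (br x z) y)
    (hnilp : ∃ n : ℕ, LeibnizAlgebra.rightLowerSeries br n = ⊥)
    (f g : L →ₗ[k] Module.End k V)
    (hf : ∀ x y : L, f (br x y) = f x ∘ₗ f y - f y ∘ₗ f x)
    (hg : ∀ x y : L, g (br x y) = g x ∘ₗ f y - f y ∘ₗ g x)
    (hgg : ∀ x y : L, g x ∘ₗ g y = g x ∘ₗ f y)
    (Vann : Submodule k V)
    (hVann : Vann = Submodule.span k {w : V | ∃ (y : L) (v : V), w = (g y - f y) v})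
    (φ : L →ₗ[k] k) (S : Set V)
    (hS : S = {v : V | ∀ x : L, ∃ n : ℕ, 1 ≤ n ∧
      ((f x - φ x • (1 : Module.End k V)) ^ n) v = 0})
    (hweight : ∃ v ∈ S, v ≠ 0) :
    (∀ x : L, ∀ v ∈ S, f x v ∈ S ∧ g x v ∈ S) ∧
    (φ ≠ 0 → (Vann : Set V) ∩ S =
      (Submodule.span k {w : V | ∃ y : L, ∃ v ∈ S, w = (g y - f y) v} : Set V)) := by
  obtain ⟨N, hN⟩ := hnilp
  have mem_S (v : V) : v ∈ S ↔ ∀ x, v ∈ (f x).maxGenEigenspace (φ x) := by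
    simp only [hS, Set.mem_ofPred_eq, Module.End.mem_maxGenEigenspace]
    refine forall_congr' fun x => ⟨fun ⟨n, _, hn⟩ => ⟨n, hn⟩, fun ⟨n, hn⟩ => ⟨n + 1, by omega, ?_⟩⟩
    rw [pow_succ', Module.End.mul_apply, hn, map_zero]
  have hbr (x y : L) : (br.flip y ^ N) x = 0 := by
    have := LeibnizAlgebra.flip_pow_mem_rightLowerSeries br x y N
    rwa [hN, Submodule.mem_bot] at this
  have stable (x : L) (v : V) (hv : v ∈ S) : f x v ∈ S ∧ g x v ∈ S := by
    rw [mem_S] at hv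
    simp only [mem_S]
    exact ⟨fun y => LeibnizAlgebra.apply_mem_maxGenEigenspace br f (f y) (φ y) y
        (fun x => hf x y) N x (hbr x y) v (hv y),
      fun y => LeibnizAlgebra.apply_mem_maxGenEigenspace br g (f y) (φ y) y
        (fun x => hg x y) N x (hbr x y) v (hv y)⟩
  refine ⟨stable, fun hφ => ?_⟩
  have S_sub {v w : V} (hv : v ∈ S) (hw : w ∈ S) : v - w ∈ S := by
    rw [mem_S] at hv hw ⊢
    exact fun x => sub_mem (hv x) (hw x)
  have S_smul (c : k) {v : V} (hv : v ∈ S) : c • v ∈ S := by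
    rw [mem_S] at hv ⊢
    exact fun x => Submodule.smul_mem _ c (hv x)
  obtain ⟨x, hx⟩ : ∃ x, φ x ≠ 0 := by
    by_contra! h
    exact hφ (LinearMap.ext h)
  have g_Vann (w : V) (hw : w ∈ Vann) : g x w = 0 := by
    have hle : Vann ≤ LinearMap.ker (g x) := by
      rw [hVann, Submodule.span_le]
      rintro _ ⟨y, v, rfl⟩
      have := LinearMap.congr_fun (hgg x y) v
      simp only [LinearMap.comp_apply] at this
      simp [this]
    exact hle hw
  have f_Vann (w : V) (hw : w ∈ Vann) : f x w ∈ Vann := by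
    have : f x w = -((g x - f x) w) := by simp [g_Vann w hw]
    rw [this, neg_mem_iff, hVann]
    exact Submodule.subset_span ⟨x, w, rfl⟩
  apply Set.Subset.antisymm
  · rintro w ⟨hw, hwS⟩
    obtain ⟨n, hn⟩ := (Module.End.mem_maxGenEigenspace _ _ _).1 ((mem_S w).1 hwS x)
    induction n generalizing w with
    | zero =>
      have : w = 0 := by simpa using hn
      simp [this]
    | succ n ih =>
      rw [pow_succ, Module.End.mul_apply] at hn
      have h₁ := ih (sub_mem (f_Vann w hw) (Submodule.smul_mem _ (φ x) hw))
        (S_sub (stable x w hwS).1 (S_smul (φ x) hwS)) hn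
      have h₂ : (g x - f x) w ∈
          Submodule.span k {w : V | ∃ y : L, ∃ v ∈ S, w = (g y - f y) v} :=
        Submodule.subset_span ⟨x, w, hwS, rfl⟩
      have h₃ := neg_mem (add_mem h₁ h₂)
      rw [LinearMap.sub_apply, g_Vann w hw] at h₃
      refine (Submodule.smul_mem_iff _ hx).1 ?_
      convert h₃ using 1
      abel
  · intro w hw
    rw [SetLike.mem_coe] at hw
    refine ⟨?_, (mem_S w).2 fun z => ?_⟩
    · rw [hVann]
      exact Submodule.span_mono (by rintro _ ⟨y, v, _, h⟩; exact ⟨y, v, h⟩) hw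
    · refine Submodule.span_le.2 ?_ hw
      rintro _ ⟨y, v, hv, rfl⟩
      exact (mem_S _).1 (S_sub (stable y v hv).2 (stable y v hv).1) z
end

section
/- Let L be a finite dimensional (right) Leibniz algebra over an algebraically closed field k of characteristic 0 whose Lie factor L/L^ann is a semisimple Lie algebra, and let H be a Cartan subalgebra of L. Then H is abelian, i.e., ⟨H, H⟩ = 0; moreover L^ann = (H ∩ L^ann) ⊕ (⊕_{φ ∈ Δ} (L^φ)^ann), where Δ is the set of roots of L with respect to H, L^φ is the root space of the root φ, and (L^φ)^ann is the span of {⟨h,v⟩ + ⟨v,h⟩ : h ∈ H, v ∈ L^φ}. -/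
/-- The right lower central series of a subalgebra `H` of a Leibniz algebra (bracket `br`):
`C¹H = H` and `C^{n+1}H = ⟨C^n H, H⟩` (indexed from `0`). -/
def LeibnizAlgebra.relRightLowerSeries {k L : Type*} [Field k] [AddCommGroup L] [Module k L]
    (br : L →ₗ[k] L →ₗ[k] L) (H : Submodule k L) : ℕ → Submodule k L
  | 0 => H
  | n + 1 => Submodule.span k
      {z : L | ∃ x ∈ LeibnizAlgebra.relRightLowerSeries br H n, ∃ y ∈ H, z = br x y}


section SlTwo

open scoped IsMulCommutative

/-- If `h` is a nilpotent element of a commutative algebra over a field of characteristic zero and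
both products `∏ (c - (h + 2j + 1)²)` and `∏ (c - (h - 2j - 1)²)` vanish, then `h = 0`. -/
theorem eq_zero_of_isNilpotent_of_prod_sub_sq_eq_zero (k : Type*) {Q : Type*} [Field k] [CharZero k]
    [CommRing Q] [Algebra k Q] {c h : Q} (hn : IsNilpotent h) (n : ℕ)
    (hA : ∏ j ∈ Finset.range n, (c - (h + 2 * j + 1) ^ 2) = 0)
    (hB : ∏ j ∈ Finset.range n, (c - (h - 2 * j - 1) ^ 2) = 0) : h = 0 := by
  have unitInt (m : ℤ) (hm : m ≠ 0) : IsUnit (m : Q) := by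
    have : IsUnit (algebraMap k Q (m : k)) :=
      (IsUnit.mk0 _ (Int.cast_ne_zero.mpr hm)).map (algebraMap k Q)
    rwa [map_intCast] at this
  have unitAdd (m : ℤ) (hm : m ≠ 0) : IsUnit (h + m) :=
    hn.isUnit_add_right_of_commute (unitInt m hm) (Commute.all _ _)
  have coprime_of_unit {x y : Q} (hxy : IsUnit (x - y)) : IsCoprime x y := by
    obtain ⟨u, hu⟩ := hxy.exists_left_inv
    exact ⟨u, -u, by linear_combination hu⟩
  have hdvd : ∏ j ∈ Finset.range n, (c - (h + 2 * j + 1) ^ 2) ∣ h := by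
    refine Finset.prod_dvd_of_coprime ?_ ?_
    · intro i _ j _ hij
      apply coprime_of_unit
      have := ((unitInt (4 * ((j : ℤ) - i)) (by omega)).mul (unitAdd (i + j + 1) (by omega)))
      convert this using 1
      push_cast
      ring
    · intro j hj
      have h1 : c - (h + 2 * j + 1) ^ 2 ∣ (c - (h - 2 * j - 1) ^ 2) *
          ∏ i ∈ (Finset.range n).erase j, (c - (h - 2 * i - 1) ^ 2) := by
        rw [Finset.mul_prod_erase _ (fun i : ℕ ↦ c - (h - 2 * i - 1) ^ 2) hj, hB]
        exact dvd_zero _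
      have h2 := IsCoprime.dvd_of_dvd_mul_right (IsCoprime.prod_right fun i hi ↦ ?_) h1
      · rw [show c - (h - 2 * j - 1) ^ 2 =
          (c - (h + 2 * j + 1) ^ 2) + ((4 * (2 * j + 1) : ℤ) : Q) * h by push_cast; ring,
          dvd_add_right (dvd_refl _)] at h2
        exact (unitInt (4 * (2 * j + 1)) (by omega)).dvd_mul_left.mp h2
      · have hij := Finset.ne_of_mem_erase hi
        apply coprime_of_unit
        have := ((unitInt (-(4 * ((i : ℤ) + j + 1))) (by omega)).mul
          (unitAdd (j - i) (by omega)))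
        convert this using 1
        push_cast
        ring
  rw [hA] at hdvd
  exact zero_dvd_iff.mp hdvd

/-- If `e`, `f` and commuting elements `ι h`, `ι c` satisfy the relations of `sl₂` and its Casimir
element, then `4ⁿ fⁿ eⁿ` is a polynomial in `ι h` and `ι c`. -/
theorem four_pow_mul_pow_mul_pow_eq_prod {A S : Type*} [Ring A] [CommRing S] (ι : S →+* A)
    {c h : S} {e f : A} (hfh : f * ι h = (ι h + 2) * f) (hfc : f * ι c = ι c * f)
    (hc : 4 * (f * e) = ι (c - (h + 1) ^ 2)) (n : ℕ) :
    4 ^ n * (f ^ n * e ^ n) = ι (∏ j ∈ Finset.range n, (c - (h + 2 * j + 1) ^ 2)) := by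
  have shift (n : ℕ) : f * ι (∏ j ∈ Finset.range n, (c - (h + 2 * j + 1) ^ 2)) =
      ι (∏ j ∈ Finset.range n, (c - (h + 2 * (j + 1 : ℕ) + 1) ^ 2)) * f := by
    induction n with
    | zero => simp
    | succ n ih =>
      have hsq : f * ι ((h + 2 * n + 1) ^ 2) = ι ((h + 2 * (n + 1 : ℕ) + 1) ^ 2) * f := by
        have hlin : f * ι (h + 2 * n + 1) = ι (h + 2 * (n + 1 : ℕ) + 1) * f := by
          have hnat : f * ((2 * n : ℕ) : A) = ((2 * n : ℕ) : A) * f := (Nat.cast_commute _ f).symm.eq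
          push_cast at hnat
          simp only [map_add, map_mul, map_one, map_ofNat, map_natCast, mul_add, add_mul, hfh, hnat,
            Nat.cast_add, Nat.cast_one, mul_one, one_mul]
          abel
        rw [pow_two, pow_two, map_mul, map_mul, ← mul_assoc, hlin, mul_assoc, hlin, mul_assoc]
      rw [Finset.prod_range_succ, Finset.prod_range_succ, map_mul, map_mul, ← mul_assoc, ih,
        mul_assoc, mul_assoc, map_sub, map_sub, mul_sub, hfc, hsq, sub_mul]
  induction n with
  | zero => simp
  | succ n ih =>
    have h4 : Commute ((4 : A) ^ n) f := ((Nat.cast_commute 4 f).pow_left n)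
    calc 4 ^ (n + 1) * (f ^ (n + 1) * e ^ (n + 1))
        = 4 * ((4 ^ n * f) * (f ^ n * e ^ n) * e) := by
          simp only [pow_succ' (4 : A), pow_succ' f, pow_succ e, mul_assoc]
      _ = 4 * (f * (4 ^ n * (f ^ n * e ^ n)) * e) := by
          rw [h4.eq]; simp only [mul_assoc]
      _ = 4 * (ι (∏ j ∈ Finset.range n, (c - (h + 2 * (j + 1 : ℕ) + 1) ^ 2)) * (f * e)) := by
          rw [ih, shift, mul_assoc]
      _ = ι (∏ j ∈ Finset.range n, (c - (h + 2 * (j + 1 : ℕ) + 1) ^ 2)) * (4 * (f * e)) := by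
          rw [← mul_assoc, ← mul_assoc, (show Commute (4 : A) _ from Nat.cast_commute 4 _).eq]
          simp only [mul_assoc]
      _ = _ := by
          rw [hc, ← map_mul, Finset.prod_range_succ']
          simp

/-- A version of `eq_zero_of_isNilpotent_of_prod_sub_sq_eq_zero` for the action of a commutative
algebra on a single vector. -/
theorem apply_eq_zero_of_prod_sub_sq_eq_zero {k V S : Type*} [Field k] [CharZero k]
    [AddCommGroup V] [Module k V] [CommRing S] [Algebra k S] (ι : S →+* Module.End k V) {c h : S}
    {v : V} {m : ℕ} (hv : ι (h ^ m) v = 0) (n : ℕ)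
    (hA : ι (∏ j ∈ Finset.range n, (c - (h + 2 * j + 1) ^ 2)) = 0)
    (hB : ι (∏ j ∈ Finset.range n, (c - (h - 2 * j - 1) ^ 2)) = 0) : ι h v = 0 := by
  let J : Ideal S :=
    { carrier := {s | ι s v = 0}
      add_mem' := fun {a b} (ha : ι a v = 0) (hb : ι b v = 0) ↦ show ι (a + b) v = 0 by
        rw [map_add, LinearMap.add_apply, ha, hb, add_zero]
      zero_mem' := show ι 0 v = 0 by rw [map_zero, LinearMap.zero_apply]
      smul_mem' := fun a {b} (hb : ι b v = 0) ↦ show ι (a * b) v = 0 by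
        rw [map_mul, Module.End.mul_apply, hb, map_zero] }
  have mem_J (s : S) : s ∈ J ↔ ι s v = 0 := Iff.rfl
  have mk_two : Ideal.Quotient.mk J 2 = 2 := map_ofNat _ 2
  have key : Ideal.Quotient.mk J h = 0 := by
    refine eq_zero_of_isNilpotent_of_prod_sub_sq_eq_zero k (c := Ideal.Quotient.mk J c)
      ⟨m, ?_⟩ n ?_ ?_
    · rw [← map_pow, Ideal.Quotient.eq_zero_iff_mem, mem_J, hv]
    · have : Ideal.Quotient.mk J (∏ j ∈ Finset.range n, (c - (h + 2 * j + 1) ^ 2)) = 0 := by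
        rw [Ideal.Quotient.eq_zero_iff_mem, mem_J, hA, LinearMap.zero_apply]
      simpa [mk_two] using this
    · have : Ideal.Quotient.mk J (∏ j ∈ Finset.range n, (c - (h - 2 * j - 1) ^ 2)) = 0 := by
        rw [Ideal.Quotient.eq_zero_iff_mem, mem_J, hB, LinearMap.zero_apply]
      simpa [mk_two] using this
  rwa [Ideal.Quotient.eq_zero_iff_mem, mem_J] at key

/-- In a representation of `sl₂` on which `e` and `f` act nilpotently, `h` acts as zero on its
generalized eigenspace for the eigenvalue zero. -/
theorem apply_eq_zero_of_sl2_relations {k V : Type*} [Field k] [CharZero k] [AddCommGroup V]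
    [Module k V] {h e f : Module.End k V} (hef : e * f - f * e = h)
    (hhe : h * e - e * h = 2 * e) (hhf : h * f - f * h = -(2 * f))
    (he : IsNilpotent e) (hf : IsNilpotent f) {v : V} {m : ℕ} (hv : (h ^ m) v = 0) : h v = 0 := by
  have eh : e * h = (h - 2) * e := by rw [sub_mul, ← hhe]; abel
  have fh : f * h = (h + 2) * f := by rw [add_mul, ← neg_eq_iff_eq_neg.mpr hhf]; abel
  have ef : e * f = f * e + h := by rw [← hef]; abel
  have hhe' : h * e = e * h + 2 * e := by rw [← hhe]; abel
  set c : Module.End k V := 4 * (f * e) + (h + 1) ^ 2 with hc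
  have hc' : c = 4 * (e * f) + (h - 1) ^ 2 := by
    rw [hc, ef]; noncomm_ring
  have fc : f * c = c * f := by
    have h1 : f * (h + 1) = (h + 3) * f := by rw [mul_add, fh]; noncomm_ring
    calc f * c = 4 * (f * (f * e)) + f * (h + 1) * (h + 1) := by rw [hc]; noncomm_ring
      _ = 4 * (f * (f * e)) + (h + 3) * ((h + 3) * f) := by rw [h1, mul_assoc, h1]
      _ = 4 * (f * (f * e)) + 4 * ((h + 2) * f) + (h + 1) ^ 2 * f := by noncomm_ring
      _ = 4 * (f * (f * e)) + 4 * (f * h) + (h + 1) ^ 2 * f := by rw [fh]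
      _ = 4 * (f * (f * e + h)) + (h + 1) ^ 2 * f := by noncomm_ring
      _ = c * f := by rw [← ef, hc]; noncomm_ring
  have ec : e * c = c * e := by
    have h1 : e * (h - 1) = (h - 3) * e := by rw [mul_sub, eh]; noncomm_ring
    calc e * c = 4 * (e * (e * f)) + e * (h - 1) * (h - 1) := by rw [hc']; noncomm_ring
      _ = 4 * (e * (e * f)) + (h - 3) * ((h - 3) * e) := by rw [h1, mul_assoc, h1]
      _ = 4 * (e * (e * f)) - 4 * ((h - 2) * e) + (h - 1) ^ 2 * e := by noncomm_ring
      _ = 4 * (e * (e * f)) - 4 * (e * h) + (h - 1) ^ 2 * e := by rw [eh]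
      _ = 4 * (e * (e * f - h)) + (h - 1) ^ 2 * e := by noncomm_ring
      _ = c * e := by rw [sub_eq_of_eq_add ef, hc']; noncomm_ring
  have ch : c * h = h * c := by
    calc c * h = 4 * (f * (e * h)) + (h + 1) ^ 2 * h := by rw [hc]; noncomm_ring
      _ = 4 * (f * h * e - 2 * (f * e)) + (h + 1) ^ 2 * h := by rw [eh]; noncomm_ring
      _ = h * c := by rw [fh, hc]; noncomm_ring
  let S := Algebra.adjoin k {c, h}
  have : IsMulCommutative S := Algebra.isMulCommutative_adjoin k (by
    rintro a (rfl | rfl) b (rfl | rfl) <;> first | rfl | exact ch | exact ch.symm)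
  let ι : S →+* Module.End k V := S.val
  let c' : S := ⟨c, Algebra.subset_adjoin (by simp)⟩
  let h' : S := ⟨h, Algebra.subset_adjoin (by simp)⟩
  have ιc : ι c' = c := rfl
  have ιh : ι h' = h := rfl
  obtain ⟨p, hp⟩ := he
  obtain ⟨q, hq⟩ := hf
  have hA := four_pow_mul_pow_mul_pow_eq_prod ι (c := c') (h := h') (e := e) (f := f) fh fc
    (by rw [map_sub, map_pow, map_add, map_one, ιc, ιh, hc]; abel) (p + q)
  have hB := four_pow_mul_pow_mul_pow_eq_prod ι (c := c') (h := -h') (e := f) (f := e)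
    (by rw [map_neg, ιh, mul_neg, eh]; noncomm_ring) ec
    (by rw [map_sub, map_pow, map_add, map_one, map_neg, ιc, ιh, hc']; noncomm_ring) (p + q)
  rw [pow_add e, hp, zero_mul, mul_zero, mul_zero] at hA
  rw [pow_add e, hp, zero_mul, zero_mul, mul_zero] at hB
  refine apply_eq_zero_of_prod_sub_sq_eq_zero ι (c := c') (h := h') (m := m) ?_ (p + q) hA.symm ?_
  · rw [map_pow, ιh, hv]
  · rw [hB]
    congr 1
    exact Finset.prod_congr rfl fun j _ ↦ by ring

end SlTwo

open LieModule in
/-- The zero weight space of a finite-dimensional module over a semisimple Lie algebra, relative to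
a Cartan subalgebra, is annihilated by the Cartan subalgebra. -/
theorem LieAlgebra.IsKilling.lie_eq_zero_of_mem_genWeightSpace_zero {k 𝔤 V : Type*} [Field k]
    [CharZero k] [LieRing 𝔤] [LieAlgebra k 𝔤] [FiniteDimensional k 𝔤] [LieAlgebra.IsKilling k 𝔤]
    (𝔥 : LieSubalgebra k 𝔤) [𝔥.IsCartanSubalgebra] [IsTriangularizable k 𝔥 𝔤]
    [AddCommGroup V] [Module k V] [LieRingModule 𝔤 V] [LieModule k 𝔤 V] [FiniteDimensional k V]
    [IsTriangularizable k 𝔥 V] {v : V} (hv : v ∈ genWeightSpace V (0 : 𝔥 → k)) (x : 𝔥) :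
    ⁅x, v⁆ = 0 := by
  have hx : x ∈ Submodule.span k (Set.range (LieAlgebra.IsKilling.rootSystem 𝔥).coroot) := by
    rw [RootPairing.IsRootSystem.span_coroot_eq_top]
    trivial
  induction hx using Submodule.span_induction with
  | zero => exact zero_lie v
  | add x y _ _ hx hy => rw [add_lie, hx, hy, add_zero]
  | smul t x _ hx => rw [smul_lie, hx, smul_zero]
  | mem x hx =>
    obtain ⟨⟨α, hα⟩, rfl⟩ := hx
    replace hα : α.IsNonZero := by simpa using hα
    obtain ⟨h, e, f, ht, heα, hfα⟩ :=
      LieAlgebra.IsKilling.exists_isSl2Triple_of_weight_isNonZero hα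
    rw [LieAlgebra.IsKilling.rootSystem_coroot_apply]
    have hh := ht.h_eq_coroot hα heα hfα
    obtain ⟨m, hm⟩ := (mem_genWeightSpace V _ v).mp hv (LieAlgebra.IsKilling.coroot α)
    have hα0 : (α : 𝔥 → k) ≠ 0 := hα
    have key : toEnd k 𝔤 V h v = 0 := by
      refine apply_eq_zero_of_sl2_relations (e := toEnd k 𝔤 V e) (f := toEnd k 𝔤 V f) (m := m)
        ?_ ?_ ?_ (isNilpotent_toEnd_of_mem_rootSpace V 𝔥 hα0 heα)
        (isNilpotent_toEnd_of_mem_rootSpace V 𝔥 (neg_ne_zero.mpr hα0) hfα) ?_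
      · ext w
        simp [← ht.lie_e_f]
      · ext w
        have := congr_arg (fun z ↦ ⁅z, w⁆) (ht.lie_h_e_smul k)
        simpa [two_smul, two_mul] using this
      · ext w
        have := congr_arg (fun z ↦ ⁅z, w⁆) (ht.lie_lie_smul_f k)
        simpa [two_smul, two_mul] using this
      · rw [hh]
        rw [Pi.zero_apply, zero_smul, sub_zero] at hm
        exact hm
    rw [hh] at key
    exact key

namespace LeibnizAlgebra

open LieModule

section Equivariant

variable {k 𝔤 V : Type*} [Field k] [LieRing 𝔤] [LieAlgebra k 𝔤]
  [AddCommGroup V] [Module k V] [LieRingModule 𝔤 V] [LieModule k 𝔤 V]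
  (p : V →ₗ⁅k,𝔤⁆ 𝔤) (H : Submodule k V) (hsub : ∀ x ∈ H, ∀ y ∈ H, ⁅p y, x⁆ ∈ H)

/-- The image in `𝔤` of a subspace that is closed under the Leibniz bracket `⟨x, y⟩ = -⁅p y, x⁆`
attached to an equivariant map `p : V → 𝔤`. -/
def imageSubalgebra : LieSubalgebra k 𝔤 where
  __ := H.map p.toLinearMap
  lie_mem' := by
    rintro _ _ ⟨x, hx, rfl⟩ ⟨y, hy, rfl⟩
    exact ⟨⁅p x, y⁆, hsub y hy x hx, p.map_lie _ _⟩

variable [FiniteDimensional k V]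

theorem isNilpotent_imageSubalgebra
    (hnil : ∀ x ∈ H, ∀ y ∈ H, ∃ n : ℕ, (toEnd k 𝔤 V (p y) ^ n) x = 0) :
    LieRing.IsNilpotent (imageSubalgebra p H hsub) := by
  have : FiniteDimensional k (imageSubalgebra p H hsub) :=
    inferInstanceAs (FiniteDimensional k (H.map p.toLinearMap))
  rw [LieAlgebra.isNilpotent_iff_forall (R := k)]
  rintro ⟨_, y, hy, rfl⟩
  rw [Module.End.isNilpotent_iff_of_finite]
  rintro ⟨_, x, hx, rfl⟩
  obtain ⟨n, hn⟩ := hnil x hx y hy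
  refine ⟨n, Subtype.ext ?_⟩
  have (n : ℕ) (z : imageSubalgebra p H hsub) :
      (((LieAlgebra.ad k (imageSubalgebra p H hsub) ⟨p y, y, hy, rfl⟩) ^ n) z : 𝔤) =
        (toEnd k 𝔤 𝔤 (p y) ^ n) z := by
    induction n with
    | zero => simp
    | succ n ih => rw [pow_succ', pow_succ', Module.End.mul_apply, Module.End.mul_apply, ← ih]; rfl
  refine (this n _).trans ?_
  change (toEnd k 𝔤 𝔤 (p y) ^ n) (p x) = 0
  rw [toEnd_pow_apply_map, hn, map_zero]

section Cartan

variable [LieRing.IsNilpotent (imageSubalgebra p H hsub)]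

theorem mem_iff_mem_genWeightSpace_zero
    (hnil : ∀ x ∈ H, ∀ y ∈ H, ∃ n : ℕ, (toEnd k 𝔤 V (p y) ^ n) x = 0)
    (hnorm : ∀ x, (∀ h ∈ H, ⁅p h, x⁆ ∈ H) → x ∈ H) (x : V) :
    x ∈ H ↔ x ∈ genWeightSpace V (0 : imageSubalgebra p H hsub → k) := by
  constructor
  · intro hx
    rw [mem_genWeightSpace]
    rintro ⟨_, y, hy, rfl⟩
    obtain ⟨n, hn⟩ := hnil x hx y hy
    refine ⟨n, ?_⟩
    rw [Pi.zero_apply, zero_smul, sub_zero]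
    exact hn
  · set M := genWeightSpace V (0 : imageSubalgebra p H hsub → k)
    obtain ⟨n, hn⟩ := (LieModule.isNilpotent_iff k (imageSubalgebra p H hsub) M).mp inferInstance
    have descend (j : ℕ) : ∀ z ∈ lowerCentralSeries k (imageSubalgebra p H hsub) M (n - j),
        (z : V) ∈ H := by
      induction j with
      | zero =>
        intro z hz
        rw [Nat.sub_zero, hn, LieSubmodule.mem_bot] at hz
        rw [hz]
        exact H.zero_mem
      | succ j ih =>
        intro z hz
        by_cases hj : j < n
        · refine hnorm _ fun h hh ↦ ?_
          refine ih ⁅(⟨p h, h, hh, rfl⟩ : imageSubalgebra p H hsub), z⁆ ?_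
          rw [show n - j = n - (j + 1) + 1 by omega, lowerCentralSeries_succ]
          exact LieSubmodule.lie_mem_lie (LieSubmodule.mem_top _) hz
        · exact ih z (by rwa [show n - j = n - (j + 1) by omega])
    intro hx
    exact descend n ⟨x, hx⟩ (by rw [Nat.sub_self]; exact LieSubmodule.mem_top _)

/-- The equivariant map `p`, regarded as a map of modules over the image of `H`. -/
def restrictImage : V →ₗ⁅k,imageSubalgebra p H hsub⁆ 𝔤 where
  __ := p.toLinearMap
  map_lie' {x m} := p.map_lie x m

theorem isCartanSubalgebra_imageSubalgebra
    (hnil : ∀ x ∈ H, ∀ y ∈ H, ∃ n : ℕ, (toEnd k 𝔤 V (p y) ^ n) x = 0)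
    (hnorm : ∀ x, (∀ h ∈ H, ⁅p h, x⁆ ∈ H) → x ∈ H)
    (hp : Function.Surjective p) :
    (imageSubalgebra p H hsub).IsCartanSubalgebra := by
  have : FiniteDimensional k 𝔤 := Module.Finite.of_surjective p.toLinearMap hp
  apply LieAlgebra.is_cartan_of_zeroRootSubalgebra_eq (R := k)
  refine le_antisymm ?_ (LieAlgebra.le_zeroRootSubalgebra _ _ _)
  intro x hx
  rw [LieAlgebra.mem_zeroRootSubalgebra] at hx
  replace hx : x ∈ genWeightSpace 𝔤 (0 : imageSubalgebra p H hsub → k) := by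
    simpa [mem_genWeightSpace] using hx
  obtain ⟨v, rfl⟩ := hp x
  obtain ⟨v₀, h₀, v₁, h₁, rfl⟩ : ∃ v₀ ∈ genWeightSpace V (0 : imageSubalgebra p H hsub → k),
      ∃ v₁ ∈ posFittingComp k (imageSubalgebra p H hsub) V, v₀ + v₁ = v := by
    rw [← LieSubmodule.mem_sup,
      (isCompl_genWeightSpace_zero_posFittingComp k (imageSubalgebra p H hsub) V).sup_eq_top]
    trivial
  have hp₀ : p v₀ ∈ genWeightSpace 𝔤 (0 : imageSubalgebra p H hsub → k) :=
    map_genWeightSpace_le (restrictImage p H hsub) ⟨v₀, h₀, rfl⟩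
  have hp₁ : p v₁ ∈ posFittingComp k (imageSubalgebra p H hsub) 𝔤 :=
    map_posFittingComp_le (restrictImage p H hsub) ⟨v₁, h₁, rfl⟩
  have hp₁' : p v₁ = 0 := by
    have hdisj := (isCompl_genWeightSpace_zero_posFittingComp k (imageSubalgebra p H hsub)
      𝔤).inf_eq_bot
    have : p v₁ ∈ genWeightSpace 𝔤 (0 : imageSubalgebra p H hsub → k) ⊓
        posFittingComp k (imageSubalgebra p H hsub) 𝔤 := by
      refine ⟨?_, hp₁⟩
      have := sub_mem hx hp₀
      rwa [map_add, add_sub_cancel_left] at this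
    rwa [hdisj, LieSubmodule.mem_bot] at this
  rw [map_add, hp₁', add_zero]
  exact ⟨v₀, (mem_iff_mem_genWeightSpace_zero p H hsub hnil hnorm v₀).mpr h₀, rfl⟩

end Cartan

theorem lie_apply_eq_zero {p : V →ₗ⁅k,𝔤⁆ 𝔤} {H : Submodule k V}
    [IsAlgClosed k] [CharZero k] [LieAlgebra.IsSemisimple k 𝔤]
    (hsub : ∀ x ∈ H, ∀ y ∈ H, ⁅p y, x⁆ ∈ H)
    (hnil : ∀ x ∈ H, ∀ y ∈ H, ∃ n : ℕ, (toEnd k 𝔤 V (p y) ^ n) x = 0)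
    (hnorm : ∀ x, (∀ h ∈ H, ⁅p h, x⁆ ∈ H) → x ∈ H)
    (hp : Function.Surjective p) {x y : V} (hx : x ∈ H) (hy : y ∈ H) : ⁅p y, x⁆ = 0 := by
  have : FiniteDimensional k 𝔤 := Module.Finite.of_surjective p.toLinearMap hp
  have := isNilpotent_imageSubalgebra p H hsub hnil
  have := isCartanSubalgebra_imageSubalgebra p H hsub hnil hnorm hp
  exact LieAlgebra.IsKilling.lie_eq_zero_of_mem_genWeightSpace_zero (imageSubalgebra p H hsub)
    ((mem_iff_mem_genWeightSpace_zero p H hsub hnil hnorm x).mp hx) ⟨p y, y, hy, rfl⟩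

/-- The decomposition of the kernel of an equivariant map `p : V → 𝔤` into its part in the Cartan
subalgebra and the annihilators of the root spaces, for the bracket `⟨x, y⟩ = -⁅p y, x⁆`. -/
theorem iSupIndep_and_iSup_eq_ker [IsAlgClosed k] [CharZero k] {p : V →ₗ⁅k,𝔤⁆ 𝔤}
    {H : Submodule k V} (hp : Function.Surjective p) (hsub : ∀ x ∈ H, ∀ y ∈ H, ⁅p y, x⁆ ∈ H)
    (hnil : ∀ x ∈ H, ∀ y ∈ H, ∃ n : ℕ, (toEnd k 𝔤 V (p y) ^ n) x = 0)
    (hnorm : ∀ x, (∀ h ∈ H, ⁅p h, x⁆ ∈ H) → x ∈ H)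
    {RS : (H →ₗ[k] k) → Set V}
    (hRS : ∀ φ y, y ∈ RS φ ↔ ∀ h : H, ∃ n : ℕ,
      ((toEnd k 𝔤 V (p h) - φ h • (1 : Module.End k V)) ^ n) y = 0)
    {rootAnn : (H →ₗ[k] k) → Submodule k V}
    (hrootAnn : ∀ φ, rootAnn φ =
      Submodule.span k {z : V | ∃ h ∈ H, ∃ v ∈ RS φ, z = -⁅p v, h⁆ + -⁅p h, v⁆}) :
    iSupIndep (fun i : Option {φ : H →ₗ[k] k // φ ≠ 0 ∧ ∃ y ∈ RS φ, y ≠ 0} =>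
      i.elim (H ⊓ LinearMap.ker p.toLinearMap) (fun φ => rootAnn φ.1)) ∧
    (⨆ i : Option {φ : H →ₗ[k] k // φ ≠ 0 ∧ ∃ y ∈ RS φ, y ≠ 0},
      i.elim (H ⊓ LinearMap.ker p.toLinearMap) (fun φ => rootAnn φ.1)) =
        LinearMap.ker p.toLinearMap := by
  have : FiniteDimensional k 𝔤 := Module.Finite.of_surjective p.toLinearMap hp
  have := isNilpotent_imageSubalgebra p H hsub hnil
  have memH := mem_iff_mem_genWeightSpace_zero p H hsub hnil hnorm
  set 𝔥 := imageSubalgebra p H hsub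
  let q (h : H) : 𝔥 := ⟨p h, h, h.2, rfl⟩
  have hq : Function.Surjective q := by
    rintro ⟨_, h, hh, rfl⟩
    exact ⟨⟨h, hh⟩, rfl⟩
  let s : 𝔥 → H := Function.surjInv hq
  have hs (x : 𝔥) : q (s x) = x := Function.surjInv_eq hq x
  have root_apply {φ : H →ₗ[k] k} (hφ : ∃ y ∈ RS φ, y ≠ 0) (h : H) : φ (s (q h)) = φ h := by
    rw [← sub_eq_zero, ← map_sub]
    obtain ⟨y, hy, hy0⟩ := hφ
    obtain ⟨n, hn⟩ := (hRS φ y).mp hy (s (q h) - h)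
    have hker : p ((s (q h) - h : H) : V) = 0 := by
      rw [Submodule.coe_sub, map_sub, sub_eq_zero]
      exact congr_arg Subtype.val (hs (q h))
    rw [hker, map_zero, zero_sub, ← neg_smul, smul_pow, one_pow, LinearMap.smul_apply,
      Module.End.one_apply, smul_eq_zero_iff_left hy0] at hn
    exact neg_eq_zero.mp (eq_zero_of_pow_eq_zero hn)
  have mem_RS_iff {φ : H →ₗ[k] k} {χ : 𝔥 → k} (hφ : ∀ h, χ (q h) = φ h) (y : V) :
      y ∈ RS φ ↔ y ∈ genWeightSpace V χ := by
    rw [hRS, mem_genWeightSpace]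
    refine ⟨fun hy x ↦ ?_, fun hy h ↦ ?_⟩
    · obtain ⟨h, rfl⟩ := hq x
      rw [hφ]
      exact hy h
    · rw [← hφ]
      exact hy (q h)
  have rootAnn_le_ker (φ : H →ₗ[k] k) : rootAnn φ ≤ LinearMap.ker p.toLinearMap := by
    rw [hrootAnn, Submodule.span_le]
    rintro _ ⟨h, _, v, _, rfl⟩
    change p (-⁅p v, h⁆ + -⁅p h, v⁆) = 0
    rw [map_add, map_neg, map_neg, p.map_lie, p.map_lie, ← lie_skew]
    abel
  have rootAnn_le {φ : H →ₗ[k] k} (hφ : ∃ y ∈ RS φ, y ≠ 0) :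
      rootAnn φ ≤ (genWeightSpace V fun x : 𝔥 ↦ φ (s x)).toSubmodule := by
    rw [hrootAnn, Submodule.span_le]
    rintro _ ⟨h, hh, v, hv, rfl⟩
    rw [mem_RS_iff (χ := fun x ↦ φ (s x)) (root_apply hφ)] at hv
    refine add_mem (neg_mem ?_) (neg_mem ?_)
    · have hpv : p v ∈ LieAlgebra.rootSpace 𝔥 fun x : 𝔥 ↦ φ (s x) :=
        map_genWeightSpace_le (restrictImage p H hsub) ⟨v, hv, rfl⟩
      have := LieAlgebra.lie_mem_genWeightSpace_of_mem_genWeightSpace hpv ((memH h).mp hh)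
      rwa [add_zero] at this
    · exact LieSubmodule.lie_mem _ (x := q ⟨h, hh⟩) hv
  refine ⟨?_, le_antisymm (iSup_le ?_) ?_⟩
  · let w (i : Option {φ : H →ₗ[k] k // φ ≠ 0 ∧ ∃ y ∈ RS φ, y ≠ 0}) : 𝔥 → k :=
      i.elim 0 fun φ x ↦ φ.1 (s x)
    have hw : Function.Injective w := by
      rintro (_ | φ) (_ | ψ) h
      · rfl
      · refine absurd (LinearMap.ext fun x ↦ ?_) ψ.2.1
        rw [← root_apply ψ.2.2]
        exact (congr_fun h (q x)).symm
      · refine absurd (LinearMap.ext fun x ↦ ?_) φ.2.1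
        rw [← root_apply φ.2.2]
        exact congr_fun h (q x)
      · refine congr_arg some (Subtype.ext (LinearMap.ext fun x ↦ ?_))
        rw [← root_apply φ.2.2, ← root_apply ψ.2.2]
        exact congr_fun h (q x)
    have hind : iSupIndep fun χ : 𝔥 → k ↦ (genWeightSpace V χ).toSubmodule :=
      LieSubmodule.iSupIndep_toSubmodule.mpr (iSupIndep_genWeightSpace k 𝔥 V)
    refine (hind.comp hw).mono ?_
    rintro (_ | φ)
    · exact fun x hx ↦ (memH x).mp hx.1
    · exact rootAnn_le φ.2.2
  · rintro (_ | φ)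
    · exact inf_le_right
    · exact rootAnn_le_ker φ.1
  · let K := (restrictImage p H hsub).ker
    intro x hx
    replace hx : x ∈ K := hx
    rw [eq_iSup_inf_genWeightSpace k 𝔥 V K] at hx
    induction hx using LieSubmodule.iSup_induction' with
    | zero => exact zero_mem _
    | add x y _ _ hx hy => exact add_mem hx hy
    | mem χ x hx =>
      obtain ⟨hxK, hxχ⟩ := hx
      by_cases hχ : (χ : 𝔥 → k) = 0
      · rw [hχ] at hxχ
        exact Submodule.mem_iSup_of_mem none ⟨(memH x).mpr hxχ, hxK⟩
      · let φ : H →ₗ[k] k := χ.toLinear ∘ₗ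
          { toFun := q
            map_add' := fun a b ↦ Subtype.ext (map_add p _ _)
            map_smul' := fun c a ↦ Subtype.ext (map_smul p c _) }
        have hφ (h : H) : χ (q h) = φ h := rfl
        obtain ⟨t, ht⟩ : ∃ t : H, φ t ≠ 0 := by
          by_contra! hzero
          refine hχ (funext fun x ↦ ?_)
          rw [← hs x]
          exact hzero _
        have hroot : φ ≠ 0 ∧ ∃ y ∈ RS φ, y ≠ 0 := by
          obtain ⟨y, hy, hy0⟩ := χ.exists_ne_zero
          exact ⟨fun h ↦ ht (by rw [h, LinearMap.zero_apply]), y, (mem_RS_iff hφ y).mpr hy, hy0⟩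
        refine Submodule.mem_iSup_of_mem (some ⟨φ, hroot⟩) (?_ : x ∈ rootAnn φ)
        have lie_mem (y : V) (hyK : y ∈ K) (hyχ : y ∈ genWeightSpace V χ) :
            ⁅p t, y⁆ ∈ rootAnn φ := by
          rw [← neg_mem_iff, hrootAnn]
          refine Submodule.subset_span ⟨t, t.2, y, (mem_RS_iff hφ y).mpr hyχ, ?_⟩
          rw [show p y = 0 from hyK, zero_lie, neg_zero, zero_add]
        obtain ⟨n, hn⟩ := (mem_genWeightSpace V _ x).mp hxχ (q t)
        induction n generalizing x with
        | zero =>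
          rw [pow_zero, Module.End.one_apply] at hn
          rw [hn]
          exact zero_mem _
        | succ n ih =>
          have hx' : ⁅p t, x⁆ - φ t • x ∈ rootAnn φ := by
            refine ih _ (sub_mem (K.lie_mem (x := q t) hxK) (K.smul_mem _ hxK))
              (sub_mem (LieSubmodule.lie_mem _ (x := q t) hxχ)
                ((genWeightSpace V χ).toSubmodule.smul_mem _ hxχ)) ?_
            rw [pow_succ, Module.End.mul_apply] at hn
            exact hn
          have := sub_mem (lie_mem x hxK hxχ) hx'
          rw [sub_sub_cancel] at this
          exact (Submodule.smul_mem_iff _ ht).mp this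

end Equivariant

section LieFactor

variable {k L 𝔤 : Type*} [Field k] [AddCommGroup L] [Module k L] [LieRing 𝔤] [LieAlgebra k 𝔤]
  (br : L →ₗ[k] L →ₗ[k] L)

theorem apply_eq_zero_of_mem_span
    (hleib : ∀ x y z : L, br (br x y) z = br x (br y z) + br (br x z) y) (x : L) {z : L}
    (hz : z ∈ Submodule.span k {z : L | ∃ x : L, z = br x x}) : br x z = 0 := by
  suffices Submodule.span k {z : L | ∃ x : L, z = br x x} ≤ LinearMap.ker (br x) from this hz
  rw [Submodule.span_le]
  rintro _ ⟨y, rfl⟩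
  simpa using hleib x y y

theorem mem_relRightLowerSeries {H : Submodule k L} {x y : L} (hx : x ∈ H) (hy : y ∈ H) (n : ℕ) :
    (br.flip y ^ n) x ∈ relRightLowerSeries br H n := by
  induction n with
  | zero => exact hx
  | succ n ih =>
    rw [pow_succ', Module.End.mul_apply]
    exact Submodule.subset_span ⟨_, ih, y, hy, rfl⟩

variable {br} (hleib : ∀ x y z : L, br (br x y) z = br x (br y z) + br (br x z) y)
  {π : L →ₗ[k] 𝔤} (hsurj : Function.Surjective π) (hbr : ∀ x y : L, π (br x y) = ⁅π x, π y⁆)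
  (hker : ∀ x z : L, π z = 0 → br x z = 0)

/-- The negated right action of a Leibniz algebra on itself, as a left module over its Lie
factor. -/
noncomputable abbrev lieFactorModule : LieRingModule 𝔤 L :=
  have key (m n n' : L) (h : π n = π n') : br m n = br m n' := by
    rw [← sub_eq_zero, ← map_sub]
    exact hker m _ (by rw [map_sub, h, sub_self])
  have hinv (x : 𝔤) : π (Function.surjInv hsurj x) = x := Function.surjInv_eq hsurj x
  { bracket x m := -br m (Function.surjInv hsurj x)
    add_lie x y m := by
      rw [← neg_add, ← map_add]
      exact congr_arg _ (key _ _ _ (by simp only [map_add, hinv]))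
    lie_add x m n := by
      rw [map_add, LinearMap.add_apply, neg_add]
    leibniz_lie x y m := by
      rw [key m (Function.surjInv hsurj ⁅x, y⁆)
        (br (Function.surjInv hsurj x) (Function.surjInv hsurj y)) (by simp only [hbr, hinv])]
      simp only [map_neg, LinearMap.neg_apply, neg_neg]
      rw [hleib m (Function.surjInv hsurj x)]
      abel }

theorem lieFactorModule_lie (n m : L) :
    (lieFactorModule hleib hsurj hbr hker).bracket (π n) m = -br m n := by
  change -br m _ = _
  rw [neg_inj, ← sub_eq_zero, ← map_sub]
  exact hker m _ (by rw [map_sub, Function.surjInv_eq hsurj, sub_self])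

theorem lieFactorModule_lieModule :
    letI := lieFactorModule hleib hsurj hbr hker
    LieModule k 𝔤 L := by
  let := lieFactorModule hleib hsurj hbr hker
  have hlie (n m : L) : ⁅π n, m⁆ = -br m n := lieFactorModule_lie hleib hsurj hbr hker n m
  constructor
  · intro t x m
    obtain ⟨n, rfl⟩ := hsurj x
    rw [← map_smul, hlie, hlie, map_smul, smul_neg]
  · intro t x m
    obtain ⟨n, rfl⟩ := hsurj x
    rw [hlie, hlie, map_smul, LinearMap.smul_apply, smul_neg]

end LieFactor

end LeibnizAlgebra

/-- Let `L` be a finite dimensional (right) Leibniz algebra over an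
algebraically closed field `k` of characteristic `0` whose Lie factor `L/L^ann` is a
semisimple Lie algebra (encoded by a bracket-compatible surjection `π` onto a semisimple Lie
algebra `𝔤` with kernel `L^ann`), and let `H` be a Cartan subalgebra of `L` (a right nilpotent
subalgebra equal to its right normalizator).  Then `H` is abelian, `⟨H, H⟩ = 0`, and
`L^ann = (H ∩ L^ann) ⊕ ⨁_{φ ∈ Δ} (L^φ)^ann`, where `Δ` is the set of roots of `L` w.r.t. `H`,
`L^φ` is the root space of `φ`, and `(L^φ)^ann = span {⟨h,v⟩ + ⟨v,h⟩ : h ∈ H, v ∈ L^φ}`. -/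
theorem leibniz_semisimple_factor_cartan_abelian_and_ann_decomposition
    (k : Type*) [Field k] [IsAlgClosed k] [CharZero k]
    (L : Type*) [AddCommGroup L] [Module k L] [FiniteDimensional k L]
    (br : L →ₗ[k] L →ₗ[k] L)
    (hleib : ∀ x y z : L, br (br x y) z = br x (br y z) + br (br x z) y)
    (Lann : Submodule k L)
    (hLann : Lann = Submodule.span k {z : L | ∃ x : L, z = br x x})
    -- the Lie factor `L / L^ann` is a semisimple Lie algebra:
    (𝔤 : Type*) [LieRing 𝔤] [LieAlgebra k 𝔤] [LieAlgebra.IsSemisimple k 𝔤]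
    (π : L →ₗ[k] 𝔤) (hπsurj : Function.Surjective π)
    (hπbr : ∀ x y : L, π (br x y) = ⁅π x, π y⁆)
    (hπker : LinearMap.ker π = Lann)
    -- `H` is a Cartan subalgebra of `L`:
    (H : Submodule k L)
    (hHsub : ∀ x ∈ H, ∀ y ∈ H, br x y ∈ H)
    (hHnilp : ∃ n : ℕ, LeibnizAlgebra.relRightLowerSeries br H n = ⊥)
    (hHnorm : ∀ x : L, (∀ h ∈ H, br x h ∈ H) ↔ x ∈ H)
    -- the root spaces `L^φ` and their annihilators `(L^φ)^ann`:
    (RS : (H →ₗ[k] k) → Set L)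
    (hRS : ∀ φ : H →ₗ[k] k, RS φ = {y : L | ∀ h : H, ∃ n : ℕ, 1 ≤ n ∧
      ((br.flip (h : L) + φ h • (1 : Module.End k L)) ^ n) y = 0})
    (rootAnn : (H →ₗ[k] k) → Submodule k L)
    (hrootAnn : ∀ φ : H →ₗ[k] k, rootAnn φ =
      Submodule.span k {z : L | ∃ h ∈ H, ∃ v ∈ RS φ, z = br h v + br v h}) :
    (∀ x ∈ H, ∀ y ∈ H, br x y = 0) ∧
    iSupIndep (fun i : Option {φ : H →ₗ[k] k // φ ≠ 0 ∧ ∃ y ∈ RS φ, y ≠ 0} =>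
      i.elim (H ⊓ Lann) (fun φ => rootAnn φ.1)) ∧
    (⨆ i : Option {φ : H →ₗ[k] k // φ ≠ 0 ∧ ∃ y ∈ RS φ, y ≠ 0},
      i.elim (H ⊓ Lann) (fun φ => rootAnn φ.1)) = Lann := by
  subst hLann
  have hker (x z : L) (hz : π z = 0) : br x z = 0 :=
    LeibnizAlgebra.apply_eq_zero_of_mem_span br hleib x (hπker ▸ LinearMap.mem_ker.mpr hz)
  let := LeibnizAlgebra.lieFactorModule hleib hπsurj hπbr hker
  have : LieModule k 𝔤 L := LeibnizAlgebra.lieFactorModule_lieModule hleib hπsurj hπbr hker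
  have hlie (n m : L) : ⁅π n, m⁆ = -br m n :=
    LeibnizAlgebra.lieFactorModule_lie hleib hπsurj hπbr hker n m
  let p : L →ₗ⁅k,𝔤⁆ 𝔤 :=
    { π with
      map_lie' := fun {x m} ↦ by
        obtain ⟨n, rfl⟩ := hπsurj x
        change π ⁅π n, m⁆ = ⁅π n, π m⁆
        rw [hlie, map_neg, hπbr, lie_skew] }
  have hp (n m : L) : ⁅p n, m⁆ = -br m n := hlie n m
  have htoEnd (n : L) : LieModule.toEnd k 𝔤 L (p n) = -br.flip n := LinearMap.ext (hp n)
  have hpow (f : Module.End k L) (n : ℕ) (x : L) : ((-f) ^ n) x = 0 ↔ (f ^ n) x = 0 := by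
    rw [neg_pow]
    rcases neg_one_pow_eq_or (Module.End k L) n with h | h <;> simp [h]
  have hsub : ∀ x ∈ H, ∀ y ∈ H, ⁅p y, x⁆ ∈ H := fun x hx y hy ↦ by
    rw [hp]
    exact neg_mem (hHsub x hx y hy)
  have hnil : ∀ x ∈ H, ∀ y ∈ H, ∃ n : ℕ, (LieModule.toEnd k 𝔤 L (p y) ^ n) x = 0 := by
    intro x hx y hy
    obtain ⟨n, hn⟩ := hHnilp
    refine ⟨n, ?_⟩
    rw [htoEnd, hpow, ← Submodule.mem_bot k, ← hn]
    exact LeibnizAlgebra.mem_relRightLowerSeries br hx hy n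
  have hnorm : ∀ x, (∀ h ∈ H, ⁅p h, x⁆ ∈ H) → x ∈ H := fun x hx ↦
    (hHnorm x).mp fun h hh ↦ by
      rw [← neg_mem_iff, ← hp]
      exact hx h hh
  refine ⟨fun x hx y hy ↦ ?_, ?_⟩
  · rw [← neg_eq_zero, ← hp]
    exact LeibnizAlgebra.lie_apply_eq_zero hsub hnil hnorm hπsurj hx hy
  · rw [← hπker]
    refine LeibnizAlgebra.iSupIndep_and_iSup_eq_ker (p := p) hπsurj hsub hnil hnorm
      (fun φ y ↦ ?_) (fun φ ↦ ?_)
    · have hneg (h : H) : LieModule.toEnd k 𝔤 L (p h) - φ h • (1 : Module.End k L) =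
          -(br.flip (h : L) + φ h • (1 : Module.End k L)) := by
        rw [htoEnd, neg_add, sub_eq_add_neg]
      rw [hRS]
      simp only [hneg, hpow]
      refine forall_congr' fun h ↦ ⟨fun ⟨n, _, hn⟩ ↦ ⟨n, hn⟩, fun ⟨n, hn⟩ ↦ ⟨n + 1, by omega, ?_⟩⟩
      rw [pow_succ', Module.End.mul_apply, hn, map_zero]
    · simp only [hrootAnn, hp, neg_neg]
end

section
/- Let L be a finite dimensional (right) Leibniz algebra over an algebraically closed field k of characteristic 0 whose Lie factor L/L^ann is a semisimple Lie algebra, let H be a Cartan subalgebra of L, and let φ be an odd root of L with respect to H, i.e., a root whose root space L^φ satisfies L^φ = (L^φ)^ann. Then there exist n ≥ 1 and a basis v_1, …, v_n of L^φ such that ⟨v_i, h⟩ = -φ(h) v_i and ⟨h, v_i⟩ = 0 for all h ∈ H and 1 ≤ i ≤ n. -/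
section Sl2
variable {K A : Type*} [Field K] [Ring A] [Algebra K A] {h e f : A}

lemma Sl2Relations.e_mul_f_pow (hef : e * f = f * e + h) (hhf : h * f = f * h - (2 : K) • f)
    (n : ℕ) :
    e * f ^ (n + 1) = f ^ (n + 1) * e + ((n : K) + 1) • (f ^ n * (h - (n : K) • 1)) := by
  induction n with
  | zero => simp [hef]
  | succ n ih =>
    have h1 : e * f ^ (n + 1 + 1) = f ^ (n + 1) * (e * f) +
        ((n : K) + 1) • (f ^ n * (h * f - (n : K) • f)) := by
      rw [pow_succ f (n + 1), ← mul_assoc, ih]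
      simp only [add_mul, sub_mul, smul_mul_assoc, one_mul, mul_assoc]
    rw [h1, hef, hhf]
    simp only [mul_add, mul_sub, mul_smul_comm, mul_one, pow_succ, mul_assoc]
    push_cast
    module

lemma Sl2Relations.h_mul_e_pow (hhe : h * e = e * h + (2 : K) • e) (n : ℕ) :
    h * e ^ n = e ^ n * h + (2 * n : K) • e ^ n := by
  induction n with
  | zero => simp
  | succ n ih =>
    rw [pow_succ, ← mul_assoc, ih, add_mul, mul_assoc, hhe]
    simp only [mul_add, mul_smul_comm, smul_mul_assoc, mul_assoc]
    push_cast
    module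

lemma Sl2Relations.commute_casimir_h (hhe : h * e = e * h + (2 : K) • e)
    (hhf : h * f = f * h - (2 : K) • f) :
    Commute ((4 : K) • (f * e) + h * h + (2 : K) • h) h := by
  have h1 : h * (f * e) = f * e * h := by
    rw [← mul_assoc, hhf, sub_mul, mul_assoc, hhe]
    simp only [mul_add, mul_smul_comm, smul_mul_assoc, mul_assoc]
    module
  simp only [Commute, SemiconjBy, add_mul, mul_add, mul_smul_comm, smul_mul_assoc, h1, mul_assoc]

lemma Sl2Relations.commute_casimir_e (hef : e * f = f * e + h)
    (hhe : h * e = e * h + (2 : K) • e) :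
    Commute ((4 : K) • (f * e) + h * h + (2 : K) • h) e := by
  have h1 : e * (f * e) = f * (e * e) + h * e := by
    rw [← mul_assoc, hef, add_mul, mul_assoc]
  have h2 : h * (h * e) = e * (h * h) + (4 : K) • (e * h) + (4 : K) • e := by
    rw [hhe, mul_add, mul_smul_comm, ← mul_assoc, hhe]
    simp only [add_mul, smul_mul_assoc, mul_assoc]
    module
  simp only [Commute, SemiconjBy, add_mul, mul_add, mul_smul_comm, smul_mul_assoc, h1, mul_assoc,
    h2]
  rw [hhe]
  module

end Sl2

section Sl2End
open Module

variable {K V : Type*} [Field K] [AddCommGroup V] [Module K V]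
  {h e f : End K V}

lemma exists_pow_apply_ne_zero_and_pow_succ_apply_eq_zero {f : End K V} (hf : IsNilpotent f)
    {v : V} (hv : v ≠ 0) : ∃ n : ℕ, (f ^ n) v ≠ 0 ∧ (f ^ (n + 1)) v = 0 := by
  obtain ⟨N, hN⟩ := hf
  exact Nat.exists_not_and_succ_of_not_zero_of_exists (p := fun n ↦ (f ^ n) v = 0) (by simpa)
    ⟨N, by simp [hN]⟩

lemma Sl2Relations.false_of_primitive [CharZero K] [FiniteDimensional K V]
    (hef : e * f = f * e + h) (hhe : h * e = e * h + (2 : K) • e)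
    (hhf : h * f = f * h - (2 : K) • f) (he : IsNilpotent e) (hf : IsNilpotent f)
    {c : K} {u v : V} (hu : u ≠ 0) (heu : e u = 0) (hhu : h u = c • u)
    (hhv : h v = c • v + u) : False := by
  have key (n : ℕ) (w : V) (hw : e w = 0) :
      e ((f ^ (n + 1)) w) = ((n : K) + 1) • (f ^ n) (h w - (n : K) • w) := by
    simpa [hw] using LinearMap.congr_fun (Sl2Relations.e_mul_f_pow hef hhf n) w
  obtain ⟨n, hn, hn'⟩ := exists_pow_apply_ne_zero_and_pow_succ_apply_eq_zero hf hu
  have hn1 (m : ℕ) : (m : K) + 1 ≠ 0 := by exact_mod_cast m.succ_ne_zero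
  have hc : c = n := by
    have := key n u heu
    rw [hn', map_zero, hhu, ← sub_smul, map_smul, smul_smul, eq_comm, smul_eq_zero] at this
    simpa [hn, hn1, sub_eq_zero] using this
  subst hc
  set C : End K V := (4 : K) • (f * e) + h * h + (2 : K) • h with hC
  set D : End K V := C - ((n : K) * n + 2 * n) • 1 with hD
  have hDh : Commute D h := (Sl2Relations.commute_casimir_h hhe hhf).sub_left
    ((Commute.one_left h).smul_left _)
  have hDe : Commute D e := (Sl2Relations.commute_casimir_e hef hhe).sub_left
    ((Commute.one_left e).smul_left _)
  have hDw {w : V} {μ : K} (hw : e w = 0) (hw' : h w = μ • w) :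
      D w = (μ * μ + 2 * μ - (n * n + 2 * n)) • w := by
    simp only [hD, hC, LinearMap.sub_apply, LinearMap.add_apply, LinearMap.smul_apply,
      Module.End.mul_apply, hw, hw', map_zero, map_smul, Module.End.one_apply]
    module
  obtain ⟨N, hN, hcompl⟩ := ((Filter.eventually_ge_atTop 1).and
    D.eventually_isCompl_ker_pow_range_pow).exists
  obtain ⟨a, ha, b, hb, rfl⟩ : ∃ a ∈ LinearMap.ker (D ^ N), ∃ b ∈ LinearMap.range (D ^ N),
      a + b = v := Submodule.mem_sup.mp (hcompl.sup_eq_top ▸ Submodule.mem_top)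
  have hDu : (D ^ N) u = 0 := by
    obtain ⟨N, rfl⟩ := Nat.exists_eq_add_of_le' hN
    simp [pow_succ, hDw heu hhu]
  have hha : h a = (n : K) • a + u := by
    have h1 : h a - (n : K) • a - u = (n : K) • b - h b := by
      rw [map_add] at hhv
      linear_combination (norm := module) hhv
    have h2 : h a - (n : K) • a - u ∈ LinearMap.ker (D ^ N) := by
      refine sub_mem (sub_mem ?_ (Submodule.smul_mem _ _ ha)) hDu
      rw [LinearMap.mem_ker] at ha ⊢
      rw [← Module.End.mul_apply, (hDh.pow_left N).eq, Module.End.mul_apply, ha, map_zero]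
    have h3 : h a - (n : K) • a - u ∈ LinearMap.range (D ^ N) := by
      rw [h1]
      refine sub_mem (Submodule.smul_mem _ _ hb) ?_
      obtain ⟨w, rfl⟩ := hb
      exact ⟨h w, by rw [← Module.End.mul_apply, (hDh.pow_left N).eq, Module.End.mul_apply]⟩
    have := Submodule.disjoint_def.mp hcompl.disjoint _ h2 h3
    rwa [sub_sub, sub_eq_zero] at this
  have hea : e a = 0 := by
    by_contra hea
    obtain ⟨j, hj, hj'⟩ := exists_pow_apply_ne_zero_and_pow_succ_apply_eq_zero he hea
    set w := (e ^ j) (e a) with hw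
    have hw1 : w = (e ^ (j + 1)) a := by rw [pow_succ, Module.End.mul_apply]
    have hew : e w = 0 := by
      rwa [pow_succ', Module.End.mul_apply] at hj'
    have hhw : h w = ((n : K) + 2 * (j + 1)) • w := by
      have := LinearMap.congr_fun (Sl2Relations.h_mul_e_pow hhe (j + 1)) a
      simp only [Module.End.mul_apply, LinearMap.add_apply, LinearMap.smul_apply, hha, map_add,
        map_smul, ← hw1] at this
      rw [this, pow_succ, Module.End.mul_apply, heu, map_zero]
      push_cast
      module
    have hDNw (m : ℕ) : (D ^ m) w = (((n : K) + 2 * (j + 1)) * (n + 2 * (j + 1)) +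
        2 * (n + 2 * (j + 1)) - (n * n + 2 * n)) ^ m • w := by
      induction m with
      | zero => simp
      | succ m ih => rw [pow_succ', Module.End.mul_apply, ih, map_smul, hDw hew hhw, smul_smul,
          pow_succ]
    have hDNw' : (D ^ N) w = 0 := by
      rw [LinearMap.mem_ker] at ha
      rw [hw1, ← Module.End.mul_apply, (hDe.pow_pow N (j + 1)).eq, Module.End.mul_apply, ha,
        map_zero]
    rw [hDNw, smul_eq_zero, or_iff_left hj] at hDNw'
    have h0 := eq_zero_of_pow_eq_zero hDNw'
    have h1 : ((4 * (j + 1) * (n + j + 2) : ℕ) : K) = 0 := by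
      push_cast
      linear_combination h0
    rw [Nat.cast_eq_zero] at h1
    simp at h1
  have hfa (m : ℕ) : (f ^ (n + 1 + m)) a ≠ 0 := by
    induction m with
    | zero =>
      intro h0
      have := key n a hea
      rw [add_zero] at h0
      rw [h0, hha, map_zero, add_sub_cancel_left, eq_comm, smul_eq_zero] at this
      exact this.elim (hn1 n) hn
    | succ m ih =>
      intro h0
      have := key (n + 1 + m) a hea
      have hu0 : (f ^ (n + 1 + m)) u = 0 := by
        rw [add_comm, pow_add, Module.End.mul_apply, hn', map_zero]
      rw [← add_assoc] at h0
      rw [h0, hha, map_zero, add_sub_right_comm, map_add, hu0, add_zero, ← sub_smul, map_smul,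
        smul_smul, eq_comm, smul_eq_zero, or_iff_left ih, mul_eq_zero, or_iff_right (hn1 _)] at this
      have h1 : ((m + 1 : ℕ) : K) = 0 := by
        push_cast at this ⊢
        linear_combination -this
      rw [Nat.cast_eq_zero] at h1
      simp at h1
  obtain ⟨m, hm⟩ := hf
  exact hfa m (by rw [pow_add, hm, mul_zero, LinearMap.zero_apply])

lemma Sl2Relations.sub_smul_apply_eq_zero [CharZero K] [FiniteDimensional K V]
    (hef : e * f = f * e + h) (hhe : h * e = e * h + (2 : K) • e)
    (hhf : h * f = f * h - (2 : K) • f) (he : IsNilpotent e) (hf : IsNilpotent f)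
    {c : K} {v : V} (hv : h (h v - c • v) = c • (h v - c • v)) : h v = c • v := by
  by_contra hne
  obtain ⟨k, hk, hk'⟩ := exists_pow_apply_ne_zero_and_pow_succ_apply_eq_zero he
    (sub_ne_zero.mpr hne)
  have hpow (w : V) : h ((e ^ k) w) = (e ^ k) (h w) + (2 * k : K) • (e ^ k) w :=
    LinearMap.congr_fun (Sl2Relations.h_mul_e_pow hhe k) w
  refine Sl2Relations.false_of_primitive (c := c + 2 * k) (v := (e ^ k) v)
    hef hhe hhf he hf hk ?_ ?_ ?_
  · rwa [pow_succ', Module.End.mul_apply] at hk'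
  · rw [hpow, hv, map_smul, add_smul]
  · rw [hpow, map_sub, map_smul]
    module

open Polynomial in
lemma Module.End.isSemisimple_of_sub_smul_apply_eq_zero [IsAlgClosed K]
    [FiniteDimensional K V]
    {f : End K V} (hf : ∀ (c : K) (v : V), f (f v - c • v) = c • (f v - c • v) → f v = c • v) :
    f.IsSemisimple := by
  refine isSemisimple_of_squarefree_aeval_eq_zero (p := minpoly K f) ?_ (minpoly.aeval K f)
  have hint := Algebra.IsIntegral.isIntegral (R := K) f
  have hne := minpoly.ne_zero hint
  rw [squarefree_iff_irreducible_sq_not_dvd_of_ne_zero hne]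
  rintro p hp ⟨q, hq⟩
  obtain ⟨c, hc⟩ := IsAlgClosed.exists_root p
    (Polynomial.degree_pos_of_irreducible hp).ne'
  obtain ⟨r, rfl⟩ := dvd_iff_isRoot.mpr hc
  have hmq : minpoly K f = (X - C c) * ((X - C c) * (r * r * q)) := by rw [hq]; ring
  have hzero : aeval f ((X - C c) * (r * r * q)) = 0 := by
    ext v
    have h0 := LinearMap.congr_fun (minpoly.aeval K f) v
    rw [hmq] at h0
    simp only [map_mul, Module.End.mul_apply, map_sub, aeval_X, aeval_C, LinearMap.sub_apply,
      Module.algebraMap_end_apply, LinearMap.zero_apply] at h0 ⊢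
    rw [sub_eq_zero]
    refine hf c _ ?_
    rw [← sub_eq_zero, ← h0]
    simp only [map_sub, smul_sub]
    abel
  have hdvd := minpoly.dvd K f hzero
  rw [hmq] at hdvd
  have hne' : (X - C c) * (r * r * q) ≠ 0 := right_ne_zero_of_mul (hmq ▸ hne)
  have := Polynomial.natDegree_le_of_dvd hdvd hne'
  rw [natDegree_mul (X_sub_C_ne_zero c) hne', natDegree_X_sub_C] at this
  omega

end Sl2End

section LieModule
open Module LieAlgebra LieModule

variable {K 𝔤 M : Type*} [Field K] [LieRing 𝔤] [LieAlgebra K 𝔤]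
  [AddCommGroup M] [Module K M] [FiniteDimensional K M] [LieRingModule 𝔤 M] [LieModule K 𝔤 M]

lemma IsSl2Triple.isSemisimple_toEnd [CharZero K] [IsAlgClosed K] {h e f : 𝔤}
    (t : IsSl2Triple h e f)
    (he : _root_.IsNilpotent (toEnd K 𝔤 M e)) (hf : _root_.IsNilpotent (toEnd K 𝔤 M f)) :
    (toEnd K 𝔤 M h).IsSemisimple := by
  refine Module.End.isSemisimple_of_sub_smul_apply_eq_zero fun c v hv ↦
    Sl2Relations.sub_smul_apply_eq_zero (e := toEnd K 𝔤 M e) (f := toEnd K 𝔤 M f)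
      ?_ ?_ ?_ he hf hv
  · ext m
    simp [← t.lie_e_f]
  · ext m
    simp [leibniz_lie h, t.lie_h_e_smul K, add_comm]
  · ext m
    simp [leibniz_lie h, t.lie_lie_smul_f K, add_comm, sub_eq_add_neg]

variable [FiniteDimensional K 𝔤]

lemma LieAlgebra.IsKilling.isSemisimple_toEnd_of_mem_isCartanSubalgebra
    [CharZero K] [IsAlgClosed K] [IsKilling K 𝔤]
    (T : LieSubalgebra K 𝔤) [T.IsCartanSubalgebra] (t : T) :
    (toEnd K 𝔤 M t).IsSemisimple := by
  have hspan : t ∈ ⨆ α : Weight K T 𝔤, ⨆ (_ : α.IsNonZero), (corootSpace α).toSubmodule := by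
    have := biSup_corootSpace_eq_top (K := K) (H := T)
    rw [← LieSubmodule.toSubmodule_inj] at this
    simp only [LieSubmodule.iSup_toSubmodule] at this
    rw [this]
    trivial
  induction hspan using Submodule.iSup_induction' with
  | zero => simp
  | add x y _ _ hx hy =>
    have hcomm : Commute (toEnd K 𝔤 M x) (toEnd K 𝔤 M y) := by
      have hxy : ⁅(x : 𝔤), (y : 𝔤)⁆ = 0 := by
        rw [← LieSubalgebra.coe_bracket, trivial_lie_zero T T x y, ZeroMemClass.coe_zero]
      ext m
      simp [leibniz_lie (x : 𝔤), hxy]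
    simpa using Module.End.IsSemisimple.add_of_commute hcomm hx hy
  | mem α x hx =>
    by_cases hα : α.IsNonZero
    · rw [iSup_pos hα, coe_corootSpace_eq_span_singleton, Submodule.mem_span_singleton] at hx
      obtain ⟨r, rfl⟩ := hx
      obtain ⟨h, e, f, ht, he, hf⟩ := exists_isSl2Triple_of_weight_isNonZero hα
      have hα' : (α : T → K) ≠ 0 := hα
      have := ht.isSemisimple_toEnd (isNilpotent_toEnd_of_mem_rootSpace (M := M) T hα' he)
        (isNilpotent_toEnd_of_mem_rootSpace (M := M) T (neg_ne_zero.mpr hα') hf)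
      rw [ht.h_eq_coroot hα he hf] at this
      simpa using Module.End.IsSemisimple_smul r this
    · rw [iSup_neg hα] at hx
      simp [(Submodule.mem_bot K).mp hx]

lemma LieSubalgebra.isCartanSubalgebra_of_map_eq (π : M →ₗ⁅K,𝔤⁆ 𝔤)
    (hπ : Function.Surjective π) (T : LieSubalgebra K 𝔤) [LieRing.IsNilpotent T]
    (H : Submodule K M) (hmap : H.map (π : M →ₗ[K] 𝔤) = T.toSubmodule)
    (hnorm : ∀ x : M, (∀ t ∈ T, ⁅t, x⁆ ∈ H) → x ∈ H) :
    T.IsCartanSubalgebra := by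
  have hH : ∀ x ∈ genWeightSpace M (0 : T → K), x ∈ H := by
    obtain ⟨n, hn⟩ := LieSubmodule.isNilpotent_iff_exists_self_le_ucs
      (genWeightSpace M (0 : T → K)) |>.mp inferInstance
    have hucs (n : ℕ) : ∀ x ∈ (⊥ : LieSubmodule K T M).ucs n, x ∈ H := by
      induction n with
      | zero => simp
      | succ n ih =>
        intro x hx
        rw [LieSubmodule.ucs_succ, LieSubmodule.mem_normalizer] at hx
        exact hnorm x fun t ht ↦ ih _ (hx ⟨t, ht⟩)
    exact fun x hx ↦ hucs n x (hn hx)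
  let π' : M →ₗ⁅K,T⁆ 𝔤 := { (π : M →ₗ[K] 𝔤) with map_lie' := fun {t m} ↦ π.map_lie t m }
  refine is_cartan_of_zeroRootSubalgebra_eq K 𝔤 T (le_antisymm ?_ (le_zeroRootSubalgebra K 𝔤 T))
  intro x hx
  replace hx : x ∈ rootSpace T (0 : T → K) := hx
  obtain ⟨y, rfl⟩ := hπ x
  have hy : y ∈ genWeightSpace M (0 : T → K) ⊔ posFittingComp K T M := by
    rw [(isCompl_genWeightSpace_zero_posFittingComp K T M).sup_eq_top]
    trivial
  obtain ⟨a, ha, b, hb, rfl⟩ := (LieSubmodule.mem_sup _ _ _).mp hy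
  have ha' : π a ∈ rootSpace T (0 : T → K) :=
    map_genWeightSpace_le π' ((LieSubmodule.mem_map _).mpr ⟨a, ha, rfl⟩)
  have hb' : π b ∈ posFittingComp K T 𝔤 :=
    map_posFittingComp_le π' ((LieSubmodule.mem_map _).mpr ⟨b, hb, rfl⟩)
  have hb0 : π b = 0 := by
    have hmem : π b ∈ rootSpace T (0 : T → K) := by
      have := sub_mem hx ha'
      rwa [map_add, add_sub_cancel_left] at this
    have := (isCompl_genWeightSpace_zero_posFittingComp K T 𝔤).inf_eq_bot
    have h2 : π b ∈ rootSpace T (0 : T → K) ⊓ posFittingComp K T 𝔤 := ⟨hmem, hb'⟩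
    rwa [rootSpace, this, LieSubmodule.mem_bot] at h2
  rw [map_add, hb0, add_zero, ← LieSubalgebra.mem_toSubmodule, ← hmap]
  exact ⟨a, hH a ha, rfl⟩

end LieModule

section Leibniz
open LieAlgebra LieModule

variable {k L 𝔤 : Type*} [Field k] [AddCommGroup L] [Module k L] [LieRing 𝔤] [LieAlgebra k 𝔤]

/-- A section `s` of a surjection `π` from a Leibniz algebra `L` onto a Lie algebra `𝔤`, whose
kernel is annihilated by right multiplication, makes `L` a Lie ring module over `𝔤` through
`⁅g, y⁆ = -⟨y, s g⟩`. -/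
@[reducible]
def LeibnizAlgebra.lieRingModule (br : L →ₗ[k] L →ₗ[k] L)
    (hleib : ∀ x y z : L, br (br x y) z = br x (br y z) + br (br x z) y)
    (π : L →ₗ[k] 𝔤) (hπbr : ∀ x y : L, π (br x y) = ⁅π x, π y⁆)
    (hker : ∀ x y : L, π y = 0 → br x y = 0) (s : 𝔤 →ₗ[k] L) (hs : ∀ g, π (s g) = g) :
    LieRingModule 𝔤 L where
  bracket g y := -br y (s g)
  add_lie x y m := by simp [add_comm]
  lie_add x m n := by simp [add_comm]
  leibniz_lie x y m := by
    have h1 : br m (s ⁅x, y⁆) = br m (br (s x) (s y)) := by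
      rw [← sub_eq_zero, ← map_sub]
      exact hker _ _ (by simp [hπbr, hs])
    have h2 := hleib m (s x) (s y)
    simp [h1, h2]

/-- The Lie ring module structure of `LeibnizAlgebra.lieRingModule` is linear. -/
lemma LeibnizAlgebra.lieModule (br : L →ₗ[k] L →ₗ[k] L)
    (hleib : ∀ x y z : L, br (br x y) z = br x (br y z) + br (br x z) y)
    (π : L →ₗ[k] 𝔤) (hπbr : ∀ x y : L, π (br x y) = ⁅π x, π y⁆)
    (hker : ∀ x y : L, π y = 0 → br x y = 0) (s : 𝔤 →ₗ[k] L) (hs : ∀ g, π (s g) = g) :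
    letI := LeibnizAlgebra.lieRingModule br hleib π hπbr hker s hs
    LieModule k 𝔤 L :=
  letI := LeibnizAlgebra.lieRingModule br hleib π hπbr hker s hs
  { smul_lie := fun t x m ↦ by
      change -br m (s (t • x)) = t • -br m (s x)
      simp
    lie_smul := fun t x m ↦ by
      change -br (t • m) (s x) = t • -br m (s x)
      simp }

lemma LeibnizAlgebra.isNilpotent_of_relRightLowerSeries_eq_bot (br : L →ₗ[k] L →ₗ[k] L)
    (π : L →ₗ[k] 𝔤) (hπbr : ∀ x y : L, π (br x y) = ⁅π x, π y⁆)
    (H : Submodule k L) {n : ℕ} (hn : LeibnizAlgebra.relRightLowerSeries br H n = ⊥)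
    (T : LieSubalgebra k 𝔤) (hT : T.toSubmodule = H.map π) : LieRing.IsNilpotent T := by
  have hmem (x : T) : ∃ y ∈ H, π y = x := by
    have : (x : 𝔤) ∈ H.map π := hT ▸ x.2
    exact this
  have hlcs (n : ℕ) : ∀ x ∈ lowerCentralSeries k T T n,
      (x : 𝔤) ∈ (LeibnizAlgebra.relRightLowerSeries br H n).map π := by
    induction n with
    | zero => exact fun x _ ↦ hmem x
    | succ n ih =>
      intro x hx
      rw [lowerCentralSeries_succ, ← LieSubmodule.mem_toSubmodule,
        LieSubmodule.lieIdeal_oper_eq_linear_span'] at hx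
      induction hx using Submodule.span_induction with
      | zero => simp
      | add x y _ _ hx hy => simpa using add_mem hx hy
      | smul a x _ hx => simpa using Submodule.smul_mem _ a hx
      | mem x hx =>
        obtain ⟨a, -, b, hb, rfl⟩ := hx
        obtain ⟨a', ha', ha⟩ := hmem a
        obtain ⟨b', hb', hb⟩ := ih b hb
        refine ⟨-br b' a', neg_mem (Submodule.subset_span ⟨b', hb', a', ha', rfl⟩), ?_⟩
        rw [map_neg, hπbr, ha, hb, lie_skew, LieSubalgebra.coe_bracket]
  have : LieModule.IsNilpotent T T := by
    rw [LieModule.isNilpotent_iff k]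
    refine ⟨n, (LieSubmodule.eq_bot_iff _).mpr fun x hx ↦ ?_⟩
    simpa [hn] using hlcs n x hx
  exact this

lemma LeibnizAlgebra.br_eq_zero_of_mem_span_squares (br : L →ₗ[k] L →ₗ[k] L)
    (hleib : ∀ x y z : L, br (br x y) z = br x (br y z) + br (br x z) y) (x : L) {y : L}
    (hy : y ∈ Submodule.span k {z : L | ∃ x : L, z = br x x}) : br x y = 0 := by
  suffices Submodule.span k {z : L | ∃ x : L, z = br x x} ≤ LinearMap.ker (br x) from this hy
  rw [Submodule.span_le]
  rintro _ ⟨z, rfl⟩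
  simpa using hleib x z z

lemma LeibnizAlgebra.br_add_br_mem_span_squares (br : L →ₗ[k] L →ₗ[k] L) (x y : L) :
    br x y + br y x ∈ Submodule.span k {z : L | ∃ x : L, z = br x x} := by
  have h : br x y + br y x = br (x + y) (x + y) - br x x - br y y := by
    simp only [map_add, LinearMap.add_apply]
    abel
  rw [h]
  exact sub_mem (sub_mem (Submodule.subset_span ⟨_, rfl⟩) (Submodule.subset_span ⟨_, rfl⟩))
    (Submodule.subset_span ⟨_, rfl⟩)

/-- Right multiplications by a Cartan subalgebra of a Leibniz algebra with semisimple Lie factor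
are semisimple. -/
lemma LeibnizAlgebra.isSemisimple_flip_of_cartan [CharZero k] [IsAlgClosed k]
    [FiniteDimensional k L] [IsSemisimple k 𝔤] (br : L →ₗ[k] L →ₗ[k] L)
    (hleib : ∀ x y z : L, br (br x y) z = br x (br y z) + br (br x z) y)
    (π : L →ₗ[k] 𝔤) (hπ : Function.Surjective π) (hπbr : ∀ x y : L, π (br x y) = ⁅π x, π y⁆)
    (hker : ∀ x y : L, π y = 0 → br x y = 0)
    (H : Submodule k L) (hH : ∀ x ∈ H, ∀ y ∈ H, br x y ∈ H)
    {n : ℕ} (hn : LeibnizAlgebra.relRightLowerSeries br H n = ⊥)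
    (hnorm : ∀ x : L, (∀ h ∈ H, br x h ∈ H) → x ∈ H) {h : L} (hh : h ∈ H) :
    Module.End.IsSemisimple (br.flip h : Module.End k L) := by
  obtain ⟨s, hs⟩ := LinearMap.exists_rightInverse_of_surjective π (LinearMap.range_eq_top.mpr hπ)
  replace hs (g : 𝔤) : π (s g) = g := LinearMap.congr_fun hs g
  let _ := LeibnizAlgebra.lieRingModule br hleib π hπbr hker s hs
  have := LeibnizAlgebra.lieModule br hleib π hπbr hker s hs
  have hact (x y : L) : ⁅π x, y⁆ = -br y x := by
    change -br y (s (π x)) = -br y x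
    rw [neg_inj, ← sub_eq_zero, ← map_sub]
    exact hker _ _ (by simp [hs])
  have : FiniteDimensional k 𝔤 := Module.Finite.of_surjective π hπ
  let T : LieSubalgebra k 𝔤 :=
    { H.map π with
      lie_mem' := by
        rintro _ _ ⟨x, hx, rfl⟩ ⟨y, hy, rfl⟩
        exact ⟨br x y, hH x hx y hy, hπbr x y⟩ }
  have hT : T.toSubmodule = H.map π := rfl
  have := LeibnizAlgebra.isNilpotent_of_relRightLowerSeries_eq_bot br π hπbr H hn T hT
  let π' : L →ₗ⁅k,𝔤⁆ 𝔤 :=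
    { π with
      map_lie' := fun {g y} ↦ by
        obtain ⟨x, rfl⟩ := hπ g
        change π ⁅π x, y⁆ = ⁅π x, π y⁆
        rw [hact, map_neg, hπbr, lie_skew] }
  have : T.IsCartanSubalgebra := by
    refine LieSubalgebra.isCartanSubalgebra_of_map_eq π' hπ T H rfl fun x hx ↦ hnorm x fun y hy ↦ ?_
    have := neg_mem (hx (π y) ⟨y, hy, rfl⟩)
    rwa [hact, neg_neg] at this
  have hss := IsKilling.isSemisimple_toEnd_of_mem_isCartanSubalgebra (M := L) T ⟨π h, h, hh, rfl⟩
  have heq : toEnd k 𝔤 L (π h) = -br.flip h := by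
    ext y
    simp [hact]
  rwa [heq, Module.End.isSemisimple_neg] at hss

end Leibniz

/-- Let `L` be a finite dimensional (right) Leibniz algebra over an
algebraically closed field `k` of characteristic `0` whose Lie factor `L/L^ann` is semisimple,
`H` a Cartan subalgebra of `L`, and `φ` an odd root (a root with `L^φ = (L^φ)^ann`).  Then
there are `n ≥ 1` and a basis `v_1, …, v_n` of `L^φ` with `⟨v_i, h⟩ = -φ(h) v_i` and
`⟨h, v_i⟩ = 0` for all `h ∈ H`. -/
theorem leibniz_odd_root_space_basis
    (k : Type*) [Field k] [IsAlgClosed k] [CharZero k]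
    (L : Type*) [AddCommGroup L] [Module k L] [FiniteDimensional k L]
    (br : L →ₗ[k] L →ₗ[k] L)
    (hleib : ∀ x y z : L, br (br x y) z = br x (br y z) + br (br x z) y)
    (Lann : Submodule k L)
    (hLann : Lann = Submodule.span k {z : L | ∃ x : L, z = br x x})
    (𝔤 : Type*) [LieRing 𝔤] [LieAlgebra k 𝔤] [LieAlgebra.IsSemisimple k 𝔤]
    (π : L →ₗ[k] 𝔤) (hπsurj : Function.Surjective π)
    (hπbr : ∀ x y : L, π (br x y) = ⁅π x, π y⁆)
    (hπker : LinearMap.ker π = Lann)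
    (H : Submodule k L)
    (hHsub : ∀ x ∈ H, ∀ y ∈ H, br x y ∈ H)
    (hHnilp : ∃ n : ℕ, LeibnizAlgebra.relRightLowerSeries br H n = ⊥)
    (hHnorm : ∀ x : L, (∀ h ∈ H, br x h ∈ H) ↔ x ∈ H)
    (φ : H →ₗ[k] k) (RS : Set L)
    (hRS : RS = {y : L | ∀ h : H, ∃ n : ℕ, 1 ≤ n ∧
      ((br.flip (h : L) + φ h • (1 : Module.End k L)) ^ n) y = 0})
    (hroot : φ ≠ 0 ∧ ∃ y ∈ RS, y ≠ 0)
    (hodd : RS = (Submodule.span k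
      {z : L | ∃ h ∈ H, ∃ v ∈ RS, z = br h v + br v h} : Set L)) :
    ∃ n : ℕ, 1 ≤ n ∧ ∃ v : Fin n → L,
      LinearIndependent k v ∧
      RS = (Submodule.span k (Set.range v) : Set L) ∧
      ∀ (i : Fin n) (h : H), br (v i) (h : L) = -(φ h) • v i ∧ br (h : L) (v i) = 0 := by
  have hker (x y : L) (hy : π y = 0) : br x y = 0 :=
    LeibnizAlgebra.br_eq_zero_of_mem_span_squares br hleib x (hLann ▸ hπker ▸ hy)
  obtain ⟨m, hm⟩ := hHnilp
  have hright (h : H) (y : L) (hy : y ∈ RS) : br y (h : L) = -(φ h) • y := by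
    have hss := LeibnizAlgebra.isSemisimple_flip_of_cartan br hleib π hπsurj hπbr hker H hHsub hm
      (fun x ↦ (hHnorm x).mp) h.2
    rw [hRS] at hy
    obtain ⟨n, -, hn⟩ := hy h
    have hmem : y ∈ Module.End.maxGenEigenspace (br.flip (h : L)) (-(φ h)) := by
      rw [Module.End.mem_maxGenEigenspace]
      exact ⟨n, by rwa [neg_smul, sub_neg_eq_add]⟩
    rw [hss.isFinitelySemisimple.maxGenEigenspace_eq_eigenspace,
      Module.End.mem_eigenspace_iff] at hmem
    simpa using hmem
  have hleft (x y : L) (hy : y ∈ RS) : br x y = 0 := by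
    refine LeibnizAlgebra.br_eq_zero_of_mem_span_squares br hleib x ?_
    rw [hodd] at hy
    refine Submodule.span_le.mpr ?_ hy
    rintro _ ⟨h, -, v, -, rfl⟩
    exact LeibnizAlgebra.br_add_br_mem_span_squares br h v
  set W := Submodule.span k {z : L | ∃ h ∈ H, ∃ v ∈ RS, z = br h v + br v h}
  obtain ⟨y, hy, hy0⟩ := hroot.2
  have hmemW (z : L) : z ∈ RS ↔ z ∈ W := by rw [hodd, SetLike.mem_coe]
  have : Nontrivial W := ⟨⟨y, (hmemW y).mp hy⟩, 0, fun h ↦ hy0 (congrArg Subtype.val h)⟩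
  let b := Module.finBasis k W
  have hb (i) : (b i : L) ∈ RS := (hmemW _).mpr (b i).2
  refine ⟨Module.finrank k W, Module.finrank_pos, fun i ↦ b i,
    b.linearIndependent.map' W.subtype W.ker_subtype, ?_,
    fun i h ↦ ⟨hright h _ (hb i), hleft h _ (hb i)⟩⟩
  have hspan : Submodule.span k (Set.range fun i ↦ (b i : L)) = W := by
    rw [show (fun i ↦ (b i : L)) = W.subtype ∘ b from rfl, Set.range_comp, Submodule.span_image,
      b.span_eq, Submodule.map_top, Submodule.range_subtype]
  rw [hspan]
  exact hodd
end

section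
/- Let L be a finite dimensional (right) Leibniz algebra over an algebraically closed field k of characteristic 0 whose Lie factor L/L^ann is a semisimple Lie algebra, let H be a Cartan subalgebra of L, and let φ be an even root of L with respect to H, i.e., a root whose root space L^φ satisfies L^φ ≠ (L^φ)^ann. Then there exist n ≥ 0, vectors v_1, …, v_n ∈ L^φ, and a nonzero vector v ∈ L^φ such that L^φ = k v_1 ⊕ ⋯ ⊕ k v_n ⊕ k v, the vectors v_i satisfy ⟨v_i, h⟩ = -φ(h) v_i and ⟨h, v_i⟩ = 0 for all h ∈ H, and v satisfies ⟨v, h⟩ = -φ(h) v and ⟨h, v⟩ ≡ φ(h) v mod (k v_1 ⊕ ⋯ ⊕ k v_n) for all h ∈ H. -/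
namespace IsSl2Triple

open LieModule

variable {K L M : Type*} [Field K] [CharZero K] [LieRing L] [LieAlgebra K L]
  [AddCommGroup M] [Module K M] [LieRingModule L M] [LieModule K L M]
  {h e f : L}

/-- In a finite-dimensional representation, some power of `e` kills any given `h`-eigenvector. -/
lemma exists_pow_toEnd_e_apply_eq_zero [FiniteDimensional K M] (t : IsSl2Triple h e f) {x : M}
    {μ : K} (hx : ⁅h, x⁆ = μ • x) : ∃ n : ℕ, ((toEnd K L M e) ^ n) x = 0 := by
  by_contra! hne
  have hinj : Function.Injective fun n : ℕ ↦ μ + 2 * n := fun a b hab ↦ by simpa using hab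
  have : Finite ℕ := (Module.End.eigenvectors_linearIndependent' (toEnd K L M h) _ hinj
    (fun n ↦ ((toEnd K L M e) ^ n) x) fun n ↦ by
      rw [Module.End.hasEigenvector_iff, Module.End.mem_eigenspace_iff]
      exact ⟨t.lie_h_pow_toEnd_e hx n, hne n⟩).finite
  exact not_finite ℕ

/-- In a finite-dimensional representation, a generalized `h`-eigenvector of height at most two
which is killed by `e` is an `h`-eigenvector. -/
lemma eq_zero_of_lie_h_eq_smul_add [FiniteDimensional K M] (t : IsSl2Triple h e f) {x y : M} {μ : K}
    (hx : ⁅h, x⁆ = μ • x + y) (hy : ⁅h, y⁆ = μ • y) (hex : ⁅e, x⁆ = 0) : y = 0 := by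
  by_contra hy0
  have hey : ⁅e, y⁆ = 0 := by
    have h1 := leibniz_lie h e x
    rw [t.lie_h_e_smul K, hex, smul_lie, hex, hx, lie_add, lie_smul, hex] at h1
    simpa using h1.symm
  have P : t.HasPrimitiveVectorWith y μ := ⟨hy0, hy, hey⟩
  obtain ⟨m, rfl⟩ := P.exists_nat
  set F := toEnd K L M f with hF
  have succ (n : ℕ) (z : M) : (F ^ (n + 1)) z = ⁅f, (F ^ n) z⁆ := by
    rw [pow_succ', Module.End.mul_apply]; rfl
  have hh (n : ℕ) : ⁅h, (F ^ n) x⁆ = ((m : K) - 2 * n) • (F ^ n) x + (F ^ n) y := by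
    induction n with
    | zero => simpa using hx
    | succ n ih =>
      rw [succ, succ, leibniz_lie h, t.lie_lie_smul_f K, ih, neg_lie, smul_lie, lie_add, lie_smul]
      push_cast
      module
  have he (n : ℕ) :
      ⁅e, (F ^ (n + 1)) x⁆ = ((n : K) + 1) • (((m : K) - n) • (F ^ n) x + (F ^ n) y) := by
    induction n with
    | zero =>
      rw [succ, leibniz_lie e, t.lie_e_f]
      simp [hex, hx]
    | succ n ih =>
      rw [succ, leibniz_lie e, t.lie_e_f, ih, hh, succ, succ, lie_smul, lie_add, lie_smul]
      push_cast
      module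
  have hFy (n : ℕ) : (F ^ (m + 1 + n)) y = 0 := by
    rw [add_comm, pow_add, Module.End.mul_apply, P.pow_toEnd_f_eq_zero_of_eq_nat rfl, map_zero]
  have hFx (n : ℕ) : (F ^ (m + 1 + n)) x ≠ 0 := by
    induction n with
    | zero =>
      intro h0
      have h1 := he m
      rw [add_zero] at h0
      rw [h0, lie_zero, sub_self, zero_smul, zero_add, eq_comm, smul_eq_zero] at h1
      exact h1.elim (Nat.cast_add_one_ne_zero m) (P.pow_toEnd_f_ne_zero_of_eq_nat rfl le_rfl)
    | succ n ih =>
      intro h0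
      have h1 := he (m + 1 + n)
      rw [add_assoc _ n 1, h0, lie_zero, hFy, add_zero, eq_comm, smul_eq_zero, smul_eq_zero] at h1
      rcases h1 with h1 | h1 | h1
      · exact Nat.cast_add_one_ne_zero _ h1
      · push_cast at h1
        have : ((n + 1 : ℕ) : K) = 0 := by push_cast; linear_combination -h1
        exact Nat.cast_ne_zero.mpr n.succ_ne_zero this
      · exact ih h1
  obtain ⟨n, hn⟩ := t.symm.exists_pow_toEnd_e_apply_eq_zero (x := (F ^ (m + 1)) x)
    (μ := -((m : K) - 2 * (m + 1 : ℕ))) <| by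
      rw [neg_lie, hh, hFy 0, add_zero, neg_smul]
  rw [← Module.End.mul_apply, ← pow_add, add_comm] at hn
  exact hFx n hn

/-- In a finite-dimensional representation, a generalized `h`-eigenvector of height at most two is
an `h`-eigenvector. -/
lemma lie_h_eq_smul_of_lie_h_eq_smul_add [FiniteDimensional K M] (t : IsSl2Triple h e f)
    {x y : M} {μ : K} (hx : ⁅h, x⁆ = μ • x + y) (hy : ⁅h, y⁆ = μ • y) : y = 0 := by
  have comm (x y : M) (μ : K) (hx : ⁅h, x⁆ = μ • x + y) :
      ⁅h, ⁅e, x⁆⁆ = (μ + 2) • ⁅e, x⁆ + ⁅e, y⁆ := by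
    rw [leibniz_lie h, t.lie_h_e_smul K, hx, smul_lie, lie_add, lie_smul]
    module
  set E := toEnd K L M e with hE
  have succ (n : ℕ) (z : M) : (E ^ (n + 1)) z = ⁅e, (E ^ n) z⁆ := by
    rw [pow_succ', Module.End.mul_apply]; rfl
  have hh (n : ℕ) : ⁅h, (E ^ n) x⁆ = (μ + 2 * n) • (E ^ n) x + (E ^ n) y := by
    induction n with
    | zero => simpa using hx
    | succ n ih =>
      rw [succ, succ, comm _ _ _ ih]
      push_cast
      module
  obtain ⟨N, hN⟩ := t.exists_pow_toEnd_e_apply_eq_zero hy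
  obtain ⟨N', hN'⟩ := t.exists_pow_toEnd_e_apply_eq_zero (x := (E ^ N) x) (μ := μ + 2 * N) <| by
    rw [hh, hN, add_zero]
  rw [← Module.End.mul_apply, ← pow_add] at hN'
  generalize N' + N = r at hN'
  clear hN N hh
  induction r generalizing x y μ with
  | zero =>
    obtain rfl : x = 0 := by simpa using hN'
    simpa using hx.symm
  | succ r ih =>
    have hey : ⁅e, y⁆ = 0 := by
      refine ih (comm _ _ _ hx) ?_ ?_
      · simpa using comm y 0 μ (by simpa using hy)
      · rwa [pow_succ, Module.End.mul_apply] at hN'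
    by_contra hy0
    have P : t.HasPrimitiveVectorWith y μ := ⟨hy0, hy, hey⟩
    obtain ⟨m, rfl⟩ := P.exists_nat
    have hz (n : ℕ) : ⁅h, (E ^ (n + 1)) x⁆ = ((m : K) + 2 * (n + 1 : ℕ)) • (E ^ (n + 1)) x := by
      induction n with
      | zero => simpa [hey, E] using comm _ _ _ hx
      | succ n ih =>
        rw [succ (n + 1)]
        have := comm _ 0 _ (by simpa using ih)
        rw [this]
        push_cast
        simp only [lie_zero]
        module
    obtain rfl | r := r
    · exact hy0 (t.eq_zero_of_lie_h_eq_smul_add hx hy (by simpa [E] using hN'))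
    · by_cases hzr : (E ^ (r + 1)) x = 0
      · exact hy0 (ih hx hy hzr)
      have Q : t.HasPrimitiveVectorWith ((E ^ (r + 1)) x) ((m : K) + 2 * (r + 1 : ℕ)) :=
        ⟨hzr, hz r, by rw [← succ]; exact hN'⟩
      set z := (E ^ (r + 1)) x with hzdef
      set F := toEnd K L M f with hF
      obtain ⟨c, hc0, hc⟩ : ∃ c : K, c ≠ 0 ∧ (E ^ (r + 1)) ((F ^ (r + 1)) z) = c • z := by
        suffices ∀ n ≤ r + 1, ∃ c : K, c ≠ 0 ∧ (E ^ n) ((F ^ n) z) = c • z from this _ le_rfl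
        intro n hn
        induction n with
        | zero => exact ⟨1, one_ne_zero, by simp⟩
        | succ n ihn =>
          obtain ⟨c, hc0, hc⟩ := ihn (by lia)
          refine ⟨((n : K) + 1) * ((m : K) + 2 * (r + 1 : ℕ) - n) * c,
            mul_ne_zero (mul_ne_zero (Nat.cast_add_one_ne_zero n) ?_) hc0, ?_⟩
          · have : ((m + 2 * (r + 1) - n : ℕ) : K) ≠ 0 := Nat.cast_ne_zero.mpr (by lia)
            rw [Nat.cast_sub (by lia)] at this
            exact_mod_cast this
          · rw [pow_succ, Module.End.mul_apply, hE, toEnd_apply_apply,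
              Q.lie_e_pow_succ_toEnd_f, ← hE, map_smul, hc, smul_smul]
      refine hy0 (ih (x := x - c⁻¹ • (F ^ (r + 1)) z) (μ := m) (y := y) ?_ hy ?_)
      · have := Q.lie_h_pow_toEnd_f (r + 1)
        rw [lie_sub, lie_smul, this, hx]
        module
      · rw [map_sub, map_smul, hc, smul_smul, inv_mul_cancel₀ hc0, one_smul, ← hzdef, sub_self]

/-- In a finite-dimensional representation of an `sl₂` triple over a field of characteristic zero,
generalized `h`-eigenvectors are `h`-eigenvectors. -/
lemma lie_h_eq_smul_of_pow_apply_eq_zero [FiniteDimensional K M] (t : IsSl2Triple h e f)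
    {x : M} {μ : K} {n : ℕ} (hx : ((toEnd K L M h - μ • 1) ^ n) x = 0) : ⁅h, x⁆ = μ • x := by
  set T := toEnd K L M h - μ • (1 : Module.End K M) with hT
  have lie_eq (z : M) : ⁅h, z⁆ = μ • z + T z := by simp [T]
  suffices T x = 0 by simpa [this] using lie_eq x
  induction n with
  | zero =>
    obtain rfl : x = 0 := by simpa using hx
    simp
  | succ n ih =>
    obtain rfl | n := n
    · simpa using hx
    refine ih ?_
    rw [pow_succ', Module.End.mul_apply]
    refine t.lie_h_eq_smul_of_lie_h_eq_smul_add (lie_eq ((T ^ n) x)) ?_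
    rw [lie_eq, ← Module.End.mul_apply, ← Module.End.mul_apply, ← pow_succ', ← pow_succ', hx,
      add_zero]

end IsSl2Triple

/-- For a semisimple Lie algebra, a Cartan subalgebra acts diagonally on every finite-dimensional
representation. -/
lemma LieAlgebra.IsKilling.lie_eq_smul_of_mem_genWeightSpace {K L M : Type*} [Field K] [CharZero K]
    [LieRing L] [LieAlgebra K L] [FiniteDimensional K L] [LieAlgebra.IsKilling K L]
    [AddCommGroup M] [Module K M] [LieRingModule L M] [LieModule K L M] [FiniteDimensional K M]
    {H : LieSubalgebra K L} [H.IsCartanSubalgebra] [LieModule.IsTriangularizable K H L]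
    {χ : H → K} {x : M} (hx : x ∈ LieModule.genWeightSpace M χ) (h : H) : ⁅h, x⁆ = χ h • x := by
  rw [LieModule.mem_genWeightSpace] at hx
  have key : ∃ μ : K, ⁅h, x⁆ = μ • x := by
    have hh : h ∈ Submodule.span K (Set.range (rootSystem H).coroot) := by
      rw [RootPairing.IsRootSystem.span_coroot_eq_top]
      exact Submodule.mem_top
    induction hh using Submodule.span_induction with
    | zero => exact ⟨0, by simp⟩
    | add a b _ _ ha hb =>
      obtain ⟨μ, hμ⟩ := ha
      obtain ⟨ν, hν⟩ := hb
      exact ⟨μ + ν, by rw [add_lie, hμ, hν, add_smul]⟩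
    | smul c a _ ha =>
      obtain ⟨μ, hμ⟩ := ha
      exact ⟨c * μ, by rw [smul_lie, hμ, mul_smul]⟩
    | mem a ha =>
      obtain ⟨α, rfl⟩ := ha
      have hα : (α : LieModule.Weight K H L).IsNonZero := LieSubalgebra.isNonZero_coe_root α
      obtain ⟨h', e, f, t, he, hf⟩ := exists_isSl2Triple_of_weight_isNonZero hα
      have hc := t.h_eq_coroot hα he hf
      obtain ⟨n, hn⟩ := hx (coroot α)
      refine ⟨χ (coroot α), ?_⟩
      rw [rootSystem_coroot_apply, LieSubalgebra.coe_bracket_of_module, ← hc]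
      refine t.lie_h_eq_smul_of_pow_apply_eq_zero (n := n) ?_
      rw [hc]
      exact hn
  obtain ⟨μ, hμ⟩ := key
  by_cases hx0 : x = 0
  · simp [hx0]
  obtain ⟨n, hn⟩ := hx h
  have hT (n : ℕ) : ((LieModule.toEnd K H M h - χ h • (1 : Module.End K M)) ^ n) x =
      (μ - χ h) ^ n • x := by
    induction n with
    | zero => simp
    | succ n ih =>
      rw [pow_succ', Module.End.mul_apply, ih, map_smul, LinearMap.sub_apply,
        LieModule.toEnd_apply_apply, hμ, LinearMap.smul_apply, Module.End.one_apply, ← sub_smul,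
        smul_smul, pow_succ]
  rw [hT, smul_eq_zero, or_iff_left hx0] at hn
  rw [hμ, sub_eq_zero.mp (eq_zero_of_pow_eq_zero hn)]

/-- The zero weight space of a quotient is the image of the zero weight space. -/
lemma LieModule.map_genWeightSpace_zero_of_surjective {R L M M₂ : Type*} [CommRing R] [LieRing L]
    [LieAlgebra R L] [LieRing.IsNilpotent L] [AddCommGroup M] [Module R M] [LieRingModule L M]
    [LieModule R L M] [AddCommGroup M₂] [Module R M₂] [LieRingModule L M₂] [LieModule R L M₂]
    [IsNoetherian R M] [IsArtinian R M] [IsNoetherian R M₂] [IsArtinian R M₂]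
    (f : M →ₗ⁅R,L⁆ M₂) (hf : Function.Surjective f) :
    (genWeightSpace M (0 : L → R)).map f = genWeightSpace M₂ (0 : L → R) := by
  refine le_antisymm (map_genWeightSpace_le f) fun y hy ↦ ?_
  obtain ⟨x, rfl⟩ := hf y
  have hx : x ∈ genWeightSpace M (0 : L → R) ⊔ posFittingComp R L M := by
    rw [(isCompl_genWeightSpace_zero_posFittingComp R L M).sup_eq_top]
    exact LieSubmodule.mem_top x
  obtain ⟨a, ha, b, hb, rfl⟩ := (LieSubmodule.mem_sup _ _ _).mp hx
  have hfa : f a ∈ genWeightSpace M₂ (0 : L → R) :=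
    map_genWeightSpace_le f (LieSubmodule.mem_map_of_mem ha)
  have hfb : f b = 0 := by
    have h1 : f b ∈ posFittingComp R L M₂ :=
      map_posFittingComp_le f (LieSubmodule.mem_map_of_mem hb)
    have h2 : f b ∈ genWeightSpace M₂ (0 : L → R) := by
      have := sub_mem hy hfa
      rwa [map_add, add_sub_cancel_left] at this
    have := (isCompl_genWeightSpace_zero_posFittingComp R L M₂).inf_eq_bot
    rw [← LieSubmodule.mem_bot (R := R) (L := L), ← this]
    exact ⟨h2, h1⟩
  rw [map_add, hfb, add_zero]
  exact LieSubmodule.mem_map_of_mem ha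

/-- A nilpotent subalgebra which is the image of a self-normalizing submodule under an equivariant
surjection onto the adjoint representation is a Cartan subalgebra. -/
lemma LieSubalgebra.isCartanSubalgebra_of_map_eq_s13 {R L M : Type*} [CommRing R] [LieRing L]
    [LieAlgebra R L] [AddCommGroup M] [Module R M] [LieRingModule L M] [LieModule R L M]
    [IsNoetherian R M] [IsArtinian R M] [IsNoetherian R L] [IsArtinian R L]
    (H : LieSubalgebra R L) [LieRing.IsNilpotent H] (f : M →ₗ⁅R,H⁆ L) (hf : Function.Surjective f)
    (N : LieSubmodule R H M) (hN : N.normalizer = N) (hmap : ∀ x ∈ N, f x ∈ H) :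
    H.IsCartanSubalgebra := by
  refine LieAlgebra.is_cartan_of_zeroRootSubalgebra_eq R L H
    (le_antisymm (fun x hx ↦ ?_) (LieAlgebra.le_zeroRootSubalgebra R L H))
  have hx' : x ∈ LieModule.genWeightSpace L (0 : H → R) := hx
  rw [← LieModule.map_genWeightSpace_zero_of_surjective f hf] at hx'
  obtain ⟨y, hy, rfl⟩ := (LieSubmodule.mem_map x).mp hx'
  refine hmap y ?_
  rw [← LieModule.iSup_ucs_eq_genWeightSpace_zero] at hy
  exact (iSup_le fun k ↦ LieSubmodule.ucs_le_of_normalizer_eq_self hN k) hy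

/-- Let `L` be a finite dimensional (right) Leibniz algebra over an
algebraically closed field `k` of characteristic `0` whose Lie factor `L/L^ann` is semisimple,
`H` a Cartan subalgebra of `L`, and `φ` an even root (a root with `L^φ ≠ (L^φ)^ann`).  Then
there are `n ≥ 0`, vectors `v_1, …, v_n ∈ L^φ` and a nonzero `v ∈ L^φ` such that
`L^φ = k v_1 ⊕ ⋯ ⊕ k v_n ⊕ k v`, with `⟨v_i, h⟩ = -φ(h) v_i`, `⟨h, v_i⟩ = 0`,
`⟨v, h⟩ = -φ(h) v` and `⟨h, v⟩ ≡ φ(h) v mod (k v_1 ⊕ ⋯ ⊕ k v_n)` for all `h ∈ H`. -/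
theorem leibniz_even_root_space_basis
    (k : Type*) [Field k] [IsAlgClosed k] [CharZero k]
    (L : Type*) [AddCommGroup L] [Module k L] [FiniteDimensional k L]
    (br : L →ₗ[k] L →ₗ[k] L)
    (hleib : ∀ x y z : L, br (br x y) z = br x (br y z) + br (br x z) y)
    (Lann : Submodule k L)
    (hLann : Lann = Submodule.span k {z : L | ∃ x : L, z = br x x})
    (𝔤 : Type*) [LieRing 𝔤] [LieAlgebra k 𝔤] [LieAlgebra.IsSemisimple k 𝔤]
    (π : L →ₗ[k] 𝔤) (hπsurj : Function.Surjective π)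
    (hπbr : ∀ x y : L, π (br x y) = ⁅π x, π y⁆)
    (hπker : LinearMap.ker π = Lann)
    (H : Submodule k L)
    (hHsub : ∀ x ∈ H, ∀ y ∈ H, br x y ∈ H)
    (hHnilp : ∃ n : ℕ, LeibnizAlgebra.relRightLowerSeries br H n = ⊥)
    (hHnorm : ∀ x : L, (∀ h ∈ H, br x h ∈ H) ↔ x ∈ H)
    (φ : H →ₗ[k] k) (RS : Set L)
    (hRS : RS = {y : L | ∀ h : H, ∃ n : ℕ, 1 ≤ n ∧
      ((br.flip (h : L) + φ h • (1 : Module.End k L)) ^ n) y = 0})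
    (hroot : φ ≠ 0 ∧ ∃ y ∈ RS, y ≠ 0)
    (heven : RS ≠ (Submodule.span k
      {z : L | ∃ h ∈ H, ∃ v ∈ RS, z = br h v + br v h} : Set L)) :
    ∃ (n : ℕ) (vs : Fin n → L) (v : L), v ≠ 0 ∧
      LinearIndependent k (Fin.snoc vs v : Fin (n + 1) → L) ∧
      RS = (Submodule.span k (Set.range (Fin.snoc vs v : Fin (n + 1) → L)) : Set L) ∧
      (∀ (i : Fin n) (h : H), br (vs i) (h : L) = -(φ h) • vs i ∧ br (h : L) (vs i) = 0) ∧
      (∀ h : H, br v (h : L) = -(φ h) • v) ∧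
      (∀ h : H, br (h : L) v - φ h • v ∈ Submodule.span k (Set.range vs)) := by
  have ann_act (y : L) : ∀ z ∈ Lann, br y z = 0 := by
    suffices Lann ≤ LinearMap.ker (br y) from this
    rw [hLann, Submodule.span_le]
    rintro _ ⟨x, rfl⟩
    simpa using hleib y x x
  have act_congr (y a b : L) (hab : π a = π b) : br y a = br y b := by
    rw [← sub_eq_zero, ← map_sub]
    exact ann_act y _ (hπker ▸ by simp [hab])
  have symm_mem (a b : L) : br a b + br b a ∈ Lann := by
    rw [← hπker, LinearMap.mem_ker, map_add, hπbr, hπbr, ← lie_skew, neg_add_cancel]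
  obtain ⟨s, hs⟩ := π.exists_rightInverse_of_surjective (LinearMap.range_eq_top.mpr hπsurj)
  replace hs (a : 𝔤) : π (s a) = a := LinearMap.congr_fun hs a
  let _ : LieRingModule 𝔤 L :=
    { bracket := fun a y ↦ -br y (s a)
      add_lie := fun a b y ↦ by simp [add_comm]
      lie_add := fun a y z ↦ by simp [add_comm]
      leibniz_lie := fun a b y ↦ by
        have h1 : br y (s ⁅a, b⁆) = br y (br (s a) (s b)) :=
          act_congr _ _ _ (by simp [hπbr, hs])
        have h2 := hleib y (s a) (s b)
        simp only [map_neg, LinearMap.neg_apply, neg_neg, h1, h2]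
        abel }
  have bracket_def (a : 𝔤) (y : L) : ⁅a, y⁆ = -br y (s a) := rfl
  let _ : LieModule k 𝔤 L :=
    { smul_lie := fun c a y ↦ by simp [bracket_def]
      lie_smul := fun c a y ↦ by simp [bracket_def] }
  have lie_eq (x y : L) : ⁅π x, y⁆ = -br y x := by
    rw [bracket_def, act_congr y (s (π x)) x (hs _)]
  have : FiniteDimensional k 𝔤 := Module.Finite.of_surjective π hπsurj
  let H₀ : LieSubalgebra k 𝔤 :=
    { H.map π with
      lie_mem' := by
        rintro _ _ ⟨x, hx, rfl⟩ ⟨y, hy, rfl⟩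
        exact ⟨br x y, hHsub x hx y hy, hπbr x y⟩ }
  have mem_H₀ (h : H) : π h ∈ H₀ := ⟨h, h.2, rfl⟩
  have exists_H₀ (a : H₀) : ∃ h : H, a = ⟨π h, mem_H₀ h⟩ := by
    obtain ⟨_, h, hh, rfl⟩ := a
    exact ⟨⟨h, hh⟩, rfl⟩
  have : LieRing.IsNilpotent H₀ := by
    obtain ⟨n, hn⟩ := hHnilp
    rw [LieRing.IsNilpotent, LieModule.isNilpotent_iff k]
    refine ⟨n, (LieSubmodule.eq_bot_iff _).mpr fun z hz ↦ ?_⟩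
    suffices ∀ n, ∀ z ∈ LieModule.lowerCentralSeries k H₀ H₀ n,
        (z : 𝔤) ∈ (LeibnizAlgebra.relRightLowerSeries br H n).map π by
      simpa [hn] using this n z hz
    intro n
    induction n with
    | zero => exact fun z _ ↦ z.2
    | succ n ih =>
      intro z hz
      rw [LieModule.lowerCentralSeries_succ, ← LieSubmodule.mem_toSubmodule,
        LieSubmodule.lieIdeal_oper_eq_linear_span'] at hz
      induction hz using Submodule.span_induction with
      | zero => simp
      | add a b _ _ ha hb => exact add_mem ha hb
      | smul c a _ ha => exact Submodule.smul_mem _ c ha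
      | mem a ha =>
        obtain ⟨x, -, m, hm, rfl⟩ := ha
        obtain ⟨h, rfl⟩ := exists_H₀ x
        obtain ⟨m', hm', hmm⟩ := ih m hm
        refine ⟨-br m' h, neg_mem (Submodule.subset_span ⟨m', hm', h, h.2, rfl⟩), ?_⟩
        rw [map_neg, hπbr, hmm, lie_skew]
        rfl
  let f : L →ₗ⁅k,H₀⁆ 𝔤 :=
    { π with
      map_lie' := fun {a y} ↦ by
        obtain ⟨h, rfl⟩ := exists_H₀ a
        change π ⁅π h, y⁆ = ⁅π h, π y⁆
        rw [lie_eq, map_neg, hπbr, lie_skew] }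
  let N : LieSubmodule k H₀ L :=
    { H with
      lie_mem := fun {a y} hy ↦ by
        obtain ⟨h, rfl⟩ := exists_H₀ a
        change ⁅π h, y⁆ ∈ H
        rw [lie_eq]
        exact neg_mem (hHsub y hy h h.2) }
  have hN : N.normalizer = N := by
    refine le_antisymm (fun y hy ↦ ?_) N.le_normalizer
    refine (hHnorm y).mp fun h hh ↦ ?_
    have h1 : ⁅π h, y⁆ ∈ H := (LieSubmodule.mem_normalizer N y).mp hy ⟨π h, mem_H₀ ⟨h, hh⟩⟩
    rw [lie_eq] at h1
    exact neg_mem_iff.mp h1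
  have : H₀.IsCartanSubalgebra :=
    H₀.isCartanSubalgebra_of_map_eq_s13 f hπsurj N hN fun x hx ↦ mem_H₀ ⟨x, hx⟩
  have mem_RS (y : L) : y ∈ RS ↔ ∀ h : H, ∃ n : ℕ, 1 ≤ n ∧
      ((br.flip (h : L) + φ h • (1 : Module.End k L)) ^ n) y = 0 := by rw [hRS]; rfl
  have φ_eq_zero (h : H) (hh : π h = 0) : φ h = 0 := by
    obtain ⟨-, y, hy, hy0⟩ := hroot
    obtain ⟨n, -, hn⟩ := (mem_RS y).mp hy h
    have : br.flip (h : L) = 0 := by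
      ext z
      exact ann_act z h (hπker ▸ hh)
    rw [this, zero_add, smul_pow, one_pow, LinearMap.smul_apply, Module.End.one_apply,
      smul_eq_zero, or_iff_left hy0] at hn
    exact eq_zero_of_pow_eq_zero hn
  choose l hl using id exists_H₀
  let χ : H₀ → k := fun a ↦ φ (l a)
  have hχ (h : H) : χ ⟨π h, mem_H₀ h⟩ = φ h := by
    rw [← sub_eq_zero, ← map_sub]
    refine φ_eq_zero _ ?_
    have := congrArg Subtype.val (hl ⟨π h, mem_H₀ h⟩)
    simpa [sub_eq_zero] using this.symm
  have mem_RS_iff (y : L) : y ∈ RS ↔ y ∈ LieModule.genWeightSpace L χ := by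
    have hT (h : H) : LieModule.toEnd k H₀ L ⟨π h, mem_H₀ h⟩ - χ ⟨π h, mem_H₀ h⟩ • 1 =
        -(br.flip (h : L) + φ h • (1 : Module.End k L)) := by
      ext z
      have : ⁅(⟨π h, mem_H₀ h⟩ : H₀), z⁆ = -br z h := lie_eq h z
      simp only [LinearMap.sub_apply, LieModule.toEnd_apply_apply, this, hχ, LinearMap.smul_apply,
        Module.End.one_apply, LinearMap.neg_apply, LinearMap.add_apply, LinearMap.flip_apply]
      abel
    have hpow (h : H) (n : ℕ) :
        ((LieModule.toEnd k H₀ L ⟨π h, mem_H₀ h⟩ - χ ⟨π h, mem_H₀ h⟩ • 1) ^ n) y = 0 ↔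
        ((br.flip (h : L) + φ h • (1 : Module.End k L)) ^ n) y = 0 := by
      rw [hT]
      rcases n.even_or_odd with hn | hn
      · rw [hn.neg_pow]
      · rw [hn.neg_pow, LinearMap.neg_apply, neg_eq_zero]
    rw [mem_RS, LieModule.mem_genWeightSpace]
    constructor
    · intro H1 a
      obtain ⟨n, -, hn⟩ := H1 (l a)
      exact ⟨n, by rw [hl a, hpow]; exact hn⟩
    · intro H1 h
      obtain ⟨n, hn⟩ := H1 ⟨π h, mem_H₀ h⟩
      refine ⟨n + 1, by lia, ?_⟩
      rw [pow_succ', Module.End.mul_apply, (hpow h n).mp hn, map_zero]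
  have act_RS (y : L) (hy : y ∈ RS) (h : H) : br y h = -(φ h) • y := by
    have h1 := LieAlgebra.IsKilling.lie_eq_smul_of_mem_genWeightSpace ((mem_RS_iff y).mp hy)
      ⟨π h, mem_H₀ h⟩
    have h2 : ⁅(⟨π h, mem_H₀ h⟩ : H₀), y⁆ = -br y h := lie_eq h y
    rw [hχ, h2] at h1
    rw [neg_smul, ← h1, neg_neg]
  obtain ⟨h₁, hh₁⟩ : ∃ h, φ h ≠ 0 := by
    by_contra! h0
    exact hroot.1 (LinearMap.ext h0)
  let V : Submodule k L := (LieModule.genWeightSpace L χ).toSubmodule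
  have RS_eq : RS = (V : Set L) := Set.ext mem_RS_iff
  obtain ⟨v, hvRS, hv⟩ : ∃ v ∈ RS, v ∉ Lann := by
    by_contra! hsub
    refine heven (Set.Subset.antisymm (fun y hy ↦ ?_) ?_)
    · have : y = (-(φ h₁))⁻¹ • (br h₁ y + br y h₁) := by
        rw [ann_act _ y (hsub y hy), zero_add, act_RS y hy, inv_smul_smul₀ (neg_ne_zero.mpr hh₁)]
      rw [this]
      exact Submodule.smul_mem _ _ (Submodule.subset_span ⟨h₁, h₁.2, y, hy, rfl⟩)
    · intro z hz
      rw [RS_eq]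
      refine (Submodule.span_le.mpr ?_ : _ ≤ V) hz
      rintro _ ⟨h, hh, y, hy, rfl⟩
      rw [ann_act _ y (hsub y hy), zero_add, act_RS y hy ⟨h, hh⟩]
      exact V.smul_mem _ ((mem_RS_iff y).mp hy)
  have hvV : v ∈ V := (mem_RS_iff v).mp hvRS
  have exists_smul (y : L) (hy : y ∈ V) : ∃ c : k, y - c • v ∈ Lann := by
    have mem_root (y : L) (hy : y ∈ V) : π y ∈ LieAlgebra.rootSpace H₀ χ :=
      LieModule.map_genWeightSpace_le f (LieSubmodule.mem_map_of_mem hy)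
    have hπv : π v ≠ 0 := fun h0 ↦ hv (hπker ▸ h0)
    let α : LieModule.Weight k H₀ 𝔤 :=
      ⟨χ, fun h0 ↦ hπv (by simpa [LieAlgebra.rootSpace, h0] using mem_root v hvV)⟩
    have hα : α.IsNonZero := fun h0 ↦ hh₁ (by
      rw [← hχ]
      exact congrFun h0 _)
    have h1 := LieAlgebra.IsKilling.finrank_rootSpace_eq_one α hα
    obtain ⟨c, hc⟩ := (finrank_eq_one_iff_of_nonzero' (⟨π v, mem_root v hvV⟩ :
      LieAlgebra.rootSpace H₀ α) (fun h0 ↦ hπv (congrArg Subtype.val h0))).mp h1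
        ⟨π y, mem_root y hy⟩
    refine ⟨c, ?_⟩
    have hc' : c • π v = π y := congrArg Subtype.val hc
    rw [← hπker, LinearMap.mem_ker, map_sub, map_smul, hc', sub_self]
  let W : Submodule k L := V ⊓ Lann
  let b := Module.finBasis k W
  have span_b : Submodule.span k (Set.range fun i ↦ (b i : L)) = W := by
    have h1 : (Set.range fun i ↦ (b i : L)) = W.subtype '' Set.range b := by
      rw [← Set.range_comp]; rfl
    rw [h1, Submodule.span_image, b.span_eq, Submodule.map_top, Submodule.range_subtype]
  have br_mem (h : H) : br (h : L) v ∈ RS := by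
    rw [mem_RS]
    intro h'
    obtain ⟨n, hn⟩ := hHnilp
    have hr (m : ℕ) : ∃ x ∈ LeibnizAlgebra.relRightLowerSeries br H m,
        ((br.flip (h' : L) + φ h' • (1 : Module.End k L)) ^ m) (br h v) = br x v := by
      induction m with
      | zero => exact ⟨h, h.2, rfl⟩
      | succ m ih =>
        obtain ⟨x, hx, hxm⟩ := ih
        refine ⟨br x h', Submodule.subset_span ⟨x, hx, h', h'.2, rfl⟩, ?_⟩
        rw [pow_succ', Module.End.mul_apply, hxm]
        simp only [LinearMap.add_apply, LinearMap.flip_apply, LinearMap.smul_apply,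
          Module.End.one_apply]
        rw [hleib x v h', act_RS v hvRS h', map_smul, neg_smul]
        abel
    refine ⟨n + 1, by lia, ?_⟩
    obtain ⟨x, hx, hxn⟩ := hr n
    rw [hn, Submodule.mem_bot] at hx
    rw [pow_succ', Module.End.mul_apply, hxn, hx, map_zero, LinearMap.zero_apply, map_zero]
  refine ⟨_, fun i ↦ (b i : L), v, fun h0 ↦ hv (h0 ▸ Lann.zero_mem), ?_, ?_, fun i h ↦ ⟨?_, ?_⟩,
    act_RS v hvRS, fun h ↦ ?_⟩
  · rw [linearIndependent_finSnoc, span_b]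
    exact ⟨b.linearIndependent.map' W.subtype W.ker_subtype, fun h ↦ hv h.2⟩
  · rw [RS_eq, Fin.range_snoc, Submodule.span_insert, span_b]
    congr 1
    refine le_antisymm (fun y hy ↦ ?_) (sup_le ?_ inf_le_left)
    · obtain ⟨c, hc⟩ := exists_smul y hy
      rw [← add_sub_cancel (c • v) y]
      exact Submodule.add_mem_sup (Submodule.smul_mem _ _ (Submodule.mem_span_singleton_self v))
        ⟨V.sub_mem hy (V.smul_mem c hvV), hc⟩
    · rwa [Submodule.span_singleton_le_iff_mem]
  · exact act_RS _ ((mem_RS_iff _).mpr (b i).2.1) h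
  · exact ann_act _ _ (b i).2.2
  · rw [span_b]
    refine ⟨V.sub_mem ((mem_RS_iff _).mp (br_mem h)) (V.smul_mem _ hvV), ?_⟩
    have := symm_mem h v
    rwa [act_RS v hvRS h, neg_smul, ← sub_eq_add_neg] at this
end

section
/- Let L be a finite dimensional simple (right) Leibniz algebra over an algebraically closed field k of characteristic 0 such that the Lie factor L/L^ann is isomorphic, as a Lie algebra over k, to the three-dimensional simple Lie algebra sl_2(k). If dim L is odd, then dim L ≥ 5 and L is standard, i.e., there exists a Lie subalgebra L̄ of L (a subspace closed under the bracket on which the bracket is a Lie bracket, equivalently a subalgebra with ⟨x,x⟩ = 0 for all x ∈ L̄) such that L = L̄ ⊕ L^ann as a direct sum of vector spaces. -/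
attribute [local instance] LieRing.ofAssociativeRing

namespace IsSl2Triple

section Casimir

variable {A : Type*} [Ring A] {h e f : A}

/-- Four times the Casimir element, `h² + 2h + 4fe`, of an `sl₂` triple in an associative ring. -/
def casimir (h e f : A) : A := h * h + 2 * h + 4 * (f * e)

lemma casimir_commute_e (t : IsSl2Triple h e f) : Commute (casimir h e f) e := by
  have hG : e * f - f * e - h = 0 := by
    simpa [Ring.lie_def, sub_eq_zero] using t.lie_e_f
  have hD : h * e - e * h - 2 * e = 0 := by
    simpa [Ring.lie_def, sub_eq_zero] using t.lie_h_e_nsmul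
  have key : casimir h e f * e - e * casimir h e f = h * (h * e - e * h - 2 * e)
      + (h * e - e * h - 2 * e) * h - 4 * ((e * f - f * e - h) * e) := by
    simp only [casimir]; noncomm_ring
  rw [hG, hD] at key
  exact sub_eq_zero.1 (by simpa using key)

lemma casimir_commute_f (t : IsSl2Triple h e f) : Commute (casimir h e f) f := by
  have hG : e * f - f * e - h = 0 := by
    simpa [Ring.lie_def, sub_eq_zero] using t.lie_e_f
  have hK : h * f - f * h + 2 * f = 0 := by
    have := t.lie_h_f_nsmul
    rw [eq_neg_iff_add_eq_zero] at this
    simpa [Ring.lie_def] using this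
  have key : casimir h e f * f - f * casimir h e f = h * (h * f - f * h + 2 * f)
      + (h * f - f * h + 2 * f) * h + 4 * (f * (e * f - f * e - h)) := by
    simp only [casimir]; noncomm_ring
  rw [hG, hK] at key
  exact sub_eq_zero.1 (by simpa using key)

lemma casimir_commute_h (t : IsSl2Triple h e f) : Commute (casimir h e f) h := by
  have hD : h * e - e * h - 2 * e = 0 := by
    simpa [Ring.lie_def, sub_eq_zero] using t.lie_h_e_nsmul
  have hK : h * f - f * h + 2 * f = 0 := by
    have := t.lie_h_f_nsmul
    rw [eq_neg_iff_add_eq_zero] at this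
    simpa [Ring.lie_def] using this
  have key : casimir h e f * h - h * casimir h e f = - (4 * (f * (h * e - e * h - 2 * e)))
      - 4 * ((h * f - f * h + 2 * f) * e) := by
    simp only [casimir]; noncomm_ring
  rw [hD, hK] at key
  exact sub_eq_zero.1 (by simpa using key)

end Casimir

section Irreducible

variable {k V : Type*} [Field k] [CharZero k] [IsAlgClosed k]
  [AddCommGroup V] [Module k V] [FiniteDimensional k V] {h e f : Module.End k V}

/-- An irreducible representation of an `sl₂` triple has a highest weight `n`: its dimension is
`n + 1` and the Casimir element acts on it by `n (n + 2)`. -/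
theorem exists_finrank_eq_and_casimir_eq [Nontrivial V] (t : IsSl2Triple h e f)
    (hirr : ∀ N : Submodule k V, (∀ v ∈ N, h v ∈ N ∧ e v ∈ N ∧ f v ∈ N) → N = ⊥ ∨ N = ⊤) :
    ∃ n : ℕ, Module.finrank k V = n + 1 ∧
      ∀ v, casimir h e f v = ((n : k) * (n + 2)) • v := by
  obtain ⟨μ, v, -, P⟩ := t.exists_hasPrimitiveVectorWith (R := k) (M := V)
  obtain ⟨n, hn⟩ := P.exists_nat
  have hfz : (f ^ (n + 1)) v = 0 := by simpa using P.pow_toEnd_f_eq_zero_of_eq_nat hn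
  have hh (i : ℕ) : h ((f ^ i) v) = ((n : k) - 2 * i) • (f ^ i) v := by
    simpa [hn] using P.lie_h_pow_toEnd_f i
  have he (i : ℕ) : e ((f ^ (i + 1)) v) = (((i : k) + 1) * (n - i)) • (f ^ i) v := by
    simpa [hn] using P.lie_e_pow_succ_toEnd_f i
  have he0 : e v = 0 := by simpa using P.lie_e
  have hf (i : ℕ) : f ((f ^ i) v) = (f ^ (i + 1)) v := by simp [pow_succ']
  let b : Fin (n + 1) → V := fun i ↦ (f ^ (i : ℕ)) v
  have hb0 (i : Fin (n + 1)) : b i ≠ 0 := by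
    simpa using P.pow_toEnd_f_ne_zero_of_eq_nat hn (Nat.lt_succ_iff.mp i.2)
  have hli : LinearIndependent k b := by
    refine Module.End.eigenvectors_linearIndependent' h (fun i : Fin (n + 1) ↦ (n : k) - 2 * i)
      (fun i j hij ↦ ?_) b (fun i ↦ ⟨by simpa using hh i, hb0 i⟩)
    simpa [Fin.ext_iff] using hij
  have hmem (i : ℕ) : (f ^ i) v ∈ Submodule.span k (Set.range b) := by
    rcases lt_or_ge i (n + 1) with hi | hi
    · exact Submodule.subset_span ⟨⟨i, hi⟩, rfl⟩
    · obtain ⟨j, rfl⟩ := Nat.exists_eq_add_of_le' hi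
      simp [pow_add f j, hfz]
  have hspan : Submodule.span k (Set.range b) = ⊤ := by
    refine (hirr _ fun w hw ↦ ?_).resolve_left fun hbot ↦ hb0 0 ?_
    · induction hw using Submodule.span_induction with
      | mem w hw =>
        obtain ⟨⟨i, hi⟩, rfl⟩ := hw
        refine ⟨?_, ?_, ?_⟩
        · simpa only [b, hh] using Submodule.smul_mem _ _ (hmem i)
        · cases i with
          | zero => simp [b, he0]
          | succ i => simpa only [b, he] using Submodule.smul_mem _ _ (hmem i)
        · simpa only [b, hf] using hmem (i + 1)
      | zero => simp
      | add x y _ _ hx hy =>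
        simp only [map_add]
        exact ⟨add_mem hx.1 hy.1, add_mem hx.2.1 hy.2.1, add_mem hx.2.2 hy.2.2⟩
      | smul c x _ hx =>
        simp only [map_smul]
        exact ⟨Submodule.smul_mem _ _ hx.1, Submodule.smul_mem _ _ hx.2.1,
          Submodule.smul_mem _ _ hx.2.2⟩
    · rw [← Submodule.mem_bot k, ← hbot]
      exact Submodule.subset_span ⟨0, rfl⟩
  refine ⟨n, ?_, fun w ↦ ?_⟩
  · simpa using Module.finrank_eq_card_basis (Module.Basis.mk hli hspan.ge)
  · have hcas (x : V) : casimir h e f x = h (h x) + (2 : k) • h x + (4 : k) • f (e x) := by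
      simp [casimir, Module.End.mul_apply, Module.End.ofNat_apply, ofNat_smul_eq_nsmul]
    have hw : w ∈ Submodule.span k (Set.range b) := hspan ▸ Submodule.mem_top
    induction hw using Submodule.span_induction with
    | mem w hw =>
      obtain ⟨⟨i, hi⟩, rfl⟩ := hw
      cases i with
      | zero =>
        have := hh 0
        simp only [b, pow_zero, Module.End.one_apply, hcas, he0, map_zero] at this ⊢
        rw [this, map_smul, this]
        simp only [Nat.cast_zero]
        module
      | succ i =>
        simp only [b, hcas, hh, he, map_smul, hf]
        push_cast
        module
    | zero => simp
    | add x y _ _ hx hy => rw [map_add, hx, hy, smul_add]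
    | smul c x _ hx => rw [map_smul, hx, smul_comm]

end Irreducible

end IsSl2Triple

namespace LieAlgebra.SpecialLinear

variable {k : Type*} [Field k]

lemma sl_apply_one_one (X : sl (Fin 2) k) : X.val 1 1 = - X.val 0 0 := by
  have := X.val.trace_fin_two
  rw [show X.val.trace = 0 from X.2] at this
  linear_combination -this

/-- The coordinates of a traceless `2 × 2` matrix. -/
def slTwoCoord : sl (Fin 2) k ≃ₗ[k] (Fin 3 → k) where
  toFun X := ![X.val 0 0, X.val 0 1, X.val 1 0]
  invFun v := ⟨!![v 0, v 1; v 2, -v 0], by simp [sl, Matrix.trace_fin_two]⟩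
  map_add' X Y := by ext i; fin_cases i <;> simp
  map_smul' c X := by ext i; fin_cases i <;> simp
  left_inv X := by
    ext i j
    fin_cases i <;> fin_cases j <;> simp [sl_apply_one_one]
  right_inv v := by ext i; fin_cases i <;> simp

lemma finrank_sl_two : Module.finrank k (sl (Fin 2) k) = 3 := by
  simp [slTwoCoord.finrank_eq]

/-- The diagonal generator of `sl₂`. -/
def slTwoH : sl (Fin 2) k := slTwoCoord.symm ![1, 0, 0]

/-- The strictly upper triangular generator of `sl₂`. -/
def slTwoE : sl (Fin 2) k := slTwoCoord.symm ![0, 1, 0]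

/-- The strictly lower triangular generator of `sl₂`. -/
def slTwoF : sl (Fin 2) k := slTwoCoord.symm ![0, 0, 1]

lemma slTwo_eq (X : sl (Fin 2) k) :
    X = X.val 0 0 • slTwoH + X.val 0 1 • slTwoE + X.val 1 0 • slTwoF := by
  ext i j
  fin_cases i <;> fin_cases j <;>
    simp [slTwoH, slTwoE, slTwoF, slTwoCoord, sl_apply_one_one]

lemma lie_slTwoE_slTwoF : ⁅(slTwoE : sl (Fin 2) k), (slTwoF : sl (Fin 2) k)⁆ = slTwoH := by
  ext i j
  fin_cases i <;> fin_cases j <;>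
    simp [slTwoH, slTwoE, slTwoF, slTwoCoord, Ring.lie_def]

lemma lie_slTwoH_slTwoE :
    ⁅(slTwoH : sl (Fin 2) k), (slTwoE : sl (Fin 2) k)⁆ = (2 : k) • slTwoE := by
  ext i j
  fin_cases i <;> fin_cases j <;>
    simp [slTwoH, slTwoE, slTwoCoord, Ring.lie_def]; norm_num

lemma lie_slTwoH_slTwoF :
    ⁅(slTwoH : sl (Fin 2) k), (slTwoF : sl (Fin 2) k)⁆ = (-2 : k) • slTwoF := by
  ext i j
  fin_cases i <;> fin_cases j <;>
    simp [slTwoH, slTwoF, slTwoCoord, Ring.lie_def]; norm_num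

lemma adjoint_casimir (X : sl (Fin 2) k) :
    ⁅(slTwoH : sl (Fin 2) k), ⁅(slTwoH : sl (Fin 2) k), X⁆⁆
      + (2 : k) • ⁅(slTwoH : sl (Fin 2) k), X⁆
      + (4 : k) • ⁅(slTwoF : sl (Fin 2) k), ⁅(slTwoE : sl (Fin 2) k), X⁆⁆ = (8 : k) • X := by
  obtain ⟨v, rfl⟩ := slTwoCoord.symm.surjective X
  ext i j
  fin_cases i <;> fin_cases j <;>
    simp [slTwoH, slTwoE, slTwoF, slTwoCoord, Ring.lie_def] <;> ring

end LieAlgebra.SpecialLinear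

open LieAlgebra.SpecialLinear


/-- Let `L` be a finite dimensional simple (right) Leibniz algebra over an
algebraically closed field `k` of characteristic `0` whose Lie factor `L/L^ann` is isomorphic
to `sl₂(k)` (encoded by a bracket-compatible surjection `π : L → sl₂(k)` with kernel `L^ann`).
If `dim L` is odd then `dim L ≥ 5` and `L` is standard: there is a Lie subalgebra `L̄` of `L`
(a subalgebra on which the bracket is alternating) with `L = L̄ ⊕ L^ann` as vector spaces. -/
theorem simple_leibniz_sl2_odd_dim_standard
    (k : Type*) [Field k] [IsAlgClosed k] [CharZero k]
    (L : Type*) [AddCommGroup L] [Module k L] [FiniteDimensional k L]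
    (br : L →ₗ[k] L →ₗ[k] L)
    (hleib : ∀ x y z : L, br (br x y) z = br x (br y z) + br (br x z) y)
    (ann : Submodule k L)
    (hann : ann = Submodule.span k {z : L | ∃ x : L, z = br x x})
    -- `L` is simple:
    (hsimple₁ : ∃ a ∈ ann, ∃ x : L, br a x ≠ 0)
    (hsimple₂ : ∀ I : Submodule k L, (∀ a ∈ I, ∀ x : L, br a x ∈ I ∧ br x a ∈ I) →
      I = ⊥ ∨ I = ann ∨ I = ⊤)
    -- the Lie factor `L/L^ann` is isomorphic to `sl₂(k)`:
    (π : L →ₗ[k] (LieAlgebra.SpecialLinear.sl (Fin 2) k))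
    (hπsurj : Function.Surjective π)
    (hπbr : ∀ x y : L, π (br x y) = ⁅π x, π y⁆)
    (hπker : LinearMap.ker π = ann)
    (hodd : Odd (Module.finrank k L)) :
    5 ≤ Module.finrank k L ∧
    ∃ Lbar : Submodule k L,
      (∀ x ∈ Lbar, ∀ y ∈ Lbar, br x y ∈ Lbar) ∧
      (∀ x ∈ Lbar, br x x = 0) ∧
      IsCompl Lbar ann := by
  have hmem_ann (a : L) : a ∈ ann ↔ π a = 0 := by rw [← hπker, LinearMap.mem_ker]
  have hright (x a : L) (ha : a ∈ ann) : br x a = 0 := by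
    rw [hann] at ha
    induction ha using Submodule.span_induction with
    | mem z hz =>
      obtain ⟨y, rfl⟩ := hz
      simpa using hleib x y y
    | zero => simp
    | add y z _ _ hy hz => rw [map_add, hy, hz, add_zero]
    | smul c y _ hy => rw [map_smul, hy, smul_zero]
  have hright_congr {y z : L} (hyz : π y = π z) (x : L) : br x y = br x z := by
    rw [← sub_eq_zero, ← map_sub]
    exact hright _ _ ((hmem_ann _).2 (by rw [map_sub, hyz, sub_self]))
  have hbr_ann (a : L) (ha : a ∈ ann) (x : L) : br a x ∈ ann := by
    rw [hmem_ann] at ha ⊢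
    rw [hπbr, ha, zero_lie]
  obtain ⟨xh, hxh⟩ := hπsurj slTwoH
  obtain ⟨xe, hxe⟩ := hπsurj slTwoE
  obtain ⟨xf, hxf⟩ := hπsurj slTwoF
  let ρ (x : L) : Module.End k L := -br.flip x
  have hρ (x y : L) : ρ x y = -br y x := rfl
  have hρ_ann (x : L) : ∀ a ∈ ann, ρ x a ∈ ann := fun a ha ↦ neg_mem (hbr_ann a ha x)
  have hπρ (x y : L) : π (ρ x y) = ⁅π x, π y⁆ := by
    rw [hρ, map_neg, hπbr, lie_skew]
  have hρ_lie (x y : L) : ⁅ρ x, ρ y⁆ = ρ (br x y) := by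
    ext z
    have h1 := hleib z y x
    have h2 : br z (br x y) = -br z (br y x) := by
      rw [← map_neg]
      exact hright_congr (by rw [map_neg, hπbr, hπbr, lie_skew]) z
    simp only [Ring.lie_def, LinearMap.sub_apply, Module.End.mul_apply, hρ, map_neg,
      LinearMap.neg_apply, neg_neg, h2, h1]
    abel
  have hρ_congr {x y : L} (hxy : π x = π y) : ρ x = ρ y := by
    ext z
    rw [hρ, hρ, hright_congr hxy]
  have hρ_eq (x : L) : ρ x = (π x).val 0 0 • ρ xh + (π x).val 0 1 • ρ xe
      + (π x).val 1 0 • ρ xf := by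
    have : ρ x = ρ ((π x).val 0 0 • xh + (π x).val 0 1 • xe + (π x).val 1 0 • xf) :=
      hρ_congr <| by simpa only [map_add, map_smul, hxh, hxe, hxf] using slTwo_eq (π x)
    rw [this]
    ext z
    simp only [hρ, map_add, map_smul, LinearMap.add_apply, LinearMap.smul_apply]
    module
  have hbr_mem (N : Submodule k L)
      (hN : ∀ a ∈ N, ρ xh a ∈ N ∧ ρ xe a ∈ N ∧ ρ xf a ∈ N) (a : L) (ha : a ∈ N) (x : L) :
      br a x ∈ N := by
    rw [← neg_mem_iff, ← hρ, hρ_eq]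
    obtain ⟨h1, h2, h3⟩ := hN a ha
    exact add_mem (add_mem (N.smul_mem _ h1) (N.smul_mem _ h2)) (N.smul_mem _ h3)
  have hef : ⁅ρ xe, ρ xf⁆ = ρ xh := by
    rw [hρ_lie]
    exact hρ_congr (by rw [hπbr, hxe, hxf, hxh, lie_slTwoE_slTwoF])
  have hhe : ⁅ρ xh, ρ xe⁆ = 2 • ρ xe := by
    rw [hρ_lie, hρ_congr (y := (2 : k) • xe)
      (by rw [hπbr, hxh, hxe, map_smul, hxe, lie_slTwoH_slTwoE])]
    ext z
    simp [hρ, two_smul]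
  have hhf : ⁅ρ xh, ρ xf⁆ = -(2 • ρ xf) := by
    rw [hρ_lie, hρ_congr (y := (-2 : k) • xf)
      (by rw [hπbr, hxh, hxf, map_smul, hxf, lie_slTwoH_slTwoF])]
    ext z
    simp [hρ, two_smul]
  let ρ' (x : L) : Module.End k ann := (ρ x).restrict (hρ_ann x)
  have hρ' (x : L) (a : ann) : (ρ' x a : L) = ρ x a := rfl
  have hef' : ⁅ρ' xe, ρ' xf⁆ = ρ' xh := by
    ext a
    simpa [Ring.lie_def, hρ'] using LinearMap.congr_fun hef (a : L)
  have hhe' : ⁅ρ' xh, ρ' xe⁆ = 2 • ρ' xe := by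
    ext a
    simpa [Ring.lie_def, hρ'] using LinearMap.congr_fun hhe (a : L)
  have hhf' : ⁅ρ' xh, ρ' xf⁆ = -(2 • ρ' xf) := by
    ext a
    simpa [Ring.lie_def, hρ'] using LinearMap.congr_fun hhf (a : L)
  obtain ⟨a₀, ha₀, x₀, hax⟩ := hsimple₁
  have h_ne : ρ' xh ≠ 0 := by
    intro h0
    have htwo (g : Module.End k ann) (hg : 2 • g = 0) : g = 0 := by
      rw [← Nat.cast_smul_eq_nsmul k] at hg
      exact (smul_eq_zero.1 hg).resolve_left (by norm_num)
    have he0 : ρ' xe = 0 := by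
      rw [h0, zero_lie] at hhe'
      exact htwo _ hhe'.symm
    have hf0 : ρ' xf = 0 := by
      rw [h0, zero_lie] at hhf'
      exact htwo _ (neg_eq_zero.1 hhf'.symm)
    refine hax ?_
    have key (x : L) (hx : ρ' x = 0) : ρ x a₀ = 0 := by
      rw [← hρ' x ⟨a₀, ha₀⟩, hx]; rfl
    rw [← neg_eq_zero, ← hρ, hρ_eq]
    simp [key _ h0, key _ he0, key _ hf0]
  have t' : IsSl2Triple (ρ' xh) (ρ' xe) (ρ' xf) := ⟨h_ne, hef', hhe', hhf'⟩
  have t : IsSl2Triple (ρ xh) (ρ xe) (ρ xf) := by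
    refine ⟨fun h0 ↦ h_ne ?_, hef, hhe, hhf⟩
    ext a
    rw [hρ', h0]; rfl
  have : Nontrivial ann :=
    ⟨⟨a₀, ha₀⟩, 0, fun h0 ↦ hax (by rw [show a₀ = 0 from congrArg Subtype.val h0]; simp)⟩
  obtain ⟨n, hfin, hcas⟩ := t'.exists_finrank_eq_and_casimir_eq (k := k) fun N hN ↦ by
    have hmap : ∀ a ∈ N.map ann.subtype, ∀ x : L,
        br a x ∈ N.map ann.subtype ∧ br x a ∈ N.map ann.subtype := by
      intro a ha x
      have ha' : a ∈ ann := by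
        obtain ⟨b, -, rfl⟩ := ha
        exact b.2
      refine ⟨hbr_mem _ ?_ a ha x, by rw [hright x a ha']; exact zero_mem _⟩
      rintro _ ⟨b, hb, rfl⟩
      obtain ⟨h1, h2, h3⟩ := hN b hb
      exact ⟨⟨_, h1, rfl⟩, ⟨_, h2, rfl⟩, ⟨_, h3, rfl⟩⟩
    have htop (hle : ann ≤ N.map ann.subtype) : N = ⊤ := by
      refine eq_top_iff.2 fun b _ ↦ ?_
      obtain ⟨c, hc, hcb⟩ := hle b.2
      rwa [← Subtype.ext hcb]
    rcases hsimple₂ _ hmap with h | h | h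
    · exact .inl (Submodule.map_injective_of_injective ann.injective_subtype
        (by rw [h, Submodule.map_bot]))
    · exact .inr (htop h.ge)
    · exact .inr (htop (h ▸ le_top))
  have hdim : Module.finrank k L = 3 + (n + 1) := by
    rw [← LinearMap.finrank_range_add_finrank_ker π, LinearMap.range_eq_top.2 hπsurj,
      finrank_top, finrank_sl_two, hπker, hfin]
  have hn : Odd n := by
    rw [hdim] at hodd
    grind
  refine ⟨by obtain ⟨m, rfl⟩ := hn; omega, ?_⟩
  let C : Module.End k L := IsSl2Triple.casimir (ρ xh) (ρ xe) (ρ xf)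
  have hC_apply (x : L) : C x = ρ xh (ρ xh x) + (2 : k) • ρ xh x + (4 : k) • ρ xf (ρ xe x) := by
    simp [C, IsSl2Triple.casimir, Module.End.mul_apply, Module.End.ofNat_apply,
      ofNat_smul_eq_nsmul]
  have hC_ann (a : L) (ha : a ∈ ann) : C a = ((n : k) * (n + 2)) • a := by
    simpa [IsSl2Triple.casimir, C, hρ', Module.End.mul_apply, Module.End.ofNat_apply]
      using congrArg Subtype.val (hcas ⟨a, ha⟩)
  have hπC (x : L) : π (C x) = (8 : k) • π x := by
    simp only [hC_apply, map_add, map_smul, hπρ, hxh, hxe, hxf, adjoint_casimir]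
  have hn8 : ((n : k) * (n + 2)) - 8 ≠ 0 := by
    intro h0
    have h1 : n * (n + 2) = 8 := by
      have : (n : k) * (n + 2) = 8 := by linear_combination h0
      exact_mod_cast this
    have h2 : n = 2 := by nlinarith
    subst h2
    exact absurd hn (by decide)
  let M : Submodule k L := C.eigenspace 8
  have hM (x : L) : x ∈ M ↔ C x = (8 : k) • x := Module.End.mem_eigenspace_iff
  have hM_comm (y : Module.End k L) (hy : Commute C y) (x : L) (hx : x ∈ M) : y x ∈ M := by
    rw [hM] at hx ⊢
    rw [← Module.End.mul_apply, hy.eq, Module.End.mul_apply, hx, map_smul]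
  have hM_br : ∀ x ∈ M, ∀ y : L, br x y ∈ M :=
    hbr_mem M fun x hx ↦ ⟨hM_comm _ t.casimir_commute_h x hx, hM_comm _ t.casimir_commute_e x hx,
      hM_comm _ t.casimir_commute_f x hx⟩
  have hdisj : ∀ x ∈ M, x ∈ ann → x = 0 := by
    intro x hx ha
    rw [hM, hC_ann x ha, ← sub_eq_zero, ← sub_smul] at hx
    exact (smul_eq_zero.1 hx).resolve_left hn8
  refine ⟨M, fun x hx y _ ↦ hM_br x hx y, fun x hx ↦ hdisj _ (hM_br x hx x) ?_,
    Submodule.disjoint_def.2 hdisj, codisjoint_iff.2 (eq_top_iff.2 fun x _ ↦ ?_)⟩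
  · rw [hann]
    exact Submodule.subset_span ⟨x, rfl⟩
  · have hy : C x - (8 : k) • x ∈ ann := by
      rw [hmem_ann, map_sub, hπC, map_smul, sub_self]
    set c : k := (n : k) * (n + 2) - 8 with hc
    have ha : c⁻¹ • (C x - (8 : k) • x) ∈ ann := ann.smul_mem _ hy
    refine Submodule.mem_sup.2 ⟨x - c⁻¹ • (C x - (8 : k) • x), ?_, _, ha, sub_add_cancel _ _⟩
    rw [hM, map_sub, hC_ann _ ha, show (n : k) * (n + 2) = c + 8 by rw [hc]; ring, add_smul,
      smul_inv_smul₀ hn8]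
    module
end

section
/- Let L be a finite dimensional simple (right) Leibniz algebra over an algebraically closed field k of characteristic 0 such that the Lie factor L/L^ann is isomorphic, as a Lie algebra over k, to the three-dimensional simple Lie algebra sl_2(k). If dim L = 6, then there exist α, β ∈ k and a basis {f, h, e, v_0, v_1, v_2} of L such that the bracket satisfies ⟨h,e⟩ = 2e + 2α v_0, ⟨e,h⟩ = -2e, ⟨h,f⟩ = -2f + β v_2, ⟨f,h⟩ = 2f, ⟨e,f⟩ = h + α v_1, ⟨f,e⟩ = -h - β v_1, ⟨v_k, h⟩ = -(2-2k) v_k, ⟨v_k, f⟩ = -v_{k+1}, ⟨v_k, e⟩ = -k(3-k) v_{k-1} for k = 0,1,2 (with v_j := 0 for j ∉ {0,1,2}), and all other brackets of basis elements equal to 0; that is, L is isomorphic as a Leibniz algebra to sl_{2,2}^{α,β}. -/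
section LieRing

attribute [local instance] LieRing.ofAssociativeRing

open LieAlgebra.SpecialLinear in
/-- The Lie algebra `sl₂` has a basis satisfying the standard relations. -/
theorem exists_standard_basis_sl_two (k : Type*) [Field k] :
    ∃ e h f : sl (Fin 2) k, ⁅e, f⁆ = h ∧ ⁅h, e⁆ = (2 : k) • e ∧ ⁅h, f⁆ = (-2 : k) • f ∧
      LinearIndependent k ![f, h, e] ∧ ∀ x : sl (Fin 2) k, ∃ a b c : k,
        x = a • f + b • h + c • e := by
  have h01 : (0 : Fin 2) ≠ 1 := by decide
  refine ⟨single 0 1 h01 1, singleSubSingle 0 1 1, single 1 0 h01.symm 1, ?_, ?_, ?_, ?_, ?_⟩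
  · ext i j
    fin_cases i <;> fin_cases j <;> simp [Ring.lie_def]
  · ext i j
    fin_cases i <;> fin_cases j <;> simp [Ring.lie_def, one_add_one_eq_two]
  · ext i j
    fin_cases i <;> fin_cases j <;> simp [Ring.lie_def, Matrix.mul_apply]
    ring
  · rw [Fintype.linearIndependent_iff]
    intro g hg
    have hentry (i j : Fin 2) := congr_fun₂ (congr_arg Subtype.val hg) i j
    intro i
    fin_cases i
    · simpa [Fin.sum_univ_three] using hentry 1 0
    · simpa [Fin.sum_univ_three] using hentry 0 0
    · simpa [Fin.sum_univ_three] using hentry 0 1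
  · intro x
    have htr : x.val 1 1 = -x.val 0 0 := by
      have h : x.val.trace = 0 := x.2
      rw [Matrix.trace_fin_two] at h
      linear_combination h
    refine ⟨x.val 1 0, x.val 0 0, x.val 0 1, ?_⟩
    ext i j
    fin_cases i <;> fin_cases j <;> simp [htr]

theorem finrank_sl_two (k : Type*) [Field k] :
    Module.finrank k (LieAlgebra.SpecialLinear.sl (Fin 2) k) = 3 := by
  obtain ⟨e, h, f, -, -, -, hli, hspan⟩ := exists_standard_basis_sl_two k
  have hspan' : ⊤ ≤ Submodule.span k (Set.range ![f, h, e]) := fun x _ ↦ by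
    obtain ⟨a, b, c, rfl⟩ := hspan x
    rw [Submodule.mem_span_range_iff_exists_fun]
    exact ⟨![a, b, c], by simp [Fin.sum_univ_three]⟩
  simpa using Module.finrank_eq_card_basis (Module.Basis.mk hli hspan')

/-- An irreducible three-dimensional representation of `sl₂` has a standard weight basis. -/
theorem exists_weight_basis_of_finrank_eq_three {k V : Type*} [Field k] [IsAlgClosed k]
    [CharZero k] [AddCommGroup V] [Module k V] (hV : Module.finrank k V = 3)
    {h e f : Module.End k V} (h_ne_zero : h ≠ 0) (hef : ∀ x, e (f x) - f (e x) = h x)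
    (hhe : ∀ x, h (e x) - e (h x) = (2 : k) • e x)
    (hhf : ∀ x, h (f x) - f (h x) = (-2 : k) • f x)
    (hirr : ∀ W : Submodule k V, (∀ w ∈ W, h w ∈ W ∧ e w ∈ W ∧ f w ∈ W) → W = ⊥ ∨ W = ⊤) :
    ∃ v₀ v₁ v₂ : V, (∀ x, ∃ a b c : k, x = a • v₀ + b • v₁ + c • v₂) ∧
      LinearIndependent k ![v₀, v₁, v₂] ∧
      h v₀ = (2 : k) • v₀ ∧ h v₁ = 0 ∧ h v₂ = (-2 : k) • v₂ ∧
      e v₀ = 0 ∧ e v₁ = (2 : k) • v₀ ∧ e v₂ = (2 : k) • v₁ ∧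
      f v₀ = v₁ ∧ f v₁ = v₂ ∧ f v₂ = 0 := by
  have t : IsSl2Triple h e f :=
    { h_ne_zero := h_ne_zero
      lie_e_f := LinearMap.ext hef
      lie_h_e_nsmul := LinearMap.ext fun x ↦ by simpa [Ring.lie_def, two_smul] using hhe x
      lie_h_f_nsmul := LinearMap.ext fun x ↦ by simpa [Ring.lie_def, two_smul] using hhf x }
  have : FiniteDimensional k V := Module.finite_of_finrank_pos (by lia)
  have : Nontrivial V := Module.nontrivial_of_finrank_pos (R := k) (by lia)
  obtain ⟨μ, m, -, P⟩ := t.exists_hasPrimitiveVectorWith (R := k) (M := V)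
  obtain ⟨n, hn⟩ := P.exists_nat
  set w : ℕ → V := fun i ↦ (f ^ i) m
  have hwh (i : ℕ) : h (w i) = ((n : k) - 2 * i) • w i := by
    have := P.lie_h_pow_toEnd_f i
    rwa [hn] at this
  have hwf (i : ℕ) : f (w i) = w (i + 1) := P.lie_f_pow_toEnd_f i
  have hwe (i : ℕ) : e (w (i + 1)) = ((i + 1) * ((n : k) - i)) • w i := by
    have := P.lie_e_pow_succ_toEnd_f i
    rwa [hn] at this
  have hwe0 : e (w 0) = 0 := P.lie_e
  have hw_ne {i : ℕ} (hi : i ≤ n) : w i ≠ 0 := P.pow_toEnd_f_ne_zero_of_eq_nat hn hi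
  have hw_zero : w (n + 1) = 0 := P.pow_toEnd_f_eq_zero_of_eq_nat hn
  have hli : LinearIndependent k (fun i : Fin (n + 1) ↦ w i) := by
    refine h.eigenvectors_linearIndependent' (fun i : Fin (n + 1) ↦ (n : k) - 2 * (i : ℕ)) ?_ _
      fun i ↦ Module.End.hasEigenvector_iff.mpr
        ⟨Module.End.mem_eigenspace_iff.mpr (hwh i), hw_ne (Nat.lt_succ_iff.mp i.2)⟩
    intro i j hij
    simpa [Fin.val_inj] using hij
  have hspan : Submodule.span k (Set.range fun i : Fin (n + 1) ↦ w i) = ⊤ := by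
    refine (hirr _ fun x hx ↦ ?_).resolve_left ?_
    · have hmem (i : ℕ) (hi : i ≤ n + 1) :
          w i ∈ Submodule.span k (Set.range fun i : Fin (n + 1) ↦ w i) := by
        rcases hi.eq_or_lt with rfl | hi
        · simp [hw_zero]
        · exact Submodule.subset_span ⟨⟨i, hi⟩, rfl⟩
      induction hx using Submodule.span_induction with
      | zero => simp
      | add x y _ _ hx hy =>
        simp only [map_add]
        exact ⟨add_mem hx.1 hy.1, add_mem hx.2.1 hy.2.1, add_mem hx.2.2 hy.2.2⟩
      | smul c x _ hx =>
        simp only [map_smul]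
        exact ⟨Submodule.smul_mem _ _ hx.1, Submodule.smul_mem _ _ hx.2.1,
          Submodule.smul_mem _ _ hx.2.2⟩
      | mem x hx =>
        obtain ⟨⟨i, hi⟩, rfl⟩ := hx
        refine ⟨?_, ?_, ?_⟩
        · simp only [hwh]
          exact Submodule.smul_mem _ _ (hmem i hi.le)
        · cases i with
          | zero => simp [hwe0]
          | succ i =>
            simp only [hwe]
            exact Submodule.smul_mem _ _ (hmem i (by lia))
        · simp only [hwf]
          exact hmem _ (by lia)
    · intro hbot
      rw [Submodule.span_eq_bot] at hbot
      exact hw_ne n.zero_le (hbot _ ⟨0, rfl⟩)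
  obtain rfl : n = 2 := by
    have := finrank_span_eq_card hli
    rw [hspan, finrank_top, hV, Fintype.card_fin] at this
    lia
  have hfun : (fun i : Fin 3 ↦ w i) = ![w 0, w 1, w 2] := by
    ext i
    fin_cases i <;> rfl
  refine ⟨w 0, w 1, w 2, ?_, ?_, ?_, ?_, ?_, hwe0, ?_, ?_, hwf 0, hwf 1, (hwf 2).trans hw_zero⟩
  · intro x
    have hx : x ∈ Submodule.span k (Set.range ![w 0, w 1, w 2]) := by
      rw [← hfun, hspan]
      trivial
    obtain ⟨c, rfl⟩ := Submodule.mem_span_range_iff_exists_fun k |>.mp hx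
    exact ⟨c 0, c 1, c 2, by simp [Fin.sum_univ_three]⟩
  · rwa [← hfun]
  · simp [hwh]
  · simp [hwh]
  · rw [hwh]; norm_num
  · simp [hwe 0]
  · rw [hwe 1]; norm_num

end LieRing

/-- An extension of the adjoint representation of `sl₂` by itself splits: a lift `x` of the highest
weight vector can be corrected to a highest weight vector generating a complement. -/
theorem exists_highest_weight_lift {k V : Type*} [Field k]
    [CharZero k] [AddCommGroup V] [Module k V] {h e f : Module.End k V}
    (hef : ∀ x, e (f x) - f (e x) = h x)
    (hhe : ∀ x, h (e x) - e (h x) = (2 : k) • e x)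
    (hhf : ∀ x, h (f x) - f (h x) = (-2 : k) • f x)
    {v₀ v₁ v₂ : V} (hli : LinearIndependent k ![v₀, v₁, v₂])
    (hv₀ : h v₀ = (2 : k) • v₀) (hv₁ : h v₁ = 0) (hv₂ : h v₂ = (-2 : k) • v₂)
    (ev₀ : e v₀ = 0) (ev₁ : e v₁ = (2 : k) • v₀) (ev₂ : e v₂ = (2 : k) • v₁)
    (fv₀ : f v₀ = v₁) (fv₁ : f v₁ = v₂) (fv₂ : f v₂ = 0)
    {x : V} (hx : ∃ a b c : k, h x = (2 : k) • x + a • v₀ + b • v₁ + c • v₂)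
    (ex : ∃ a b c : k, e x = a • v₀ + b • v₁ + c • v₂)
    (fx : ∃ a b c : k, f (f (f x)) = a • v₀ + b • v₁ + c • v₂) :
    ∃ b c : k, h (x + b • v₁ + c • v₂) = (2 : k) • (x + b • v₁ + c • v₂) ∧
      e (x + b • v₁ + c • v₂) = 0 ∧ f (f (f (x + b • v₁ + c • v₂))) = 0 := by
  have hcoeff {p q r : k} (h0 : p • v₀ + q • v₁ + r • v₂ = 0) : p = 0 ∧ q = 0 ∧ r = 0 := by
    have := Fintype.linearIndependent_iff.mp hli ![p, q, r] (by simpa [Fin.sum_univ_three] using h0)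
    exact ⟨this 0, this 1, this 2⟩
  obtain ⟨a, b, c, hx⟩ := hx
  obtain ⟨p, q, r, ex⟩ := ex
  obtain ⟨s, t, u, fx⟩ := fx
  refine ⟨b / 2, c / 4, ?_⟩
  have hy : h (x + (b / 2) • v₁ + (c / 4) • v₂) =
      (2 : k) • (x + (b / 2) • v₁ + (c / 4) • v₂) + a • v₀ := by
    simp only [map_add, map_smul, hx, hv₁, hv₂]
    module
  have ey : e (x + (b / 2) • v₁ + (c / 4) • v₂) = (p + b) • v₀ + (q + c / 2) • v₁ + r • v₂ := by
    simp only [map_add, map_smul, ex, ev₁, ev₂]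
    module
  have fy : f (f (f (x + (b / 2) • v₁ + (c / 4) • v₂))) = s • v₀ + t • v₁ + u • v₂ := by
    simp only [map_add, map_smul, fx, fv₁, fv₂, smul_zero, add_zero]
  generalize x + (b / 2) • v₁ + (c / 4) • v₂ = y at hy ey fy ⊢
  have ey0 : e y = 0 := by
    have h1 := hhe y
    rw [hy, map_add, map_smul, map_smul, ev₀, ey] at h1
    simp only [map_add, map_smul, hv₀, hv₁, hv₂] at h1
    obtain ⟨h2, h3, h4⟩ := hcoeff (p := -2 * (p + b)) (q := -4 * (q + c / 2)) (r := -6 * r) (by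
      rw [← sub_eq_zero] at h1
      rw [← h1]
      module)
    have h2 : p + b = 0 := by simpa using h2
    have h3 : q + c / 2 = 0 := by simpa using h3
    have h4 : r = 0 := by simpa using h4
    simp [ey, h2, h3, h4]
  have hfy : h (f y) = a • v₁ := by
    rw [← sub_eq_zero, ← sub_eq_zero.mpr (hhf y), hy, map_add, map_smul, map_smul, fv₀]
    module
  have hffy : h (f (f y)) = (-2 : k) • f (f y) + a • v₂ := by
    rw [← sub_eq_zero, ← sub_eq_zero.mpr (hhf (f y)), hfy, map_smul, fv₁]
    module
  have hfffy : h (f (f (f y))) = (-4 : k) • f (f (f y)) := by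
    rw [← sub_eq_zero, ← sub_eq_zero.mpr (hhf (f (f y))), hffy, map_add, map_smul, map_smul, fv₂]
    module
  have fy0 : f (f (f y)) = 0 := by
    rw [fy] at hfffy
    simp only [map_add, map_smul, hv₀, hv₁, hv₂] at hfffy
    obtain ⟨h2, h3, h4⟩ := hcoeff (p := 6 * s) (q := 4 * t) (r := 2 * u) (by
      rw [← sub_eq_zero] at hfffy
      rw [← hfffy]
      module)
    have h2 : s = 0 := by simpa using h2
    have h3 : t = 0 := by simpa using h3
    have h4 : u = 0 := by simpa using h4
    simp [fy, h2, h3, h4]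
  have efy : e (f y) = (2 : k) • y + a • v₀ := by
    rw [← hy, ← hef y, ey0, map_zero, sub_zero]
  have effy : e (f (f y)) = (2 : k) • f y + (2 * a) • v₁ := by
    have h1 := hef (f y)
    rw [hfy, efy, map_add, map_smul, map_smul, fv₀, sub_eq_iff_eq_add] at h1
    rw [h1]
    module
  have ha : a = 0 := by
    have h1 := hef (f (f y))
    rw [hffy, effy, fy0, map_zero, map_add, map_smul, map_smul, fv₁] at h1
    have := hcoeff (p := 0) (q := 0) (r := 3 * a) (by
      rw [← sub_eq_zero, ← neg_eq_zero] at h1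
      rw [← h1]
      module)
    simpa using this.2.2
  exact ⟨by simpa [ha] using hy, ey0, fy0⟩

/-- Let `L` be a finite dimensional simple (right) Leibniz algebra over an
algebraically closed field `k` of characteristic `0` whose Lie factor `L/L^ann` is isomorphic
to `sl₂(k)`.  If `dim L = 6`, then there are `α, β ∈ k` and a basis `{f, h, e, v₀, v₁, v₂}`
of `L` whose bracket satisfies the multiplication table of `sl_{2,2}^{α,β}` (with `v_j := 0`
for `j ∉ {0,1,2}` and all unlisted brackets of basis vectors equal to `0`); that is, `L` is
isomorphic as a Leibniz algebra to `sl_{2,2}^{α,β}`. -/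
theorem simple_leibniz_sl2_dim_six_classification
    (k : Type*) [Field k] [IsAlgClosed k] [CharZero k]
    (L : Type*) [AddCommGroup L] [Module k L] [FiniteDimensional k L]
    (br : L →ₗ[k] L →ₗ[k] L)
    (hleib : ∀ x y z : L, br (br x y) z = br x (br y z) + br (br x z) y)
    (ann : Submodule k L)
    (hann : ann = Submodule.span k {z : L | ∃ x : L, z = br x x})
    -- `L` is simple:
    (hsimple₁ : ∃ a ∈ ann, ∃ x : L, br a x ≠ 0)
    (hsimple₂ : ∀ I : Submodule k L, (∀ a ∈ I, ∀ x : L, br a x ∈ I ∧ br x a ∈ I) →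
      I = ⊥ ∨ I = ann ∨ I = ⊤)
    -- the Lie factor `L/L^ann` is isomorphic to `sl₂(k)`:
    (π : L →ₗ[k] (LieAlgebra.SpecialLinear.sl (Fin 2) k))
    (hπsurj : Function.Surjective π)
    (hπbr : ∀ x y : L, π (br x y) = ⁅π x, π y⁆)
    (hπker : LinearMap.ker π = ann)
    (hdim : Module.finrank k L = 6) :
    ∃ (α β : k) (F H E : L) (v : ℕ → L),
      -- `v_j = 0` for `j ∉ {0, 1, 2}`:
      (∀ j : ℕ, 2 < j → v j = 0) ∧
      -- `{f, h, e, v₀, v₁, v₂}` is a basis of `L`: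
      LinearIndependent k ![F, H, E, v 0, v 1, v 2] ∧
      Submodule.span k {F, H, E, v 0, v 1, v 2} = ⊤ ∧
      -- the multiplication table of `sl_{2,2}^{α,β}`:
      br H E = (2 : k) • E + (2 * α) • v 0 ∧
      br E H = (-2 : k) • E ∧
      br H F = (-2 : k) • F + β • v 2 ∧
      br F H = (2 : k) • F ∧
      br E F = H + α • v 1 ∧
      br F E = -H - β • v 1 ∧
      (∀ j : ℕ, j < 3 → br (v j) H = (-((2 : k) - 2 * (j : k))) • v j) ∧
      (∀ j : ℕ, j < 3 → br (v j) F = -v (j + 1)) ∧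
      (∀ j : ℕ, j < 3 → br (v j) E = (-((j : k) * (3 - (j : k)))) • v (j - 1)) ∧
      -- all other brackets of basis elements are zero:
      br F F = 0 ∧ br H H = 0 ∧ br E E = 0 ∧
      (∀ j : ℕ, j < 3 → br F (v j) = 0) ∧
      (∀ j : ℕ, j < 3 → br H (v j) = 0) ∧
      (∀ j : ℕ, j < 3 → br E (v j) = 0) ∧
      (∀ i j : ℕ, i < 3 → j < 3 → br (v i) (v j) = 0) := by
  have hann_right (x a : L) (ha : a ∈ ann) : br x a = 0 := by
    rw [hann] at ha
    induction ha using Submodule.span_induction with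
    | zero => simp
    | add y z _ _ hy hz => simp [hy, hz]
    | smul c y _ hy => simp [hy]
    | mem y hy =>
      obtain ⟨z, rfl⟩ := hy
      simpa using hleib x z z
  have hmem {x y : L} (hxy : π x = π y) : x - y ∈ ann := by
    rw [← hπker, LinearMap.sub_mem_ker_iff, hxy]
  have hcongr (z : L) {x y : L} (hxy : π x = π y) : br z x = br z y := by
    rw [← sub_eq_zero, ← map_sub]
    exact hann_right z _ (hmem hxy)
  have hann_left (x : L) {a : L} (ha : a ∈ ann) : br a x ∈ ann := by
    rw [← hπker, LinearMap.mem_ker] at ha ⊢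
    rw [hπbr, ha, zero_lie]
  obtain ⟨e, h, f, hef, hhe, hhf, -, hspan⟩ := exists_standard_basis_sl_two k
  obtain ⟨e₀, he₀⟩ := hπsurj e
  obtain ⟨h₀, hh₀⟩ := hπsurj h
  obtain ⟨f₀, hf₀⟩ := hπsurj f
  have hbr (x : L) : ∃ a b c : k, ∀ y, br y x = a • br y f₀ + b • br y h₀ + c • br y e₀ := by
    obtain ⟨a, b, c, hx⟩ := hspan (π x)
    refine ⟨a, b, c, fun y ↦ ?_⟩
    rw [hcongr y (y := a • f₀ + b • h₀ + c • e₀) (by simp [hx, he₀, hh₀, hf₀])]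
    simp
  have ref (x : L) : br (br x e₀) f₀ = br x h₀ + br (br x f₀) e₀ := by
    rw [hleib, hcongr x (y := h₀) (by rw [hπbr, he₀, hf₀, hef, hh₀])]
  have rhe (x : L) : br (br x h₀) e₀ = (2 : k) • br x e₀ + br (br x e₀) h₀ := by
    rw [hleib, hcongr x (y := (2 : k) • e₀) (by rw [hπbr, he₀, hh₀, hhe, map_smul, he₀]), map_smul]
  have rhf (x : L) : br (br x h₀) f₀ = (-2 : k) • br x f₀ + br (br x f₀) h₀ := by
    rw [hleib, hcongr x (y := (-2 : k) • f₀) (by rw [hπbr, hf₀, hh₀, hhf, map_smul, hf₀]), map_smul]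
  -- the operators `ρ x = -⟨·, x⟩` define a representation of `sl₂` on `L`
  let ρ (x : L) : Module.End k L := -br.flip x
  have hρ (x y : L) : ρ x y = -br y x := rfl
  have hρann (x : L) : ∀ a ∈ ann, ρ x a ∈ ann := fun a ha ↦ neg_mem (hann_left x ha)
  have ρef (x : L) : ρ e₀ (ρ f₀ x) - ρ f₀ (ρ e₀ x) = ρ h₀ x := by
    simp only [hρ, map_neg, LinearMap.neg_apply, neg_neg, ref]
    abel
  have ρhe (x : L) : ρ h₀ (ρ e₀ x) - ρ e₀ (ρ h₀ x) = (2 : k) • ρ e₀ x := by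
    simp only [hρ, map_neg, LinearMap.neg_apply, neg_neg, rhe]
    module
  have ρhf (x : L) : ρ h₀ (ρ f₀ x) - ρ f₀ (ρ h₀ x) = (-2 : k) • ρ f₀ x := by
    simp only [hρ, map_neg, LinearMap.neg_apply, neg_neg, rhf]
    module
  have hfin : Module.finrank k ann = 3 := by
    have := LinearMap.finrank_range_add_finrank_ker π
    rw [LinearMap.range_eq_top.mpr hπsurj, finrank_top, finrank_sl_two, hπker, hdim] at this
    lia
  obtain ⟨v₀, v₁, v₂, hvspan, hvli, hv₀, hv₁, hv₂, ev₀, ev₁, ev₂, fv₀, fv₁, fv₂⟩ :=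
    exists_weight_basis_of_finrank_eq_three hfin
      (h := (ρ h₀).restrict (hρann h₀)) (e := (ρ e₀).restrict (hρann e₀))
      (f := (ρ f₀).restrict (hρann f₀))
      (by
        intro hzero
        have hh (a : L) (ha : a ∈ ann) : br a h₀ = 0 := by
          simpa [hρ] using congr_arg Subtype.val (LinearMap.congr_fun hzero ⟨a, ha⟩)
        obtain ⟨a, ha, x, hax⟩ := hsimple₁
        have he : br a e₀ = 0 := by
          have := rhe a
          rw [hh a ha, hh _ (hann_left e₀ ha)] at this
          simpa using this.symm
        have hf : br a f₀ = 0 := by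
          have := rhf a
          rw [hh a ha, hh _ (hann_left f₀ ha)] at this
          simpa using this.symm
        obtain ⟨p, q, r, hx⟩ := hbr x
        exact hax (by simp [hx, hh a ha, he, hf]))
      (fun x ↦ Subtype.ext (ρef x)) (fun x ↦ Subtype.ext (ρhe x)) (fun x ↦ Subtype.ext (ρhf x))
      (by
        intro W hW
        have hideal : ∀ a ∈ W.map ann.subtype, ∀ x : L,
            br a x ∈ W.map ann.subtype ∧ br x a ∈ W.map ann.subtype := by
          rintro _ ⟨a, ha, rfl⟩ x
          have hmemW (y : L) (hy : (ρ y).restrict (hρann y) a ∈ W) :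
              br (ann.subtype a) y ∈ W.map ann.subtype :=
            ⟨_, neg_mem hy, by simp [hρ]⟩
          obtain ⟨hWh, hWe, hWf⟩ := hW a ha
          constructor
          · obtain ⟨p, q, r, hx⟩ := hbr x
            rw [hx]
            exact add_mem (add_mem (Submodule.smul_mem _ _ (hmemW _ hWf))
              (Submodule.smul_mem _ _ (hmemW _ hWh))) (Submodule.smul_mem _ _ (hmemW _ hWe))
          · rw [hann_right x (ann.subtype a) a.2]
            exact zero_mem _
        have hinj := Submodule.map_injective_of_injective ann.injective_subtype
        rcases hsimple₂ _ hideal with hI | hI | hI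
        · left
          exact hinj (by rw [hI, Submodule.map_bot])
        · right
          exact hinj (by rw [hI, Submodule.map_subtype_top])
        · exfalso
          have hle := Submodule.map_subtype_le ann W
          rw [hI, top_le_iff] at hle
          rw [hle, finrank_top, hdim] at hfin
          lia)
  replace hvspan {x : L} (hx : x ∈ ann) :
      ∃ a b c : k, x = a • (v₀ : L) + b • (v₁ : L) + c • (v₂ : L) := by
    obtain ⟨a, b, c, h⟩ := hvspan ⟨x, hx⟩
    exact ⟨a, b, c, congr_arg Subtype.val h⟩
  replace hvli : LinearIndependent k ![(v₀ : L), v₁, v₂] := by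
    have hcoe : ann.subtype ∘ ![v₀, v₁, v₂] = ![(v₀ : L), v₁, v₂] := by
      ext i
      fin_cases i <;> rfl
    exact hcoe ▸ hvli.map' ann.subtype (Submodule.ker_subtype _)
  have hmv₀ := v₀.2
  have hmv₁ := v₁.2
  have hmv₂ := v₂.2
  replace hv₀ := congr_arg Subtype.val hv₀
  replace hv₁ := congr_arg Subtype.val hv₁
  replace hv₂ := congr_arg Subtype.val hv₂
  replace ev₀ := congr_arg Subtype.val ev₀
  replace ev₁ := congr_arg Subtype.val ev₁
  replace ev₂ := congr_arg Subtype.val ev₂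
  replace fv₀ := congr_arg Subtype.val fv₀
  replace fv₁ := congr_arg Subtype.val fv₁
  replace fv₂ := congr_arg Subtype.val fv₂
  simp only [LinearMap.coe_restrict_apply, Submodule.coe_smul, Submodule.coe_zero]
    at hv₀ hv₁ hv₂ ev₀ ev₁ ev₂ fv₀ fv₁ fv₂
  generalize (v₀ : L) = v₀ at *
  generalize (v₁ : L) = v₁ at *
  generalize (v₂ : L) = v₂ at *
  have hπv {x : L} (hx : x ∈ ann) : π x = 0 := by rwa [← hπker] at hx
  obtain ⟨b, c, hE, eE, fE⟩ := exists_highest_weight_lift ρef ρhe ρhf hvli hv₀ hv₁ hv₂ ev₀ ev₁ ev₂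
    fv₀ fv₁ fv₂ (x := e₀)
    (by
      obtain ⟨p, q, r, hx⟩ := hvspan (hmem (x := ρ h₀ e₀) (y := (2 : k) • e₀) (by
        rw [hρ, map_neg, hπbr, he₀, hh₀, lie_skew, hhe, map_smul, he₀]))
      exact ⟨p, q, r, by rw [add_assoc, add_assoc, ← add_assoc (p • v₀), ← hx]; abel⟩)
    (hvspan (by rw [← hπker, LinearMap.mem_ker, hρ, map_neg, hπbr, lie_self, neg_zero]))
    (hvspan (by
      rw [← hπker, LinearMap.mem_ker]
      simp only [hρ, map_neg, LinearMap.neg_apply, neg_neg, hπbr, he₀, hf₀, hef, hhf]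
      simp))
  have hπE : π (e₀ + b • v₁ + c • v₂) = e := by simp [hπv hmv₁, hπv hmv₂, he₀]
  generalize e₀ + b • v₁ + c • v₂ = E at hE eE fE hπE
  simp only [hρ, map_neg, LinearMap.neg_apply, neg_neg, neg_eq_zero] at hE eE fE
  simp only [hρ] at hv₀ hv₁ hv₂ ev₀ ev₁ ev₂ fv₀ fv₁ fv₂
  obtain ⟨H, hH⟩ : ∃ H, H = br E f₀ := ⟨_, rfl⟩
  obtain ⟨F, hF⟩ : ∃ F, F = (-2⁻¹ : k) • br H f₀ := ⟨_, rfl⟩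
  have hπH : π H = h := by rw [hH, hπbr, hπE, hf₀, hef]
  have hπF : π F = f := by
    rw [hF, map_smul, hπbr, hπH, hf₀, hhf, smul_smul]
    norm_num
  have toE (x : L) : br x E = br x e₀ := hcongr x (by rw [hπE, he₀])
  have toH (x : L) : br x H = br x h₀ := hcongr x (by rw [hπH, hh₀])
  have toF (x : L) : br x F = br x f₀ := hcongr x (by rw [hπF, hf₀])
  have brEh : br E h₀ = (-2 : k) • E := by rw [neg_smul, ← hE, neg_neg]
  have brHf : br H f₀ = (-2 : k) • F := by rw [hF, smul_smul]; norm_num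
  have brHh : br H h₀ = 0 := by
    have := rhf E
    rw [brEh, map_smul, LinearMap.smul_apply, ← hH] at this
    simpa using this.symm
  have brHe : br H e₀ = (2 : k) • E := by
    have := ref E
    rw [eE, ← hH, brEh, map_zero, LinearMap.zero_apply] at this
    rw [← sub_eq_zero, this]
    module
  have brFh : br F h₀ = (2 : k) • F := by
    have := rhf H
    rw [brHh, map_zero, LinearMap.zero_apply, brHf, map_smul, LinearMap.smul_apply, ← smul_add,
      eq_comm, smul_eq_zero_iff_right (by norm_num)] at this
    rw [← sub_eq_zero, ← this]
    module
  have brFf : br F f₀ = 0 := by rw [hF, hH, map_smul, LinearMap.smul_apply, fE, smul_zero]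
  have brFe : br F e₀ = -H := by
    have := ref H
    rw [brHe, brHh, brHf, map_smul, map_smul, LinearMap.smul_apply, LinearMap.smul_apply, ← hH,
      zero_add, ← sub_eq_zero, ← neg_smul_neg, ← smul_sub,
      smul_eq_zero_iff_right (by norm_num)] at this
    rw [← sub_eq_zero, ← neg_eq_zero, ← this]
    module
  have htop : Submodule.span k {F, H, E, v₀, v₁, v₂} = ⊤ := by
    rw [eq_top_iff]
    intro x _
    obtain ⟨p, q, r, hx⟩ := hspan (π x)
    obtain ⟨s, t, u, hy⟩ := hvspan (hmem (x := x) (y := p • F + q • H + r • E)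
      (by simp [hx, hπF, hπH, hπE]))
    rw [sub_eq_iff_eq_add] at hy
    rw [hy]
    have hs {y : L} (hy : y ∈ ({F, H, E, v₀, v₁, v₂} : Set L)) (a : k) :
        a • y ∈ Submodule.span k {F, H, E, v₀, v₁, v₂} :=
      Submodule.smul_mem _ _ (Submodule.subset_span hy)
    exact add_mem (add_mem (add_mem (hs (by simp) s) (hs (by simp) t)) (hs (by simp) u))
      (add_mem (add_mem (hs (by simp) p) (hs (by simp) q)) (hs (by simp) r))
  let v : ℕ → L := fun j ↦ match j with
    | 0 => v₀
    | 1 => v₁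
    | 2 => v₂
    | _ => 0
  have hv_mem (j : ℕ) (hj : j < 3) : v j ∈ ann := by interval_cases j <;> assumption
  refine ⟨0, 0, F, H, E, v, ?_, ?_, htop, ?_, ?_, ?_, ?_, ?_, ?_, ?_, ?_, ?_, ?_, ?_, ?_,
    fun j hj ↦ hann_right _ _ (hv_mem j hj), fun j hj ↦ hann_right _ _ (hv_mem j hj),
    fun j hj ↦ hann_right _ _ (hv_mem j hj), fun i j _ hj ↦ hann_right _ _ (hv_mem j hj)⟩
  · intro j hj
    obtain ⟨i, rfl⟩ := Nat.exists_eq_add_of_lt hj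
    rw [add_right_comm, add_comm]
    rfl
  · refine linearIndependent_of_top_le_span_of_card_eq_finrank ?_ (by simp [hdim])
    rw [← htop]
    refine Submodule.span_mono fun x hx ↦ ?_
    simp only [Set.mem_insert_iff, Set.mem_singleton_iff] at hx
    rcases hx with rfl | rfl | rfl | rfl | rfl | rfl
    exacts [⟨0, rfl⟩, ⟨1, rfl⟩, ⟨2, rfl⟩, ⟨3, rfl⟩, ⟨4, rfl⟩, ⟨5, rfl⟩]
  · rw [toE, brHe]; simp
  · rw [toH, brEh]
  · rw [toF, brHf]; simp
  · rw [toH, brFh]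
  · rw [toF, ← hH]; simp
  · rw [toE, brFe]; simp
  · intro j hj
    rw [toH]
    interval_cases j
    · simpa [v, neg_eq_iff_eq_neg] using hv₀
    · simpa [v] using hv₁
    · change br v₂ h₀ = _ • v₂
      rw [neg_eq_iff_eq_neg.mp hv₂]
      module
  · intro j hj
    rw [toF]
    interval_cases j
    · exact neg_eq_iff_eq_neg.mp fv₀
    · exact neg_eq_iff_eq_neg.mp fv₁
    · exact neg_eq_iff_eq_neg.mp fv₂
  · intro j hj
    rw [toE]
    interval_cases j
    · simpa [v] using ev₀
    · change br v₁ e₀ = _ • v₀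
      rw [neg_eq_iff_eq_neg.mp ev₁]
      module
    · change br v₂ e₀ = _ • v₁
      rw [neg_eq_iff_eq_neg.mp ev₂]
      module
  · rw [toF, brFf]
  · rw [toH, brHh]
  · rw [toE, eE]
end
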